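/- Let D ⊂ ℂⁿ be a bounded α-regular domain, E ⊂ D any set, and ψ a bounded function on E with sup_E ψ < 0. Then the weighted α-subharmonic measure ω*_α(z,E,D,ψ) is α-harmonic in D \ Ē, i.e., it satisfies dd^c u ∧ α = 0 there. -/

import Mathlib

open MeasureTheory Filter Topology Complex Metric

noncomputable section

/-- Complex `n`-space. -/
abbrev Cn (n : ℕ) := Fin n → ℂ

/-- The Wirtinger derivative `∂f/∂z_j` of a (real-differentiable) function `f : ℂⁿ → ℂ`. -/
noncomputable def wdz {n : ℕ} (j : Fin n) (f : Cn n → ℂ) (z : Cn n) : ℂ :=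
  (fderiv ℝ f z (Pi.single j 1) - Complex.I * fderiv ℝ f z (Pi.single j Complex.I)) / 2

/-- The Wirtinger derivative `∂f/∂z̄_j` of a (real-differentiable) function `f : ℂⁿ → ℂ`. -/
noncomputable def wdzbar {n : ℕ} (j : Fin n) (f : Cn n → ℂ) (z : Cn n) : ℂ :=
  (fderiv ℝ f z (Pi.single j 1) + Complex.I * fderiv ℝ f z (Pi.single j Complex.I)) / 2

/-- The square of the Euclidean norm `|z|² = ∑ |z_i|²` on `ℂⁿ`. -/
noncomputable def sqNorm {n : ℕ} (z : Cn n) : ℝ := ∑ i, Complex.normSq (z i)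

/-- A closed, strictly positive differential form `α` of bidegree `(n-1, n-1)` with `C¹`
coefficients on `ℂⁿ`, recorded through its normalized coefficient matrix:  `coeff j k` is
the Hermitian positive-definite matrix `A_{jk}` such that
`dd^c u ∧ α = (∑_{j,k} A_{jk} ∂²u/∂z_j∂z̄_k) dV`.  In these terms closedness of `α`
reads `∑_j ∂A_{jk}/∂z_j = 0` for every `k` (the conjugate identity follows by
Hermitian symmetry). -/
structure AlphaForm (n : ℕ) where
  coeff : Fin n → Fin n → Cn n → ℂ
  contDiff : ∀ j k, ContDiff ℝ 1 (coeff j k)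
  hermitian : ∀ j k z, coeff k j z = starRingEnd ℂ (coeff j k z)
  strictlyPositive : ∀ z : Cn n, ∀ ξ : Fin n → ℂ, ξ ≠ 0 →
    0 < (∑ j, ∑ k, coeff j k z * ξ j * starRingEnd ℂ (ξ k)).re
  closed : ∀ k, ∀ z : Cn n, (∑ j, wdz j (coeff j k) z) = 0

/-- The second order operator `f ↦ ∑_{j,k} A_{jk} ∂²f/∂z_j∂z̄_k` representing the
top-degree form `dd^c f ∧ α` (with respect to Lebesgue measure). -/
noncomputable def alphaOp {n : ℕ} (A : AlphaForm n) (f : Cn n → ℂ) (z : Cn n) : ℂ :=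
  ∑ j, ∑ k, A.coeff j k z * wdzbar k (wdz j f) z

/-- The operator `alphaOp` applied to a real-valued function, returning the real part. -/
noncomputable def alphaOpR {n : ℕ} (A : AlphaForm n) (ω : Cn n → ℝ) (z : Cn n) : ℝ :=
  (alphaOp A (fun w => (ω w : ℂ)) z).re

/-- `u : ℂⁿ → EReal` is `α`-subharmonic on `D`: it is finite-or-`-∞`, strongly upper
semicontinuous on `D`, locally integrable on `D`, and the current `dd^c u ∧ α` is
positive, i.e. `∫_D u · (α ∧ dd^c ω) ≥ 0` for every nonnegative test function `ω` on `D`. -/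
def IsAlphaSubharmonicE {n : ℕ} (A : AlphaForm n) (D : Set (Cn n)) (u : Cn n → EReal) : Prop :=
  (∀ z ∈ D, u z ≠ ⊤) ∧
  UpperSemicontinuousOn u D ∧
  (∀ z₀ ∈ D, ∀ S : Set (Cn n),
      (∃ N ∈ 𝓝 z₀, volume (N \ S) = 0) → Filter.limsup u (𝓝[S] z₀) = u z₀) ∧
  LocallyIntegrableOn (fun z => (u z).toReal) D volume ∧
  ∀ ω : Cn n → ℝ, ContDiff ℝ (⊤ : ℕ∞) ω → HasCompactSupport ω → tsupport ω ⊆ D →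
    (∀ z, 0 ≤ ω z) → 0 ≤ ∫ z in D, (u z).toReal * alphaOpR A ω z

/-- A real-valued function is `α`-subharmonic on `D` if it is so as an `EReal`-valued
function. -/
def IsAlphaSubharmonic {n : ℕ} (A : AlphaForm n) (D : Set (Cn n)) (u : Cn n → ℝ) : Prop :=
  IsAlphaSubharmonicE A D (fun z => (u z : EReal))

/-- `h` is `α`-harmonic on the open set `U`: `dd^c h ∧ α = 0` there, in the sense of
currents. -/
def IsAlphaHarmonicOn {n : ℕ} (A : AlphaForm n) (U : Set (Cn n)) (h : Cn n → ℝ) : Prop :=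
  LocallyIntegrableOn h U volume ∧
  ∀ ω : Cn n → ℝ, ContDiff ℝ (⊤ : ℕ∞) ω → HasCompactSupport ω → tsupport ω ⊆ U →
    (∫ z in U, h z * alphaOpR A ω z) = 0

/-- `u` is strictly `α`-subharmonic on `G`: for every compact subdomain `G' ⋐ G` there is
`ε > 0` with `u - ε|z|²` `α`-subharmonic on `G'`. -/
def IsStrictlyAlphaSubharmonic {n : ℕ} (A : AlphaForm n) (G : Set (Cn n)) (u : Cn n → ℝ) :
    Prop :=
  ∀ G' : Set (Cn n), IsOpen G' → IsCompact (closure G') → closure G' ⊆ G →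
    ∃ ε > (0 : ℝ), IsAlphaSubharmonic A G' (fun z => u z - ε * sqNorm z)

/-- `D` is a bounded `α`-regular domain: a bounded domain carrying a negative
`α`-subharmonic exhaustion `ρ` with boundary limit `0`. -/
def IsAlphaRegularDomain {n : ℕ} (A : AlphaForm n) (D : Set (Cn n)) : Prop :=
  IsOpen D ∧ IsConnected D ∧ Bornology.IsBounded D ∧
  ∃ ρ : Cn n → ℝ, IsAlphaSubharmonic A D ρ ∧ (∀ z ∈ D, ρ z < 0) ∧
    ∀ ζ ∈ frontier D, Filter.Tendsto ρ (𝓝[D] ζ) (𝓝 0)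

/-- `D` is a strongly `α`-regular domain: `D = {ρ < 0}` for some `ρ` which is `C²` and
strictly `α`-subharmonic on a neighborhood `D⁺` of `closure D`. -/
def IsStronglyAlphaRegularDomain {n : ℕ} (A : AlphaForm n) (D : Set (Cn n)) : Prop :=
  IsOpen D ∧ IsConnected D ∧ Bornology.IsBounded D ∧
  ∃ Dp : Set (Cn n), IsOpen Dp ∧ closure D ⊆ Dp ∧
    ∃ ρ : Cn n → ℝ, ContDiffOn ℝ 2 ρ Dp ∧ IsStrictlyAlphaSubharmonic A Dp ρ ∧
      D = {z ∈ Dp | ρ z < 0}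

/-- The class `U(E, D, ψ)` of `α`-subharmonic functions `u` on `D` with `u ≤ ψ` on `E`
and `u < 0` on `D`. -/
def Uclass {n : ℕ} (A : AlphaForm n) (E D : Set (Cn n)) (ψ : Cn n → ℝ) :
    Set (Cn n → ℝ) :=
  {u | IsAlphaSubharmonic A D u ∧ (∀ z ∈ E, u z ≤ ψ z) ∧ ∀ z ∈ D, u z < 0}

/-- The weighted extremal function `ω_α(z, E, D, ψ)`. -/
noncomputable def omegaW {n : ℕ} (A : AlphaForm n) (E D : Set (Cn n)) (ψ : Cn n → ℝ)
    (z : Cn n) : ℝ :=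
  sSup ((fun u : Cn n → ℝ => u z) '' Uclass A E D ψ)

/-- The weighted `α`-subharmonic measure `ω*_α(z, E, D, ψ)`: the upper semicontinuous
regularization of `ω_α(·, E, D, ψ)`. -/
noncomputable def omegaWStar {n : ℕ} (A : AlphaForm n) (E D : Set (Cn n)) (ψ : Cn n → ℝ)
    (z : Cn n) : ℝ :=
  Filter.limsup (omegaW A E D ψ) (𝓝 z)

/-- The (unweighted) extremal function `ω_α(z, E, D)`. -/
noncomputable def omega0 {n : ℕ} (A : AlphaForm n) (E D : Set (Cn n)) : Cn n → ℝ :=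
  omegaW A E D (fun _ => (-1 : ℝ))

/-- The (unweighted) `α`-subharmonic measure `ω*_α(z, E, D)`. -/
noncomputable def omega0Star {n : ℕ} (A : AlphaForm n) (E D : Set (Cn n)) : Cn n → ℝ :=
  omegaWStar A E D (fun _ => (-1 : ℝ))

/-- `S` is `α`-polar in `D`: there is an `α`-subharmonic `ρ` on `D`, not identically
`-∞`, with `ρ = -∞` on `S`. -/
def IsAlphaPolar {n : ℕ} (A : AlphaForm n) (D S : Set (Cn n)) : Prop :=
  ∃ ρ : Cn n → EReal, IsAlphaSubharmonicE A D ρ ∧ (∃ z ∈ D, ρ z ≠ ⊥) ∧ ∀ z ∈ S, ρ z = ⊥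

/-- `u` is plurisubharmonic on `D`: upper semicontinuous, locally integrable, and with
positive semidefinite complex Hessian in the sense of distributions. -/
def IsPlurisubharmonic {n : ℕ} (D : Set (Cn n)) (u : Cn n → ℝ) : Prop :=
  UpperSemicontinuousOn u D ∧ LocallyIntegrableOn u D volume ∧
  ∀ ξ : Fin n → ℂ, ∀ ω : Cn n → ℝ, ContDiff ℝ (⊤ : ℕ∞) ω → HasCompactSupport ω →
    tsupport ω ⊆ D → (∀ z, 0 ≤ ω z) →
    0 ≤ ∫ z in D, u z *
      (∑ j, ∑ k, ξ j * starRingEnd ℂ (ξ k) * wdzbar k (wdz j (fun w => (ω w : ℂ))) z).re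

/-- The class `U(E,D)` for the plurisubharmonic measure. -/
def UclassPsh {n : ℕ} (E D : Set (Cn n)) : Set (Cn n → ℝ) :=
  {u | IsPlurisubharmonic D u ∧ (∀ z ∈ E, u z ≤ -1) ∧ ∀ z ∈ D, u z < 0}

/-- The plurisubharmonic extremal function `ω(z, E, D)`. -/
noncomputable def omegaPsh {n : ℕ} (E D : Set (Cn n)) (z : Cn n) : ℝ :=
  sSup ((fun u : Cn n → ℝ => u z) '' UclassPsh E D)

/-- The plurisubharmonic measure `ω*(z, E, D)`. -/
noncomputable def omegaPshStar {n : ℕ} (E D : Set (Cn n)) (z : Cn n) : ℝ :=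
  Filter.limsup (omegaPsh E D) (𝓝 z)

end

open MeasureTheory Filter Topology Complex Metric

set_option linter.unusedSectionVars false
set_option linter.unusedSimpArgs false

noncomputable section

namespace APerron

open Module

/-- A real divergence-free symmetric elliptic operator with `C¹` coefficients. -/
structure EF (V : Type*) [NormedAddCommGroup V] [NormedSpace ℝ V] (ι : Type*) [Fintype ι] where
  e : Basis ι ℝ V
  a : ι → ι → V → ℝ
  smooth : ∀ i j, ContDiff ℝ 1 (a i j)
  symm : ∀ i j x, a j i x = a i j x
  pos : ∀ x (ξ : ι → ℝ), ξ ≠ 0 → 0 < ∑ i, ∑ j, a i j x * ξ i * ξ j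
  div : ∀ j x, ∑ i, fderiv ℝ (a i j) x (e i) = 0

section calc1

variable {V : Type*} [NormedAddCommGroup V] [NormedSpace ℝ V] [FiniteDimensional ℝ V]
  [MeasureSpace V] [BorelSpace V] [(volume : Measure V).IsAddHaarMeasure]
  {ι : Type*} [Fintype ι]

def EF.d (S : EF V ι) (i : ι) (f : V → ℝ) (x : V) : ℝ := fderiv ℝ f x (S.e i)

def EF.L (S : EF V ι) (f : V → ℝ) (x : V) : ℝ := ∑ i, ∑ j, S.a i j x * S.d i (S.d j f) x

variable (S : EF V ι)

theorem d_contDiff {m k : WithTop ℕ∞} (i : ι) {f : V → ℝ} (hf : ContDiff ℝ m f) (h : k + 1 ≤ m) :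
    ContDiff ℝ k (S.d i f) := by
  unfold EF.d
  exact (hf.fderiv_right h).clm_apply contDiff_const

theorem d_cont (i : ι) {f : V → ℝ} (hf : ContDiff ℝ 1 f) : Continuous (S.d i f) :=
  (d_contDiff S (k := 0) i hf (by norm_num)).continuous

theorem d_one (i : ι) {f : V → ℝ} (hf : ContDiff ℝ 2 f) : ContDiff ℝ 1 (S.d i f) :=
  d_contDiff S i hf (by norm_num)

theorem d_infty (i : ι) {f : V → ℝ} (hf : ContDiff ℝ (⊤ : ℕ∞) f) :
    ContDiff ℝ (⊤ : ℕ∞) (S.d i f) :=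
  d_contDiff S i hf (by exact_mod_cast le_rfl)

theorem d_tsupport (i : ι) {f : V → ℝ} : tsupport (S.d i f) ⊆ tsupport f := by
  apply closure_minimal _ (isClosed_tsupport _)
  intro x hx
  by_contra h
  apply hx
  have : fderiv ℝ f x = 0 := by
    have := fderiv_of_notMem_tsupport (𝕜 := ℝ) h
    exact this
  simp [EF.d, this]

theorem d_hcs (i : ι) {f : V → ℝ} (hf : HasCompactSupport f) : HasCompactSupport (S.d i f) :=
  hf.of_isClosed_subset (isClosed_tsupport _) (d_tsupport S i)

theorem d_mul (i : ι) {f g : V → ℝ} (hf : ContDiff ℝ 1 f) (hg : ContDiff ℝ 1 g) (x : V) :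
    S.d i (fun y => f y * g y) x = S.d i f x * g x + f x * S.d i g x := by
  have h1 := (hf.differentiable (by norm_num) x)
  have h2 := (hg.differentiable (by norm_num) x)
  unfold EF.d
  rw [fderiv_fun_mul h1 h2]
  simp; ring

theorem d_add (i : ι) {f g : V → ℝ} (hf : ContDiff ℝ 1 f) (hg : ContDiff ℝ 1 g) :
    S.d i (fun y => f y + g y) = fun x => S.d i f x + S.d i g x := by
  funext x
  have h1 := (hf.differentiable (by norm_num) x)
  have h2 := (hg.differentiable (by norm_num) x)
  unfold EF.d
  rw [fderiv_fun_add h1 h2]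
  simp

theorem d_const_mul (i : ι) {f : V → ℝ} (c : ℝ) (hf : ContDiff ℝ 1 f) :
    S.d i (fun y => c * f y) = fun x => c * S.d i f x := by
  funext x
  have h1 := (hf.differentiable (by norm_num) x)
  unfold EF.d
  rw [fderiv_const_mul h1]
  simp

theorem d_const (i : ι) (c : ℝ) : S.d i (fun _ => c) = fun _ => 0 := by
  funext x
  simp [EF.d]

/-- chain rule -/
theorem d_comp (i : ι) {f : V → ℝ} {g : ℝ → ℝ} {g' : ℝ} {x : V} (hf : DifferentiableAt ℝ f x)
    (hg : HasDerivAt g g' (f x)) :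
    S.d i (fun y => g (f y)) x = g' * S.d i f x := by
  unfold EF.d
  have := hg.comp_hasFDerivAt x hf.hasFDerivAt
  have h2 : fderiv ℝ (fun y => g (f y)) x = g' • fderiv ℝ f x := this.fderiv
  rw [h2]; simp

theorem L_cont {f : V → ℝ} (hf : ContDiff ℝ 2 f) : Continuous (S.L f) := by
  unfold EF.L
  refine continuous_finsetSum _ fun i _ => continuous_finsetSum _ fun j _ => ?_
  exact (S.smooth i j).continuous.mul (d_cont S i (d_one S j hf))

theorem L_tsupport {f : V → ℝ} : tsupport (S.L f) ⊆ tsupport f := by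
  apply closure_minimal _ (isClosed_tsupport _)
  intro x hx
  by_contra h
  apply hx
  unfold EF.L
  refine Finset.sum_eq_zero fun i _ => Finset.sum_eq_zero fun j _ => ?_
  have : S.d i (S.d j f) x = 0 := by
    apply image_eq_zero_of_notMem_tsupport
    intro h'
    exact h (d_tsupport S j (d_tsupport S i h'))
  simp [this]

theorem L_hcs {f : V → ℝ} (hf : HasCompactSupport f) : HasCompactSupport (S.L f) :=
  hf.of_isClosed_subset (isClosed_tsupport _) (L_tsupport S)

theorem L_add {f g : V → ℝ} (hf : ContDiff ℝ 2 f) (hg : ContDiff ℝ 2 g) :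
    S.L (fun y => f y + g y) = fun x => S.L f x + S.L g x := by
  funext x
  unfold EF.L
  simp only [← Finset.sum_add_distrib]
  refine Finset.sum_congr rfl fun i _ => Finset.sum_congr rfl fun j _ => ?_
  rw [d_add S j (hf.of_le (by norm_num)) (hg.of_le (by norm_num)),
    d_add S i (d_one S j hf) (d_one S j hg)]
  ring

theorem L_const_mul {f : V → ℝ} (c : ℝ) (hf : ContDiff ℝ 2 f) :
    S.L (fun y => c * f y) = fun x => c * S.L f x := by
  funext x
  unfold EF.L
  simp only [Finset.mul_sum]
  refine Finset.sum_congr rfl fun i _ => Finset.sum_congr rfl fun j _ => ?_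
  rw [d_const_mul S j c (hf.of_le (by norm_num)),
    d_const_mul S i c (d_one S j hf)]
  ring

theorem L_const (c : ℝ) : S.L (fun _ => c) = fun _ => 0 := by
  funext x
  simp [EF.L, d_const]

theorem d_congr (i : ι) {f g : V → ℝ} {x : V} (h : f =ᶠ[𝓝 x] g) : S.d i f x = S.d i g x := by
  unfold EF.d; rw [h.fderiv_eq]

theorem d_congr' (i : ι) {f g : V → ℝ} {x : V} (h : f =ᶠ[𝓝 x] g) : S.d i f =ᶠ[𝓝 x] S.d i g := by
  filter_upwards [h.eventuallyEq_nhds] with y hy using d_congr S i hy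

theorem L_congr {f g : V → ℝ} {x : V} (h : f =ᶠ[𝓝 x] g) : S.L f x = S.L g x := by
  unfold EF.L
  refine Finset.sum_congr rfl fun i _ => Finset.sum_congr rfl fun j _ => ?_
  rw [d_congr S i (d_congr' S j h)]

/-- chain rule for `L` -/
theorem L_comp {f : V → ℝ} (hf : ContDiff ℝ 2 f) {g g1 : ℝ → ℝ} {g2 : ℝ} {x : V}
    (hg : ∀ᶠ t in 𝓝 (f x), HasDerivAt g (g1 t) t) (hg1 : HasDerivAt g1 g2 (f x)) :
    S.L (fun y => g (f y)) x =
      g1 (f x) * S.L f x + g2 * ∑ i, ∑ j, S.a i j x * S.d i f x * S.d j f x := by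
  have hd : Differentiable ℝ f := hf.differentiable (by norm_num)
  have key : ∀ i j, S.d i (S.d j (fun y => g (f y))) x =
      g1 (f x) * S.d i (S.d j f) x + g2 * S.d i f x * S.d j f x := by
    intro i j
    have h1 : S.d j (fun y => g (f y)) =ᶠ[𝓝 x] fun y => g1 (f y) * S.d j f y := by
      filter_upwards [hd.continuous.continuousAt.eventually hg] with y hy
      exact d_comp S j (hd y) hy
    rw [d_congr S i h1]
    have h2 : HasFDerivAt (fun y => g1 (f y)) (g2 • fderiv ℝ f x) x :=
      hg1.comp_hasFDerivAt x (hd x).hasFDerivAt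
    have h3 : DifferentiableAt ℝ (S.d j f) x := (d_one S j hf).differentiable (by norm_num) x
    have h4 := (h2.mul h3.hasFDerivAt).fderiv
    have h5 : S.d i (fun y => g1 (f y) * S.d j f y) x =
      (fderiv ℝ ((fun y => g1 (f y)) * S.d j f) x) (S.e i) := rfl
    rw [h5, h4]
    simp [EF.d]; ring
  unfold EF.L
  simp only [key, Finset.mul_sum, ← Finset.sum_add_distrib]
  refine Finset.sum_congr rfl fun i _ => Finset.sum_congr rfl fun j _ => ?_
  ring

theorem int_hcs {f : V → ℝ} (hf : Continuous f) (h : HasCompactSupport f) : Integrable f :=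
  hf.integrable_of_hasCompactSupport h

/-- Integration by parts. -/
theorem ibp (i : ι) {f g : V → ℝ} (hf : ContDiff ℝ 1 f) (hg : ContDiff ℝ 1 g)
    (h : HasCompactSupport f ∨ HasCompactSupport g) :
    ∫ x, f x * S.d i g x = - ∫ x, S.d i f x * g x := by
  unfold EF.d
  have c1 := hf.continuous
  have c2 := hg.continuous
  have c3 := d_cont S i hf
  have c4 := d_cont S i hg
  apply integral_mul_fderiv_eq_neg_fderiv_mul_of_integrable
  · refine int_hcs (c3.mul c2) ?_
    rcases h with h | h
    · exact (d_hcs S i h).mul_right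
    · exact h.mul_left
  · refine int_hcs (c1.mul c4) ?_
    rcases h with h | h
    · exact h.mul_right
    · exact (d_hcs S i h).mul_left
  · refine int_hcs (c1.mul c2) ?_
    rcases h with h | h
    · exact h.mul_right
    · exact h.mul_left
  · exact fun x _ => hf.differentiable (by norm_num) x
  · exact fun x _ => hg.differentiable (by norm_num) x

/-- The weak form of `L`. -/
theorem int_L {f φ : V → ℝ} (hf : ContDiff ℝ 2 f) (hφ : ContDiff ℝ 1 φ)
    (h : HasCompactSupport φ ∨ HasCompactSupport f) :
    ∫ x, φ x * S.L f x = - ∫ x, ∑ i, ∑ j, S.a i j x * S.d i φ x * S.d j f x := by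
  have hc : ∀ i j, HasCompactSupport (fun x => S.a i j x * S.d i φ x * S.d j f x) := by
    intro i j
    rcases h with h | h
    · exact ((d_hcs S i h).mul_left).mul_right
    · exact (d_hcs S j h).mul_left
  have hcont : ∀ i j, Continuous (fun x => S.a i j x * S.d i φ x * S.d j f x) := fun i j =>
    ((S.smooth i j).continuous.mul (d_cont S i hφ)).mul (d_cont S j (hf.of_le (by norm_num)))
  have hI1 : ∀ i j, Integrable (fun x => φ x * S.a i j x * S.d i (S.d j f) x) := by
    intro i j
    refine int_hcs ((hφ.continuous.mul (S.smooth i j).continuous).mul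
      (d_cont S i (d_one S j hf))) ?_
    rcases h with h | h
    · exact (h.mul_right).mul_right
    · exact (d_hcs S i (d_hcs S j h)).mul_left
  have hI3 : ∀ i j, Integrable (fun x => φ x * S.d i (S.a i j) x * S.d j f x) := by
    intro i j
    refine int_hcs ((hφ.continuous.mul (d_cont S i (S.smooth i j))).mul
      (d_cont S j (hf.of_le (by norm_num)))) ?_
    rcases h with h | h
    · exact (h.mul_right).mul_right
    · exact (d_hcs S j h).mul_left
  have e1 : ∫ x, φ x * S.L f x = ∑ i, ∑ j, ∫ x, φ x * S.a i j x * S.d i (S.d j f) x := by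
    unfold EF.L
    simp only [Finset.mul_sum, ← mul_assoc]
    rw [integral_finsetSum _ fun i _ => integrable_finsetSum _ fun j _ => hI1 i j]
    refine Finset.sum_congr rfl fun i _ => ?_
    rw [integral_finsetSum _ fun j _ => hI1 i j]
  have e2 : ∀ i j, ∫ x, φ x * S.a i j x * S.d i (S.d j f) x =
      - (∫ x, S.a i j x * S.d i φ x * S.d j f x) - ∫ x, φ x * S.d i (S.a i j) x * S.d j f x := by
    intro i j
    rw [ibp S i (hφ.mul (S.smooth i j)) (d_one S j hf) (by
      rcases h with h | h
      · exact Or.inl h.mul_right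
      · exact Or.inr (d_hcs S j h))]
    rw [← neg_add', ← integral_add (int_hcs (hcont i j) (hc i j)) (hI3 i j)]
    congr 1
    refine integral_congr_ae (Eventually.of_forall fun x => ?_)
    show S.d i (fun y => φ y * S.a i j y) x * _ = _
    rw [d_mul S i hφ (S.smooth i j)]
    simp only [Pi.mul_apply]; ring
  rw [e1]
  simp only [e2, Finset.sum_sub_distrib, Finset.sum_neg_distrib]
  have e3 : ∑ i, ∑ j, ∫ x, φ x * S.d i (S.a i j) x * S.d j f x = 0 := by
    rw [Finset.sum_comm]
    refine Finset.sum_eq_zero fun j _ => ?_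
    rw [← integral_finsetSum _ fun i _ => hI3 i j]
    have : ∀ x, ∑ i, φ x * S.d i (S.a i j) x * S.d j f x = 0 := by
      intro x
      rw [← Finset.sum_mul, ← Finset.mul_sum]
      have := S.div j x
      unfold EF.d
      rw [this]; ring
    simp [this]
  rw [e3, sub_zero]
  congr 1
  rw [integral_finsetSum _ fun i _ => integrable_finsetSum _ fun j _ =>
    int_hcs (hcont i j) (hc i j)]
  refine Finset.sum_congr rfl fun i _ => ?_
  rw [integral_finsetSum _ fun j _ => int_hcs (hcont i j) (hc i j)]

theorem L_symm {f φ : V → ℝ} (hf : ContDiff ℝ 2 f) (hφ : ContDiff ℝ 2 φ)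
    (h : HasCompactSupport φ ∨ HasCompactSupport f) :
    ∫ x, φ x * S.L f x = ∫ x, f x * S.L φ x := by
  rw [int_L S hf (hφ.of_le (by norm_num)) h, int_L S hφ (hf.of_le (by norm_num)) h.symm]
  congr 1
  refine integral_congr_ae (Eventually.of_forall fun x => ?_)
  simp only
  rw [Finset.sum_comm]
  refine Finset.sum_congr rfl fun i _ => Finset.sum_congr rfl fun j _ => ?_
  rw [S.symm i j]; ring

theorem int_L_zero {φ : V → ℝ} (hφ : ContDiff ℝ 2 φ) (h : HasCompactSupport φ) :
    ∫ x, S.L φ x = 0 := by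
  have := L_symm S (f := fun _ => 1) contDiff_const hφ (Or.inl h)
  rw [L_const] at this
  simpa using this.symm

end calc1

end APerron
end

open MeasureTheory Filter Topology Complex Metric

set_option linter.unusedSectionVars false
set_option linter.unusedSimpArgs false

noncomputable section

namespace APerron

open Module

section AK

variable {V : Type*} [NormedAddCommGroup V] [NormedSpace ℝ V] [FiniteDimensional ℝ V]
  [MeasureSpace V] [BorelSpace V] [(volume : Measure V).IsAddHaarMeasure]

/-- continuity of translations in `L¹` -/
theorem trans_cont {f : V → ℝ} (hf : Integrable f) :
    Tendsto (fun z : V => ∫⁻ x, ‖f (x - z) - f x‖ₑ) (𝓝 0) (𝓝 0) := by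
  have hm : MemLp f 1 := memLp_one_iff_integrable.mpr hf
  let g : V → C(V, V) := fun z => ⟨fun x => x - z, by fun_prop⟩
  have hg : Continuous g := by
    have : Continuous (Function.uncurry fun z x : V => x - z) := by
      unfold Function.uncurry; fun_prop
    exact (ContinuousMap.curry ⟨_, this⟩).continuous
  have hgm : ∀ z, MeasurePreserving (g z) volume volume := fun z => measurePreserving_sub_right _ z
  have h1 := Filter.Tendsto.compMeasurePreservingLp (p := 1) (E := ℝ) (l := 𝓝 (0:V))
    (f := fun _ => hm.toLp f) (f₀ := hm.toLp f) (g := g) (g₀ := g 0) tendsto_const_nhds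
    (hg.tendsto 0) hgm (hgm 0) (by simp)
  rw [Lp.tendsto_Lp_iff_tendsto_eLpNorm'] at h1
  refine h1.congr fun z => ?_
  rw [eLpNorm_one_eq_lintegral_enorm]
  apply lintegral_congr_ae
  have e1 := Lp.coeFn_compMeasurePreserving (hm.toLp f) (hgm z)
  have e2 := Lp.coeFn_compMeasurePreserving (hm.toLp f) (hgm 0)
  have e3 := (hgm z).quasiMeasurePreserving.ae_eq_comp hm.coeFn_toLp
  have e4 := (hgm 0).quasiMeasurePreserving.ae_eq_comp hm.coeFn_toLp
  filter_upwards [e1, e2, e3, e4] with x h1 h2 h3 h4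
  rw [Pi.sub_apply, h1, h2, h3, h4]
  simp [g]

theorem AK {f : V → ℝ} (hf : Integrable f) {B : Set V} (hB : MeasurableSet B)
    {k : ℕ → V → V → ℝ} {M : ℕ → V → ℝ} {Θ : ℕ → V → ENNReal} (hΘm : ∀ m, Measurable (Θ m))
    {C : ENNReal} (hC : C ≠ ⊤) (hΘC : ∀ m, ∫⁻ z, Θ m z ≤ C)
    (hΘ0 : ∀ r > 0, Tendsto (fun m => ∫⁻ z in {z | r ≤ ‖z‖}, Θ m z) atTop (𝓝 0))
    (hkm : ∀ m, ∀ x ∈ B, AEStronglyMeasurable (k m x) volume)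
    (hk : ∀ᶠ m in atTop, ∀ x ∈ B, ∀ y, ‖k m x y‖ₑ ≤ Θ m (x - y))
    (hM : ∀ᶠ m in atTop, ∀ x ∈ B, ∫ y, k m x y = M m x) :
    Tendsto (fun m => ∫⁻ x in B, ‖(∫ y, k m x y * f y) - M m x * f x‖ₑ) atTop (𝓝 0) := by
  wlog hfm : StronglyMeasurable f generalizing f with H
  · obtain ⟨f', hf', he⟩ := hf.aestronglyMeasurable
    have := H (hf.congr he) hf'
    refine this.congr fun m => ?_
    apply lintegral_congr_ae
    filter_upwards [ae_restrict_of_ae he] with x hx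
    rw [hx]
    congr 2
    exact integral_congr_ae (by filter_upwards [he] with y hy; rw [hy])
  have hfmm := hfm.measurable
  -- basic bound
  have key : ∀ᶠ m in atTop, ∫⁻ x in B, ‖(∫ y, k m x y * f y) - M m x * f x‖ₑ ≤
      ∫⁻ z, Θ m z * ∫⁻ x, ‖f (x - z) - f x‖ₑ := by
    filter_upwards [hk, hM] with m hk hM
    have hfin : ∫⁻ x, ∫⁻ y, Θ m (x - y) * ‖f y‖ₑ < ⊤ := by
      rw [lintegral_lintegral_swap (by fun_prop)]
      have : ∀ y, ∫⁻ x, Θ m (x - y) * ‖f y‖ₑ ≤ C * ‖f y‖ₑ := by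
        intro y
        rw [lintegral_mul_const _ (by fun_prop), lintegral_sub_right_eq_self (Θ m) y]
        gcongr; exact hΘC m
      calc _ ≤ ∫⁻ y, C * ‖f y‖ₑ := lintegral_mono this
        _ = C * ∫⁻ y, ‖f y‖ₑ := lintegral_const_mul _ (by fun_prop)
        _ < ⊤ := ENNReal.mul_lt_top hC.lt_top hf.2
    have hae : ∀ᵐ x, ∫⁻ y, Θ m (x - y) * ‖f y‖ₑ < ⊤ :=
      ae_lt_top (Measurable.lintegral_prod_right' (f := fun p : V × V => Θ m (p.1 - p.2) * ‖f p.2‖ₑ)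
        (by fun_prop)) hfin.ne
    have hpt : ∀ᵐ x, x ∈ B → ‖(∫ y, k m x y * f y) - M m x * f x‖ₑ ≤
        ∫⁻ y, Θ m (x - y) * ‖f y - f x‖ₑ := by
      filter_upwards [hae] with x hx hxB
      have i1 : Integrable (k m x) := by
        refine ⟨hkm m x hxB, ?_⟩
        calc ∫⁻ y, ‖k m x y‖ₑ ≤ ∫⁻ y, Θ m (x - y) := lintegral_mono (hk x hxB)
          _ = ∫⁻ y, Θ m y := lintegral_sub_left_eq_self (Θ m) x
          _ ≤ C := hΘC m
          _ < ⊤ := hC.lt_top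
      have i2 : Integrable (fun y => k m x y * f y) := by
        refine ⟨(hkm m x hxB).mul hfm.aestronglyMeasurable, ?_⟩
        refine lt_of_le_of_lt (lintegral_mono fun y => ?_) hx
        rw [enorm_mul]; gcongr; exact hk x hxB y
      have : (∫ y, k m x y * f y) - M m x * f x = ∫ y, k m x y * (f y - f x) := by
        rw [← hM x hxB, ← integral_mul_const, ← integral_sub i2 (i1.mul_const _)]
        congr 1; ext y; ring
      rw [this]
      refine (enorm_integral_le_lintegral_enorm _).trans (lintegral_mono fun y => ?_)
      rw [enorm_mul]; gcongr; exact hk x hxB y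
    calc ∫⁻ x in B, ‖(∫ y, k m x y * f y) - M m x * f x‖ₑ
        ≤ ∫⁻ x in B, ∫⁻ y, Θ m (x - y) * ‖f y - f x‖ₑ := by
          refine setLIntegral_mono_ae' hB hpt
      _ ≤ ∫⁻ x, ∫⁻ y, Θ m (x - y) * ‖f y - f x‖ₑ := setLIntegral_le_lintegral _ _
      _ = ∫⁻ x, ∫⁻ z, Θ m z * ‖f (x - z) - f x‖ₑ := by
          congr 1; ext x
          rw [← lintegral_sub_left_eq_self (fun y => Θ m (x - y) * ‖f y - f x‖ₑ) x]
          simp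
      _ = ∫⁻ z, ∫⁻ x, Θ m z * ‖f (x - z) - f x‖ₑ := lintegral_lintegral_swap (by fun_prop)
      _ = ∫⁻ z, Θ m z * ∫⁻ x, ‖f (x - z) - f x‖ₑ := by
          congr 1; ext z
          rw [lintegral_const_mul _ (by fun_prop)]
  have hb : ∀ z, ∫⁻ x, ‖f (x - z) - f x‖ₑ ≤ 2 * ∫⁻ x, ‖f x‖ₑ := by
    intro z
    calc ∫⁻ x, ‖f (x - z) - f x‖ₑ ≤ ∫⁻ x, (‖f (x - z)‖ₑ + ‖f x‖ₑ) :=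
          lintegral_mono fun x => enorm_sub_le
      _ = 2 * ∫⁻ x, ‖f x‖ₑ := by
          rw [lintegral_add_left (by fun_prop), lintegral_sub_right_eq_self (fun x => ‖f x‖ₑ) z,
            two_mul]
  set A := 2 * ∫⁻ x, ‖f x‖ₑ with hA
  have hAt : A ≠ ⊤ := ENNReal.mul_ne_top (by simp) hf.2.ne
  rw [ENNReal.tendsto_nhds_zero]
  intro ε hε
  obtain ⟨δ, hδ, hδε⟩ : ∃ δ : ENNReal, 0 < δ ∧ C * δ ≤ ε / 2 := by
    have : Tendsto (fun δ => C * δ) (𝓝[>] (0:ENNReal)) (𝓝 (C * 0)) :=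
      (ENNReal.Tendsto.const_mul tendsto_id (Or.inr hC)).mono_left nhdsWithin_le_nhds
    rw [mul_zero] at this
    have h2 := (this.eventually (ge_mem_nhds (ENNReal.half_pos hε.ne'))).and self_mem_nhdsWithin
    obtain ⟨δ, h1, h2⟩ := h2.exists
    exact ⟨δ, h2, h1⟩
  have := (trans_cont hf).eventually (ge_mem_nhds hδ)
  obtain ⟨r, hr, hball⟩ := Metric.eventually_nhds_iff.mp this
  have h3 := hΘ0 r hr
  have h4 : Tendsto (fun m => A * ∫⁻ z in {z | r ≤ ‖z‖}, Θ m z) atTop (𝓝 (A * 0)) :=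
    ENNReal.Tendsto.const_mul h3 (Or.inr hAt)
  rw [mul_zero] at h4
  filter_upwards [key, h4.eventually (ge_mem_nhds (ENNReal.half_pos hε.ne'))] with m h5 h6
  have hms : MeasurableSet {z : V | r ≤ ‖z‖} := measurableSet_le measurable_const measurable_norm
  calc _ ≤ _ := h5
    _ ≤ ∫⁻ z, (Θ m z * δ + {z : V | r ≤ ‖z‖}.indicator (fun z => A * Θ m z) z) := by
        refine lintegral_mono fun z => ?_
        by_cases hz : r ≤ ‖z‖
        · rw [Set.indicator_of_mem (by exact hz), mul_comm A]
          refine le_add_left ?_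
          gcongr; exact hb z
        · refine le_add_right ?_
          gcongr
          exact hball (by simpa using hz)
    _ = (∫⁻ z, Θ m z) * δ + A * ∫⁻ z in {z | r ≤ ‖z‖}, Θ m z := by
        rw [lintegral_add_left (by fun_prop), lintegral_mul_const _ (hΘm m), lintegral_indicator hms,
          lintegral_const_mul _ (hΘm m)]
    _ ≤ C * δ + ε / 2 := by gcongr; exact hΘC m
    _ ≤ ε / 2 + ε / 2 := by gcongr
    _ = ε := ENNReal.add_halves ε

end AK

end APerron

end

open MeasureTheory Filter Topology Complex Metric

set_option linter.unusedSectionVars false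
set_option linter.unusedSimpArgs false

noncomputable section

namespace APerron

open Module

section moll

variable {V : Type*} [NormedAddCommGroup V] [NormedSpace ℝ V] [FiniteDimensional ℝ V]
  [MeasureSpace V] [BorelSpace V] [(volume : Measure V).IsAddHaarMeasure]
  {ι : Type*} [Fintype ι] (S : EF V ι)

/-- convolution of real functions -/
def cv (f g : V → ℝ) (x : V) : ℝ := ∫ t, f t * g (x - t)

theorem cv_eq (f g : V → ℝ) :
    cv f g = MeasureTheory.convolution f g (ContinuousLinearMap.mul ℝ ℝ) volume := by
  ext x; rfl

theorem cv_contDiff {f g : V → ℝ} (hf : Integrable f) (hg : ContDiff ℝ (⊤ : ℕ∞) g)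
    (hc : HasCompactSupport g) : ContDiff ℝ (⊤ : ℕ∞) (cv f g) := by
  rw [cv_eq]
  exact hc.contDiff_convolution_right _ hf.locallyIntegrable hg

theorem cv_cont {f g : V → ℝ} (hf : Integrable f) (hg : Continuous g)
    (hc : HasCompactSupport g) : Continuous (cv f g) := by
  rw [cv_eq]
  exact hc.continuous_convolution_right _ hf.locallyIntegrable hg

theorem cv_d (i : ι) {f g : V → ℝ} (hf : Integrable f) (hg : ContDiff ℝ 1 g)
    (hc : HasCompactSupport g) : S.d i (cv f g) = cv f (S.d i g) := by
  ext x
  have h := hc.hasFDerivAt_convolution_right (ContinuousLinearMap.mul ℝ ℝ)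
    hf.locallyIntegrable hg x
  unfold EF.d
  rw [cv_eq, h.fderiv]
  have hi : Integrable (fun t => ((ContinuousLinearMap.mul ℝ ℝ).precompR V) (f t)
      (fderiv ℝ g (x - t))) := by
    have := (hc.fderiv (𝕜 := ℝ)).convolutionExists_right ((ContinuousLinearMap.mul ℝ ℝ).precompR V)
      hf.locallyIntegrable (hg.continuous_fderiv (by norm_num)) x
    exact this
  unfold MeasureTheory.convolution
  rw [ContinuousLinearMap.integral_apply hi]
  rfl

theorem cv_d_left (i : ι) {f g : V → ℝ} (hf : ContDiff ℝ 1 f) (hc : HasCompactSupport f)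
    (hg : Continuous g) : S.d i (cv f g) = cv (S.d i f) g := by
  ext x
  have h := hc.hasFDerivAt_convolution_left (μ := volume) (ContinuousLinearMap.mul ℝ ℝ) hf
    hg.locallyIntegrable x
  unfold EF.d
  rw [cv_eq, h.fderiv]
  have hi : Integrable (fun t => ((ContinuousLinearMap.mul ℝ ℝ).precompL V) (fderiv ℝ f t)
      (g (x - t))) := by
    have := (hc.fderiv (𝕜 := ℝ)).convolutionExists_left ((ContinuousLinearMap.mul ℝ ℝ).precompL V)
      (hf.continuous_fderiv (by norm_num)) (hg.locallyIntegrable (μ := volume)) x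
    exact this
  unfold MeasureTheory.convolution
  rw [ContinuousLinearMap.integral_apply hi]
  rfl

theorem bdd_of_hcs {g : V → ℝ} (hg : Continuous g) (hc : HasCompactSupport g) :
    ∃ C, 0 ≤ C ∧ ∀ x, |g x| ≤ C := by
  obtain ⟨C, hC⟩ := hg.bounded_above_of_compact_support hc
  exact ⟨C, (abs_nonneg _).trans (hC 0), hC⟩

theorem cv_int {f g : V → ℝ} (hf : Integrable f) (hg : Continuous g)
    (hc : HasCompactSupport g) (x : V) : Integrable (fun t => f t * g (x - t)) := by
  obtain ⟨C, -, hC⟩ := bdd_of_hcs hg hc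
  exact hf.mul_bdd (c := C) (by fun_prop) (Eventually.of_forall fun t => hC _)

/-- Fubini for `cv`. -/
theorem cv_fubini {f g h : V → ℝ} (hf : Integrable f) (hg : Continuous g)
    (hc : HasCompactSupport g) (hh : Integrable h) :
    ∫ x, h x * cv f g x = ∫ y, f y * ∫ x, h x * g (x - y) := by
  obtain ⟨C, -, hC⟩ := bdd_of_hcs hg hc
  have hi : Integrable (fun p : V × V => h p.1 * f p.2 * g (p.1 - p.2)) (volume.prod volume) :=
    (hh.mul_prod hf).mul_bdd (c := C) (by fun_prop) (Eventually.of_forall fun t => hC _)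
  calc ∫ x, h x * cv f g x = ∫ x, ∫ y, h x * f y * g (x - y) := by
        congr 1; ext x
        rw [cv, ← integral_const_mul]
        congr 1; ext y; ring
    _ = ∫ y, ∫ x, h x * f y * g (x - y) := integral_integral_swap hi
    _ = _ := by
        congr 1; ext x
        rw [← integral_const_mul]
        congr 1; ext y; ring

structure IsMoll (C : ℝ) (ε : ℝ) (ρ : V → ℝ) : Prop where
  smooth : ContDiff ℝ (⊤ : ℕ∞) ρ
  even : ∀ z, ρ (-z) = ρ z
  nonneg : ∀ z, 0 ≤ ρ z
  supp : ∀ z, ε < ‖z‖ → ρ z = 0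
  one : ∫ z, ρ z = 1
  le : ∀ z, ρ z ≤ C * (ε⁻¹) ^ finrank ℝ V
  dle : ∀ i z, |ε * S.d i ρ z| ≤ C * (ε⁻¹) ^ finrank ℝ V
  dsq : ∀ i z, (ε * S.d i ρ z) ^ 2 ≤ C * ρ z * (ε⁻¹) ^ finrank ℝ V

theorem exists_moll : ∃ C : ℝ, 0 < C ∧ ∀ ε > 0, ∃ ρ : V → ℝ, IsMoll S C ε ρ := by
  let η : ContDiffBump (0 : V) := ⟨1/2, 1, by norm_num, by norm_num⟩
  have hηs : ContDiff ℝ (⊤ : ℕ∞) η := η.contDiff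
  have hη2 : ContDiff ℝ (⊤ : ℕ∞) (fun z => η z * η z) := hηs.mul hηs
  have hηc : HasCompactSupport (fun z => η z * η z) := η.hasCompactSupport.mul_left
  set J := ∫ z, η z * η z with hJ
  have hJpos : 0 < J := by
    refine hη2.continuous.integral_pos_of_hasCompactSupport_nonneg_nonzero hηc
      (fun z => mul_self_nonneg _) (x := 0) ?_
    have : η 0 = 1 := η.one_of_mem_closedBall (by simp [η])
    simp [this]
  choose B hB0 hB using fun i : ι =>
    bdd_of_hcs (d_cont S i (hηs.of_le (by simp))) (d_hcs S i η.hasCompactSupport)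
  set b := ∑ i, B i with hb
  have hb0 : 0 ≤ b := Finset.sum_nonneg fun i _ => hB0 i
  have hBb : ∀ i x, |S.d i η x| ≤ b := fun i x => (hB i x).trans
    (Finset.single_le_sum (f := B) (fun i _ => hB0 i) (Finset.mem_univ i))
  set C := J⁻¹ * (1 + 2 * b + 4 * b ^ 2) with hC
  have hJi : 0 < J⁻¹ := inv_pos.mpr hJpos
  refine ⟨C, by positivity, fun ε hε => ?_⟩
  set N := finrank ℝ V
  set e : ℝ := (ε⁻¹) ^ N with he
  have he0 : 0 < e := by positivity
  have hdρ : ∀ i z, S.d i (fun z => J⁻¹ * e * (η (ε⁻¹ • z) * η (ε⁻¹ • z))) z =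
      ε⁻¹ * (J⁻¹ * e * (2 * η (ε⁻¹ • z) * S.d i η (ε⁻¹ • z))) := by
    intro i z
    have h1 : HasFDerivAt (fun z : V => ε⁻¹ • z) (ε⁻¹ • ContinuousLinearMap.id ℝ V) z :=
      (hasFDerivAt_id z).const_smul ε⁻¹
    have h2 : HasFDerivAt η (fderiv ℝ η (ε⁻¹ • z)) (ε⁻¹ • z) :=
      (hηs.differentiable (by simp) _).hasFDerivAt
    have h3 := h2.comp z h1
    have h4 := ((h3.mul h3).const_mul (J⁻¹ * e))
    have h5 : fderiv ℝ (fun z => J⁻¹ * e * (η (ε⁻¹ • z) * η (ε⁻¹ • z))) z = _ := h4.fderiv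
    unfold EF.d
    rw [h5]
    simp
    ring
  refine ⟨fun z => J⁻¹ * e * (η (ε⁻¹ • z) * η (ε⁻¹ • z)), ⟨?_, ?_, ?_, ?_, ?_, ?_, ?_, ?_⟩⟩
  · exact contDiff_const.mul (hη2.comp (contDiff_const_smul ε⁻¹))
  · intro z; simp only [smul_neg, η.neg]
  · intro z
    exact mul_nonneg (by positivity) (mul_self_nonneg _)
  · intro z hz
    have : η (ε⁻¹ • z) = 0 := by
      apply η.zero_of_le_dist
      simp only [dist_zero_right, norm_smul, norm_inv, Real.norm_eq_abs, abs_of_pos hε, η]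
      rw [inv_mul_eq_div, le_div_iff₀ hε]; linarith
    simp [this]
  · rw [integral_const_mul, Measure.integral_comp_inv_smul_of_nonneg volume
      (fun z => η z * η z) hε.le, ← hJ, smul_eq_mul, he, inv_pow]
    have : ε ^ N ≠ 0 := by positivity
    field_simp
    rfl
  · intro z
    have h1 : η (ε⁻¹ • z) * η (ε⁻¹ • z) ≤ 1 := by
      have := η.nonneg (x := ε⁻¹ • z); have := η.le_one (x := ε⁻¹ • z); nlinarith
    calc J⁻¹ * e * (η (ε⁻¹ • z) * η (ε⁻¹ • z)) ≤ J⁻¹ * e * 1 := by gcongr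
      _ ≤ J⁻¹ * (1 + 2 * b + 4 * b ^ 2) * e := by
        have h := mul_pos hJi he0
        nlinarith [mul_nonneg h.le hb0, mul_nonneg h.le (sq_nonneg b)]
  · intro i z
    rw [hdρ, ← mul_assoc, mul_inv_cancel₀ hε.ne', one_mul]
    have h1 := η.nonneg (x := ε⁻¹ • z)
    have h2 := η.le_one (x := ε⁻¹ • z)
    have h3 := hBb i (ε⁻¹ • z)
    rw [abs_mul, abs_of_pos (mul_pos hJi he0), abs_mul, abs_of_nonneg (by positivity : 0 ≤ 2 * η (ε⁻¹ • z))]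
    calc J⁻¹ * e * (2 * η (ε⁻¹ • z) * |S.d i η (ε⁻¹ • z)|) ≤ J⁻¹ * e * (2 * 1 * b) := by gcongr
      _ ≤ J⁻¹ * (1 + 2 * b + 4 * b ^ 2) * e := by
        have h := mul_pos hJi he0
        nlinarith [mul_nonneg h.le hb0, mul_nonneg h.le (sq_nonneg b)]
  · intro i z
    rw [hdρ, ← mul_assoc, mul_inv_cancel₀ hε.ne', one_mul]
    have h1 := η.nonneg (x := ε⁻¹ • z)
    have h3 := sq_le_sq' (neg_le_of_abs_le (hBb i (ε⁻¹ • z))) (le_of_abs_le (hBb i (ε⁻¹ • z)))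
    set t := η (ε⁻¹ • z)
    set s := S.d i η (ε⁻¹ • z)
    calc (J⁻¹ * e * (2 * t * s)) ^ 2 = (J⁻¹ * (4 * s ^ 2)) * (J⁻¹ * e * (t * t)) * e := by ring
      _ ≤ C * (J⁻¹ * e * (t * t)) * e := by
        gcongr
        · rw [hC]; gcongr; nlinarith

theorem IsMoll.hcs {C ε : ℝ} {ρ : V → ℝ} (h : IsMoll S C ε ρ) : HasCompactSupport ρ := by
  apply HasCompactSupport.intro (isCompact_closedBall (0:V) ε)
  intro x hx
  exact h.supp x (by simpa using hx)

theorem IsMoll.tsupp {C ε : ℝ} {ρ : V → ℝ} (h : IsMoll S C ε ρ) :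
    tsupport ρ ⊆ closedBall 0 ε := by
  apply closure_minimal _ isClosed_closedBall
  intro x hx
  by_contra hc
  exact hx (h.supp x (by simpa using hc))

theorem IsMoll.dsupp {C ε : ℝ} {ρ : V → ℝ} (h : IsMoll S C ε ρ) (i : ι) (z : V) (hz : ε < ‖z‖) :
    S.d i ρ z = 0 := by
  apply image_eq_zero_of_notMem_tsupport
  intro h'
  have := h.tsupp S (d_tsupport S i h')
  simp at this; linarith

theorem IsMoll.dodd {C ε : ℝ} {ρ : V → ℝ} (h : IsMoll S C ε ρ) (i : ι) (z : V) :
    S.d i ρ (-z) = - S.d i ρ z := by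
  have h1 : HasFDerivAt (fun z : V => -z) (-ContinuousLinearMap.id ℝ V) (-z) :=
    (hasFDerivAt_id (-z)).neg
  have h2 : HasFDerivAt ρ (fderiv ℝ ρ z) (- - z) := by
    rw [neg_neg]
    exact (h.smooth.differentiable (by simp) _).hasFDerivAt
  have h3 := h2.comp (-z) h1
  have h4 : (ρ ∘ fun z => -z) = ρ := by ext z; exact h.even z
  rw [h4] at h3
  unfold EF.d
  rw [h3.fderiv]
  simp

/-- commutator -/
def cF (i : ι) (ρ f : V → ℝ) (x : V) : ℝ :=
  ∫ y, (∑ j, (S.a i j x - S.a i j y) * S.d j ρ (x - y)) * f y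

theorem int_mul_cpt {f g : V → ℝ} (hf : Integrable f) (hfc : HasCompactSupport f)
    (hg : Continuous g) : Integrable (fun x => f x * g x) := by
  obtain ⟨C, hC⟩ := hfc.isCompact.exists_bound_of_continuousOn (f := g) hg.continuousOn
  refine (hf.norm.mul_const C).mono (hf.aestronglyMeasurable.mul (by fun_prop))
    (Eventually.of_forall fun x => ?_)
  by_cases hx : x ∈ tsupport f
  · have := hC x hx
    have h0 := (norm_nonneg _).trans this
    simp only [norm_mul, norm_norm, Real.norm_of_nonneg h0]
    gcongr
  · simp [image_eq_zero_of_notMem_tsupport hx]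

theorem cF_eq {C ε : ℝ} {ρ : V → ℝ} (h : IsMoll S C ε ρ) {f : V → ℝ} (hf : Integrable f)
    (hfc : HasCompactSupport f) (i : ι) (x : V) :
    cF S i ρ f x = ∑ j, (S.a i j x * cv f (S.d j ρ) x -
      cv (fun y => f y * S.a i j y) (S.d j ρ) x) := by
  have hc : ∀ j, Continuous (S.d j ρ) := fun j => d_cont S j (h.smooth.of_le (by simp))
  have hs : ∀ j, HasCompactSupport (S.d j ρ) := fun j => d_hcs S j (h.hcs S)
  have i1 : ∀ j, Integrable (fun y => f y * S.a i j y) := fun j =>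
    int_mul_cpt hf hfc (S.smooth i j).continuous
  have i2 := fun j => cv_int hf (hc j) (hs j) x
  have i3 := fun j => cv_int (i1 j) (hc j) (hs j) x
  unfold cF cv
  calc _ = ∫ y, ∑ j, (S.a i j x * (f y * S.d j ρ (x - y)) - f y * S.a i j y * S.d j ρ (x - y)) := by
        congr 1; ext y; rw [Finset.sum_mul]
        refine Finset.sum_congr rfl fun j _ => by ring
    _ = _ := by
        have i6 : ∀ j, Integrable (fun y => S.a i j x * (f y * S.d j ρ (x - y)) -
            f y * S.a i j y * S.d j ρ (x - y)) := fun j => ((i2 j).const_mul _).sub (i3 j)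
        rw [integral_finsetSum _ fun j _ => i6 j]
        refine Finset.sum_congr rfl fun j _ => ?_
        rw [integral_sub ((i2 j).const_mul _) (i3 j), integral_const_mul]

theorem cF_cont {C ε : ℝ} {ρ : V → ℝ} (h : IsMoll S C ε ρ) {f : V → ℝ} (hf : Integrable f)
    (hfc : HasCompactSupport f) (i : ι) : Continuous (cF S i ρ f) := by
  have hc : ∀ j, Continuous (S.d j ρ) := fun j => d_cont S j (h.smooth.of_le (by simp))
  have hs : ∀ j, HasCompactSupport (S.d j ρ) := fun j => d_hcs S j (h.hcs S)
  have i1 : ∀ j, Integrable (fun y => f y * S.a i j y) := fun j =>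
    int_mul_cpt hf hfc (S.smooth i j).continuous
  have : cF S i ρ f = fun x => ∑ j, (S.a i j x * cv f (S.d j ρ) x -
      cv (fun y => f y * S.a i j y) (S.d j ρ) x) := funext fun x => cF_eq S h hf hfc i x
  rw [this]
  refine continuous_finsetSum _ fun j _ => ?_
  exact ((S.smooth i j).continuous.mul (cv_cont hf (hc j) (hs j))).sub
    (cv_cont (i1 j) (hc j) (hs j))

/-- commutator identity -/
theorem comm_id {C ε : ℝ} {ρ : V → ℝ} (h : IsMoll S C ε ρ) {f : V → ℝ} (hf : Integrable f)
    (hfc : HasCompactSupport f) {θ : V → ℝ} (hθ : ContDiff ℝ (⊤ : ℕ∞) θ)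
    (hθc : HasCompactSupport θ) :
    ∫ x, θ x * S.L (cv f ρ) x = (∫ y, f y * S.L (cv θ ρ) y) - ∫ x, ∑ i, S.d i θ x * cF S i ρ f x := by
  have hρ1 : ContDiff ℝ 1 ρ := h.smooth.of_le (by simp)
  have hc : ∀ j, Continuous (S.d j ρ) := fun j => d_cont S j hρ1
  have hs : ∀ j, HasCompactSupport (S.d j ρ) := fun j => d_hcs S j (h.hcs S)
  have hθ1 : ContDiff ℝ 1 θ := hθ.of_le (by simp)
  have hdθ : ∀ i, Continuous (S.d i θ) := fun i => d_cont S i hθ1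
  have hdθc : ∀ i, HasCompactSupport (S.d i θ) := fun i => d_hcs S i hθc
  have hdθi : ∀ i, Integrable (S.d i θ) := fun i => int_hcs (hdθ i) (hdθc i)
  have i1 : ∀ i j, Integrable (fun y => f y * S.a i j y) := fun i j =>
    int_mul_cpt hf hfc (S.smooth i j).continuous
  have i4 : ∀ i j, Integrable (fun x => S.d i θ x * (S.a i j x * cv f (S.d j ρ) x)) := fun i j =>
    int_hcs ((hdθ i).mul ((S.smooth i j).continuous.mul (cv_cont hf (hc j) (hs j)))) (hdθc i).mul_right
  have i5 : ∀ i j, Integrable (fun x => S.d i θ x * cv (fun y => f y * S.a i j y) (S.d j ρ) x) :=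
    fun i j => int_hcs ((hdθ i).mul (cv_cont (i1 i j) (hc j) (hs j))) (hdθc i).mul_right
  have e1 : ∫ x, θ x * S.L (cv f ρ) x =
      - ∑ i, ∑ j, ∫ x, S.d i θ x * (S.a i j x * cv f (S.d j ρ) x) := by
    rw [int_L S ((cv_contDiff hf h.smooth (h.hcs S)).of_le (by norm_cast)) hθ1
      (Or.inl hθc)]
    congr 1
    calc _ = ∫ x, ∑ i, ∑ j, S.d i θ x * (S.a i j x * cv f (S.d j ρ) x) := by
          congr 1; ext x
          refine Finset.sum_congr rfl fun i _ => Finset.sum_congr rfl fun j _ => ?_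
          rw [cv_d S j hf hρ1 (h.hcs S)]; ring
      _ = _ := by
          rw [integral_finsetSum _ fun i _ => integrable_finsetSum _ fun j _ => i4 i j]
          exact Finset.sum_congr rfl fun i _ => integral_finsetSum _ fun j _ => i4 i j
  have i6 : ∀ i j, Integrable (fun x => S.d i θ x * (S.a i j x * cv f (S.d j ρ) x) -
      S.d i θ x * cv (fun y => f y * S.a i j y) (S.d j ρ) x) := fun i j => (i4 i j).sub (i5 i j)
  have e2 : ∫ x, ∑ i, S.d i θ x * cF S i ρ f x =
      ∑ i, ∑ j, ((∫ x, S.d i θ x * (S.a i j x * cv f (S.d j ρ) x)) -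
        ∫ x, S.d i θ x * cv (fun y => f y * S.a i j y) (S.d j ρ) x) := by
    calc _ = ∫ x, ∑ i, ∑ j, (S.d i θ x * (S.a i j x * cv f (S.d j ρ) x) -
            S.d i θ x * cv (fun y => f y * S.a i j y) (S.d j ρ) x) := by
          congr 1; ext x
          refine Finset.sum_congr rfl fun i _ => ?_
          rw [cF_eq S h hf hfc, Finset.mul_sum]
          refine Finset.sum_congr rfl fun j _ => by ring
      _ = _ := by
          rw [integral_finsetSum _ fun i _ => integrable_finsetSum _ fun j _ => i6 i j]
          refine Finset.sum_congr rfl fun i _ => ?_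
          rw [integral_finsetSum _ fun j _ => i6 i j]
          exact Finset.sum_congr rfl fun j _ => integral_sub (i4 i j) (i5 i j)
  have e3 : ∫ y, f y * S.L (cv θ ρ) y =
      - ∑ i, ∑ j, ∫ x, S.d i θ x * cv (fun y => f y * S.a i j y) (S.d j ρ) x := by
    have hd : ∀ i j, S.d j (S.d i (cv θ ρ)) = cv (S.d i θ) (S.d j ρ) := fun i j => by
      rw [cv_d_left S i hθ1 hθc h.smooth.continuous, cv_d S j (hdθi i) hρ1 (h.hcs S)]
    have hneg : ∀ i j y, cv (S.d i θ) (S.d j ρ) y = - ∫ x, S.d i θ x * S.d j ρ (x - y) := by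
      intro i j y
      rw [cv, ← integral_neg]
      congr 1; ext x
      rw [← neg_sub x y, h.dodd S]; ring
    have i7 : ∀ i j, Integrable (fun y => f y * S.a i j y * cv (S.d i θ) (S.d j ρ) y) := by
      intro i j
      have hcc := cv_cont (hdθi i) (hc j) (hs j)
      have := int_mul_cpt hf hfc ((S.smooth i j).continuous.mul hcc)
      simpa [mul_assoc] using this
    calc ∫ y, f y * S.L (cv θ ρ) y =
        ∫ y, ∑ i, ∑ j, f y * S.a i j y * cv (S.d i θ) (S.d j ρ) y := by
          congr 1; ext y
          rw [EF.L, Finset.sum_comm, Finset.mul_sum]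
          refine Finset.sum_congr rfl fun i _ => ?_
          rw [Finset.mul_sum]
          refine Finset.sum_congr rfl fun j _ => ?_
          rw [hd, S.symm i j]; ring
      _ = ∑ i, ∑ j, ∫ y, f y * S.a i j y * cv (S.d i θ) (S.d j ρ) y := by
          rw [integral_finsetSum _ fun i _ => integrable_finsetSum _ fun j _ => i7 i j]
          exact Finset.sum_congr rfl fun i _ => integral_finsetSum _ fun j _ => i7 i j
      _ = _ := by
          rw [← Finset.sum_neg_distrib]
          refine Finset.sum_congr rfl fun i _ => ?_
          rw [← Finset.sum_neg_distrib]
          refine Finset.sum_congr rfl fun j _ => ?_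
          rw [cv_fubini (i1 i j) (hc j) (hs j) (hdθi i), ← integral_neg]
          congr 1; ext y
          rw [hneg]; ring
  rw [e1, e2, e3]
  simp only [Finset.sum_sub_distrib]
  ring

end moll

end APerron

end

open MeasureTheory Filter Topology Complex Metric

set_option linter.unusedSectionVars false
set_option linter.unusedSimpArgs false

noncomputable section

namespace APerron

open Module

section kato1

variable {V : Type*} [NormedAddCommGroup V] [NormedSpace ℝ V] [FiniteDimensional ℝ V]
  [MeasureSpace V] [BorelSpace V] [(volume : Measure V).IsAddHaarMeasure]
  {ι : Type*} [Fintype ι] (S : EF V ι)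

/-- coefficients are Lipschitz on balls -/
theorem a_lip (r : ℝ) : ∃ Λ : ℝ, 0 < Λ ∧ ∀ i j, ∀ x ∈ closedBall (0:V) r, ∀ y ∈ closedBall (0:V) r,
    |S.a i j x - S.a i j y| ≤ Λ * ‖x - y‖ := by
  have : ∀ i j, ∃ Λ : ℝ, 0 ≤ Λ ∧ ∀ x ∈ closedBall (0:V) r, ∀ y ∈ closedBall (0:V) r,
      |S.a i j x - S.a i j y| ≤ Λ * ‖x - y‖ := by
    intro i j
    obtain ⟨C, hC⟩ := (isCompact_closedBall (0:V) r).exists_bound_of_continuousOn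
      (f := fderiv ℝ (S.a i j)) ((S.smooth i j).continuous_fderiv (by norm_num)).continuousOn
    refine ⟨|C|, abs_nonneg _, fun x hx y hy => ?_⟩
    refine (convex_closedBall (0:V) r).norm_image_sub_le_of_norm_fderiv_le
      (fun z _ => (S.smooth i j).differentiable (by norm_num) z) (fun z hz => ?_) hy hx
    exact (hC z hz).trans (le_abs_self C)
  choose Λ h0 h using this
  refine ⟨1 + ∑ i, ∑ j, Λ i j, ?_, fun i j x hx y hy => (h i j x hx y hy).trans ?_⟩
  · have : 0 ≤ ∑ i, ∑ j, Λ i j := Finset.sum_nonneg fun i _ => Finset.sum_nonneg fun j _ => h0 i j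
    linarith
  · gcongr
    have h1 : Λ i j ≤ ∑ j, Λ i j :=
      Finset.single_le_sum (f := fun j => Λ i j) (fun j _ => h0 i j) (Finset.mem_univ j)
    have h2 : ∑ j, Λ i j ≤ ∑ i, ∑ j, Λ i j :=
      Finset.single_le_sum (f := fun i => ∑ j, Λ i j)
        (fun i _ => Finset.sum_nonneg fun j _ => h0 i j) (Finset.mem_univ i)
    linarith

/-- uniform ellipticity on compact sets -/
theorem a_ell {K : Set V} (hK : IsCompact K) : ∃ l : ℝ, 0 < l ∧ ∀ x ∈ K, ∀ ξ : ι → ℝ,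
    l * ∑ i, ξ i ^ 2 ≤ ∑ i, ∑ j, S.a i j x * ξ i * ξ j := by
  classical
  have hsph : IsCompact (sphere (0 : ι → ℝ) 1) := isCompact_sphere _ _
  have hcont : Continuous (fun p : V × (ι → ℝ) => ∑ i, ∑ j, S.a i j p.1 * p.2 i * p.2 j) := by
    refine continuous_finsetSum _ fun i _ => continuous_finsetSum _ fun j _ => ?_
    have := (S.smooth i j).continuous
    fun_prop
  obtain ⟨l, hl, hl'⟩ : ∃ l : ℝ, 0 < l ∧ ∀ x ∈ K, ∀ ξ ∈ sphere (0 : ι → ℝ) 1,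
      l ≤ ∑ i, ∑ j, S.a i j x * ξ i * ξ j := by
    rcases (K ×ˢ sphere (0 : ι → ℝ) 1).eq_empty_or_nonempty with he | hne
    · refine ⟨1, one_pos, fun x hx ξ hξ => ?_⟩
      exact absurd (show (x, ξ) ∈ K ×ˢ sphere (0 : ι → ℝ) 1 from ⟨hx, hξ⟩) (by rw [he]; simp)
    · obtain ⟨⟨x0, ξ0⟩, h0, hmin⟩ := (hK.prod hsph).exists_isMinOn hne hcont.continuousOn
      refine ⟨_, S.pos x0 ξ0 ?_, fun x hx ξ hξ => hmin (show (x, ξ) ∈ _ from ⟨hx, hξ⟩)⟩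
      rintro rfl
      have := h0.2
      simp at this
  set n := Fintype.card ι
  refine ⟨l / (n + 1), by positivity, fun x hx ξ => ?_⟩
  by_cases hξ : ξ = 0
  · simp [hξ]
  have hn : 0 < ‖ξ‖ := norm_pos_iff.mpr hξ
  have h1 := hl' x hx (‖ξ‖⁻¹ • ξ) (by simp [norm_smul, hn.ne'])
  have h2 : ∑ i, ∑ j, S.a i j x * (‖ξ‖⁻¹ • ξ) i * (‖ξ‖⁻¹ • ξ) j =
      (‖ξ‖⁻¹) ^ 2 * ∑ i, ∑ j, S.a i j x * ξ i * ξ j := by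
    simp only [Finset.mul_sum, Pi.smul_apply, smul_eq_mul]
    refine Finset.sum_congr rfl fun i _ => Finset.sum_congr rfl fun j _ => by ring
  rw [h2] at h1
  have h3 : l * ‖ξ‖ ^ 2 ≤ ∑ i, ∑ j, S.a i j x * ξ i * ξ j := by
    have := mul_le_mul_of_nonneg_right h1 (sq_nonneg ‖ξ‖)
    calc _ ≤ _ := this
      _ = _ := by field_simp
  refine le_trans ?_ h3
  have h4 : ∑ i, ξ i ^ 2 ≤ n * ‖ξ‖ ^ 2 := by
    calc ∑ i, ξ i ^ 2 ≤ ∑ i : ι, ‖ξ‖ ^ 2 := Finset.sum_le_sum fun i _ => by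
          have := norm_le_pi_norm ξ i
          rw [← sq_abs]; gcongr; exact this
      _ = _ := by simp [n]
  calc l / (n + 1) * ∑ i, ξ i ^ 2 ≤ l / (n + 1) * (n * ‖ξ‖ ^ 2) := by gcongr
    _ = l * ‖ξ‖ ^ 2 * (n / (n + 1)) := by ring
    _ ≤ l * ‖ξ‖ ^ 2 * 1 := by
        gcongr
        rw [div_le_one (by positivity)]; linarith
    _ = _ := mul_one _

/-- normalised box function -/
def bx (ε : ℝ) (z : V) : ℝ := (closedBall (0:V) ε).indicator (fun _ => (ε⁻¹) ^ finrank ℝ V) z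

theorem bx_meas (ε : ℝ) : Measurable (bx ε : V → ℝ) :=
  measurable_const.indicator isClosed_closedBall.measurableSet

theorem bx_nonneg {ε : ℝ} (hε : 0 < ε) (z : V) : 0 ≤ bx ε z :=
  Set.indicator_nonneg (fun _ _ => by positivity) _

theorem bx_of_le {ε : ℝ} {z : V} (h : ‖z‖ ≤ ε) : bx ε z = (ε⁻¹) ^ finrank ℝ V :=
  Set.indicator_of_mem (by simpa using h) _

theorem bx_of_lt {ε : ℝ} {z : V} (h : ε < ‖z‖) : bx ε z = 0 :=
  Set.indicator_of_notMem (by simpa using h) _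

theorem bx_le {ε : ℝ} (hε : 0 < ε) (z : V) : bx ε z ≤ (ε⁻¹) ^ finrank ℝ V := by
  rcases le_or_gt ‖z‖ ε with h | h
  · rw [bx_of_le h]
  · rw [bx_of_lt h]; positivity

theorem bx_lint {ε : ℝ} (hε : 0 < ε) :
    ∫⁻ z : V, ENNReal.ofReal (bx ε z) = volume (closedBall (0:V) 1) := by
  have : (fun z : V => ENNReal.ofReal (bx ε z)) =
      (closedBall (0:V) ε).indicator (fun _ => ENNReal.ofReal ((ε⁻¹) ^ finrank ℝ V)) := by
    ext z
    rcases le_or_gt ‖z‖ ε with h | h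
    · rw [bx_of_le h, Set.indicator_of_mem (by simpa using h)]
    · rw [bx_of_lt h, Set.indicator_of_notMem (by simpa using h)]; simp
  rw [this, lintegral_indicator_const isClosed_closedBall.measurableSet,
    Measure.addHaar_closedBall' _ _ hε.le, ← mul_assoc, ← ENNReal.ofReal_mul (by positivity),
    ← mul_pow, inv_mul_cancel₀ hε.ne']
  simp

theorem bx_int {ε : ℝ} (hε : 0 < ε) : Integrable (bx ε : V → ℝ) := by
  refine ⟨(bx_meas ε).aestronglyMeasurable, ?_⟩
  have : ∀ z : V, ‖bx ε z‖ₑ = ENNReal.ofReal (bx ε z) := fun z =>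
    Real.enorm_eq_ofReal (bx_nonneg hε z)
  unfold HasFiniteIntegral
  simp only [this, bx_lint hε]
  exact measure_closedBall_lt_top

theorem bx_integral {ε : ℝ} (hε : 0 < ε) :
    ∫ z : V, bx ε z = (volume (closedBall (0:V) 1)).toReal := by
  rw [integral_eq_lintegral_of_nonneg_ae (Eventually.of_forall (bx_nonneg hε))
    (bx_meas ε).aestronglyMeasurable, bx_lint hε]

/-- data for `AK` with kernel dominated by boxes -/
theorem AK_box {f : V → ℝ} (hf : Integrable f) {B : Set V} (hB : MeasurableSet B)
    {k : ℕ → V → V → ℝ} {M : ℕ → V → ℝ} {c : ℝ} {ε : ℕ → ℝ}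
    (hε : ∀ m, 0 < ε m) (hε0 : Tendsto ε atTop (𝓝 0))
    (hkm : ∀ m, ∀ x ∈ B, AEStronglyMeasurable (k m x) volume)
    (hk : ∀ᶠ m in atTop, ∀ x ∈ B, ∀ y, |k m x y| ≤ c * bx (ε m) (x - y))
    (hM : ∀ᶠ m in atTop, ∀ x ∈ B, ∫ y, k m x y = M m x) :
    Tendsto (fun m => ∫⁻ x in B, ‖(∫ y, k m x y * f y) - M m x * f x‖ₑ) atTop (𝓝 0) := by
  refine AK (Θ := fun m z => ENNReal.ofReal (|c| * bx (ε m) z))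
    (C := ENNReal.ofReal |c| * volume (closedBall (0:V) 1)) hf hB ?_ ?_ ?_ ?_ hkm ?_ hM
  · intro m
    exact ((bx_meas (ε m)).const_mul _).ennreal_ofReal
  · exact ENNReal.mul_ne_top (by simp) measure_closedBall_lt_top.ne
  · intro m
    simp only [ENNReal.ofReal_mul (abs_nonneg c)]
    rw [lintegral_const_mul _ (bx_meas (ε m)).ennreal_ofReal, bx_lint (hε m)]
  · intro r hr
    refine tendsto_const_nhds.congr' ?_
    filter_upwards [hε0.eventually (gt_mem_nhds hr)] with m hm
    rw [setLIntegral_congr_fun (g := fun _ => 0)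
      (measurableSet_le measurable_const measurable_norm)]
    · simp
    · intro z hz
      have : bx (ε m) z = 0 := bx_of_lt (lt_of_lt_of_le hm hz)
      simp [this]
  · filter_upwards [hk] with m hm x hx y
    rw [← ofReal_norm]
    apply ENNReal.ofReal_le_ofReal
    refine (hm x hx y).trans ?_
    have := bx_nonneg (hε m) (x - y)
    gcongr; exact le_abs_self c

theorem IsMoll.le_bx {C ε : ℝ} {ρ : V → ℝ} (h : IsMoll S C ε ρ) (z : V) :
    ρ z ≤ C * bx ε z := by
  rcases le_or_gt ‖z‖ ε with hz | hz
  · rw [bx_of_le hz]; exact h.le z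
  · rw [bx_of_lt hz, h.supp z hz]; simp

theorem IsMoll.dle_bx {C ε : ℝ} {ρ : V → ℝ} (h : IsMoll S C ε ρ) (i : ι) (z : V) :
    |ε * S.d i ρ z| ≤ C * bx ε z := by
  rcases le_or_gt ‖z‖ ε with hz | hz
  · rw [bx_of_le hz]; exact h.dle i z
  · rw [bx_of_lt hz, h.dsupp S i z hz]; simp

theorem IsMoll.dsq_bx {C ε : ℝ} {ρ : V → ℝ} (h : IsMoll S C ε ρ) (i : ι) (z : V) :
    (ε * S.d i ρ z) ^ 2 ≤ C * ρ z * bx ε z := by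
  rcases le_or_gt ‖z‖ ε with hz | hz
  · rw [bx_of_le hz]; exact h.dsq i z
  · rw [bx_of_lt hz, h.dsupp S i z hz]; simp

theorem cv_tendsto {f : V → ℝ} (hf : Integrable f) {C : ℝ} {ε : ℕ → ℝ} {ρ : ℕ → V → ℝ}
    (hε : ∀ m, 0 < ε m) (hε0 : Tendsto ε atTop (𝓝 0)) (hρ : ∀ m, IsMoll S C (ε m) (ρ m)) :
    Tendsto (fun m => ∫⁻ x, ‖cv f (ρ m) x - f x‖ₑ) atTop (𝓝 0) := by
  have := AK_box (B := Set.univ) (k := fun m x y => ρ m (x - y)) (M := fun _ _ => 1) (c := C)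
    hf MeasurableSet.univ hε hε0 (fun m x _ => ?_) (Eventually.of_forall fun m x _ y => ?_)
    (Eventually.of_forall fun m x _ => ?_)
  · simp only [Measure.restrict_univ, one_mul] at this
    refine this.congr fun m => ?_
    congr 1; ext x; rw [cv]; congr 3; ext y; ring
  · have := (hρ m).smooth.continuous
    exact (by fun_prop : Continuous fun y => ρ m (x - y)).aestronglyMeasurable
  · rw [abs_of_nonneg ((hρ m).nonneg _)]
    exact (hρ m).le_bx S _
  · rw [integral_sub_left_eq_self (ρ m) volume x, (hρ m).one]

theorem ck_bound {Λ r : ℝ} (hΛ : 0 < Λ) (hlip : ∀ i j, ∀ x ∈ closedBall (0:V) r,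
    ∀ y ∈ closedBall (0:V) r, |S.a i j x - S.a i j y| ≤ Λ * ‖x - y‖)
    {C ε : ℝ} (hε : 0 < ε) (hε1 : ε ≤ 1) {ρ : V → ℝ} (h : IsMoll S C ε ρ) (i : ι) {x : V}
    (hx : ‖x‖ + 1 ≤ r) (y : V) :
    |∑ j, (S.a i j x - S.a i j y) * S.d j ρ (x - y)| ≤ ∑ j, Λ * |ε * S.d j ρ (x - y)| := by
  refine (Finset.abs_sum_le_sum_abs _ _).trans (Finset.sum_le_sum fun j _ => ?_)
  rcases le_or_gt ‖x - y‖ ε with hz | hz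
  · have hxr : x ∈ closedBall (0:V) r := by simp; linarith
    have hyr : y ∈ closedBall (0:V) r := by
      simp only [mem_closedBall, dist_zero_right]
      have : ‖y‖ ≤ ‖x‖ + ‖x - y‖ := by
        have := norm_sub_le x (x - y); simpa using this
      linarith
    rw [abs_mul, abs_mul, abs_of_pos hε, ← mul_assoc]
    refine mul_le_mul_of_nonneg_right ?_ (abs_nonneg _)
    exact (hlip i j x hxr y hyr).trans (by gcongr)
  · rw [h.dsupp S j _ hz]; simp

theorem ck_bound' {Λ r : ℝ} (hΛ : 0 < Λ) (hlip : ∀ i j, ∀ x ∈ closedBall (0:V) r,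
    ∀ y ∈ closedBall (0:V) r, |S.a i j x - S.a i j y| ≤ Λ * ‖x - y‖)
    {C ε : ℝ} (hε : 0 < ε) (hε1 : ε ≤ 1) {ρ : V → ℝ} (h : IsMoll S C ε ρ) (i : ι) {x : V}
    (hx : ‖x‖ + 1 ≤ r) (y : V) :
    |∑ j, (S.a i j x - S.a i j y) * S.d j ρ (x - y)| ≤
      (Fintype.card ι * (Λ * C)) * bx ε (x - y) := by
  refine (ck_bound S hΛ hlip hε hε1 h i hx y).trans ?_
  calc _ ≤ ∑ j : ι, Λ * (C * bx ε (x - y)) := Finset.sum_le_sum fun j _ => by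
        gcongr; exact h.dle_bx S j _
    _ = _ := by simp; ring

theorem ck_mean {C ε : ℝ} {ρ : V → ℝ} (h : IsMoll S C ε ρ) (i : ι) (x : V) :
    ∫ y, ∑ j, (S.a i j x - S.a i j y) * S.d j ρ (x - y) = 0 := by
  have hρ1 : ContDiff ℝ 1 ρ := h.smooth.of_le (by simp)
  have hg : ContDiff ℝ 1 (fun y => ρ (x - y)) := hρ1.comp (contDiff_const.sub contDiff_id)
  have hgc : HasCompactSupport (fun y => ρ (x - y)) :=
    (h.hcs S).comp_homeomorph (Homeomorph.subLeft x)
  have hb : ∀ j, ContDiff ℝ 1 (fun y => S.a i j x - S.a i j y) := fun j =>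
    contDiff_const.sub (S.smooth i j)
  have hd : ∀ j y, S.d j (fun y => ρ (x - y)) y = - S.d j ρ (x - y) := by
    intro j y
    have h1 : HasFDerivAt (fun y : V => x - y) (-ContinuousLinearMap.id ℝ V) y :=
      (hasFDerivAt_id y).const_sub x
    have h2 : HasFDerivAt ρ (fderiv ℝ ρ (x - y)) (x - y) :=
      (hρ1.differentiable (by norm_num) _).hasFDerivAt
    have h3 : fderiv ℝ (fun y => ρ (x - y)) y = _ := (h2.comp y h1).fderiv
    unfold EF.d
    rw [h3]; simp
  have hd2 : ∀ j y, S.d j (fun y => S.a i j x - S.a i j y) y = - fderiv ℝ (S.a j i) y (S.e j) := by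
    intro j y
    have : S.a j i = S.a i j := funext fun y => S.symm i j y
    unfold EF.d
    rw [fderiv_const_sub, this]; simp
  have key : ∀ j, ∫ y, (S.a i j x - S.a i j y) * S.d j ρ (x - y) =
      ∫ y, - (fderiv ℝ (S.a j i) y (S.e j) * ρ (x - y)) := by
    intro j
    have := ibp S j (hb j) hg (Or.inr hgc)
    simp only [hd, hd2] at this
    simp only [mul_neg, integral_neg, neg_mul, neg_neg] at this ⊢
    linarith
  have c1 : ∀ j, Continuous (S.d j ρ) := fun j => d_cont S j hρ1
  have c2 : ∀ j, HasCompactSupport (fun y => S.d j ρ (x - y)) := fun j =>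
    (d_hcs S j (h.hcs S)).comp_homeomorph (Homeomorph.subLeft x)
  rw [integral_finsetSum]
  · simp only [key]
    rw [← integral_finsetSum]
    · have : ∀ y, ∑ j, -(fderiv ℝ (S.a j i) y (S.e j) * ρ (x - y)) = 0 := by
        intro y
        rw [Finset.sum_neg_distrib, ← Finset.sum_mul, S.div]; simp
      simp [this]
    · intro j _
      have c3 : Continuous (fun y => fderiv ℝ (S.a j i) y (S.e j)) := d_cont S j (S.smooth j i)
      exact (int_hcs (c3.mul hg.continuous) hgc.mul_left).neg
  · intro j _
    have := c1 j
    exact int_hcs ((hb j).continuous.mul (by fun_prop)) (c2 j).mul_left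

theorem cF_tendsto {f : V → ℝ} (hf : Integrable f) {C : ℝ} {ε : ℕ → ℝ} {ρ : ℕ → V → ℝ}
    (hε : ∀ m, 0 < ε m) (hε0 : Tendsto ε atTop (𝓝 0)) (hρ : ∀ m, IsMoll S C (ε m) (ρ m))
    {K : Set V} (hK : IsCompact K) (i : ι) :
    Tendsto (fun m => ∫⁻ x in K, ‖cF S i (ρ m) f x‖ₑ) atTop (𝓝 0) := by
  obtain ⟨r, hr⟩ := hK.isBounded.subset_closedBall (0:V)
  obtain ⟨Λ, hΛ, hlip⟩ := a_lip S (r + 1)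
  have := AK_box (B := K) (k := fun m x y => ∑ j, (S.a i j x - S.a i j y) * S.d j (ρ m) (x - y))
    (M := fun _ _ => 0) (c := (Fintype.card ι * (Λ * C)))
    hf hK.measurableSet hε hε0 (fun m x _ => ?_) ?_
    (Eventually.of_forall fun m x _ => ck_mean S (hρ m) i x)
  · simpa [cF] using this
  · refine Continuous.aestronglyMeasurable (continuous_finsetSum _ fun j _ => ?_)
    have := d_cont S j ((hρ m).smooth.of_le (by simp : (1 : WithTop ℕ∞) ≤ (⊤ : ℕ∞)))
    have := (S.smooth i j).continuous
    fun_prop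
  · filter_upwards [hε0.eventually (ge_mem_nhds one_pos)] with m hm x hx y
    have := hr hx
    simp at this
    exact ck_bound' S hΛ hlip (hε m) hm (hρ m) i (by linarith) y

theorem disc_lemma {X A B : ℝ} (hX : 0 ≤ X) (hA : 0 ≤ A) (h : ∀ t > 0, 2 * X * t ≤ t ^ 2 * A + B) :
    X ^ 2 ≤ A * B := by
  rcases hX.eq_or_lt with rfl | hX
  · have hB : 0 ≤ B := by
      have h0 : Tendsto (fun t : ℝ => t ^ 2 * A + B) (𝓝[>] 0) (𝓝 (0 ^ 2 * A + B)) :=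
        (Continuous.tendsto (by fun_prop) 0).mono_left nhdsWithin_le_nhds
      have := ge_of_tendsto h0 (by
        filter_upwards [self_mem_nhdsWithin] with t ht
        simpa using h t ht)
      simpa using this
    nlinarith
  · rcases hA.eq_or_lt with rfl | hA
    · exfalso
      have h1 := h 1 one_pos
      have hB : 0 < B := by linarith
      have := h (B / X) (by positivity)
      have e : 2 * X * (B / X) = 2 * B := by field_simp
      rw [e] at this
      linarith
    · have := h (X / A) (by positivity)
      field_simp at this
      nlinarith

theorem bxcv_int {f : V → ℝ} (hf : Integrable f) {ε : ℝ} (hε : 0 < ε) (x : V) :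
    Integrable (fun t => |f t| * bx ε (x - t)) := by
  refine hf.abs.mul_bdd (c := (ε⁻¹) ^ finrank ℝ V)
    (by have := bx_meas (V := V) ε; exact (by fun_prop : Measurable fun t => bx ε (x - t)).aestronglyMeasurable)
    (Eventually.of_forall fun t => ?_)
  rw [Real.norm_of_nonneg (bx_nonneg hε _)]; exact bx_le hε _

/-- L∞ bound -/
theorem cF_bound {Λ r : ℝ} (hΛ : 0 < Λ) (hlip : ∀ i j, ∀ x ∈ closedBall (0:V) r,
    ∀ y ∈ closedBall (0:V) r, |S.a i j x - S.a i j y| ≤ Λ * ‖x - y‖)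
    {C ε : ℝ} (hε : 0 < ε) (hε1 : ε ≤ 1) (hC : 0 < C) {ρ : V → ℝ} (h : IsMoll S C ε ρ) (i : ι) {x : V}
    (hx : ‖x‖ + 1 ≤ r) {f : V → ℝ} {T : ℝ} (hT : 0 ≤ T) (hfT : ∀ y, |f y| ≤ T) :
    |cF S i ρ f x| ≤ (Fintype.card ι * (Λ * C)) * (volume (closedBall (0:V) 1)).toReal * T := by
  set c := (Fintype.card ι * (Λ * C)) with hc
  have hc0 : 0 ≤ c := by positivity
  have hi : Integrable (fun y => c * bx ε (x - y) * T) :=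
    (((bx_int hε).comp_sub_left x).const_mul c).mul_const T
  calc |cF S i ρ f x| ≤ ∫ y, c * bx ε (x - y) * T := by
        rw [← Real.norm_eq_abs]
        refine norm_integral_le_of_norm_le hi (Eventually.of_forall fun y => ?_)
        rw [Real.norm_eq_abs, abs_mul]
        have := ck_bound' S hΛ hlip hε hε1 h i hx y
        have := bx_nonneg hε (x - y)
        gcongr; exact hfT y
    _ = _ := by
        rw [integral_mul_const, integral_const_mul, integral_sub_left_eq_self (bx ε) volume x,
          bx_integral hε]

/-- square bound -/
theorem cF_sq {Λ r : ℝ} (hΛ : 0 < Λ) (hlip : ∀ i j, ∀ x ∈ closedBall (0:V) r,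
    ∀ y ∈ closedBall (0:V) r, |S.a i j x - S.a i j y| ≤ Λ * ‖x - y‖)
    {C ε : ℝ} (hε : 0 < ε) (hε1 : ε ≤ 1) (hC : 0 < C) {ρ : V → ℝ} (h : IsMoll S C ε ρ) (i : ι) {x : V}
    (hx : ‖x‖ + 1 ≤ r) {f : V → ℝ} (hf : Integrable f) :
    (cF S i ρ f x) ^ 2 ≤
      ((Fintype.card ι * Λ) ^ 2 * C) * (cv (fun y => |f y|) ρ x * cv (fun y => |f y|) (bx ε) x) := by
  set c := (Fintype.card ι * Λ) with hc
  have hc0 : 0 ≤ c := by positivity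
  have i1 : Integrable (fun t => |f t| * ρ (x - t)) := cv_int hf.abs h.smooth.continuous (h.hcs S) x
  have i2 := bxcv_int hf hε x
  have hA : 0 ≤ cv (fun y => |f y|) ρ x := integral_nonneg fun y => mul_nonneg (abs_nonneg _) (h.nonneg _)
  rw [← sq_abs]
  have := disc_lemma (X := |cF S i ρ f x|) (A := c ^ 2 * cv (fun y => |f y|) ρ x)
    (B := C * cv (fun y => |f y|) (bx ε) x) (abs_nonneg _) (by positivity) ?_
  · calc _ ≤ _ := this
      _ = _ := by ring
  intro t ht
  have hi : Integrable (fun y => t * c ^ 2 * (|f y| * ρ (x - y)) + C / t * (|f y| * bx ε (x - y))) :=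
    (i1.const_mul _).add (i2.const_mul _)
  have hle : 2 * |cF S i ρ f x| ≤ ∫ y, (t * c ^ 2 * (|f y| * ρ (x - y)) + C / t * (|f y| * bx ε (x - y))) := by
    have : 2 * |cF S i ρ f x| = |∫ y, 2 * ((∑ j, (S.a i j x - S.a i j y) * S.d j ρ (x - y)) * f y)| := by
      rw [integral_const_mul, abs_mul, cF]; simp
    rw [this, ← Real.norm_eq_abs]
    refine norm_integral_le_of_norm_le hi (Eventually.of_forall fun y => ?_)
    rw [Real.norm_eq_abs, abs_mul, abs_mul]
    have h1 := ck_bound S hΛ hlip hε hε1 h i hx y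
    have h2 : ∀ j, |ε * S.d j ρ (x - y)| ≤ Real.sqrt (C * ρ (x - y) * bx ε (x - y)) := fun j =>
      Real.abs_le_sqrt (h.dsq_bx S j _)
    have h3 : |∑ j, (S.a i j x - S.a i j y) * S.d j ρ (x - y)| ≤
        c * Real.sqrt (C * ρ (x - y) * bx ε (x - y)) := by
      refine h1.trans ((Finset.sum_le_sum (g := fun _ : ι => Λ * Real.sqrt (C * ρ (x - y) * bx ε (x - y)))
        fun j _ => by gcongr; exact h2 j).trans ?_)
      simp [hc]; linarith
    have hρ0 := h.nonneg (x - y)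
    have hb0 := bx_nonneg hε (x - y)
    have h4 : 2 * (c * Real.sqrt (C * ρ (x - y) * bx ε (x - y))) ≤
        t * c ^ 2 * ρ (x - y) + C / t * bx ε (x - y) := by
      have e : C * ρ (x - y) * bx ε (x - y) = ρ (x - y) * (C * bx ε (x - y)) := by ring
      rw [e, Real.sqrt_mul hρ0]
      set p := Real.sqrt (ρ (x - y))
      set q := Real.sqrt (C * bx ε (x - y))
      have hp : ρ (x - y) = p ^ 2 := (Real.sq_sqrt hρ0).symm
      have hq : C * bx ε (x - y) = q ^ 2 := (Real.sq_sqrt (by positivity)).symm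
      have e2 : C / t * bx ε (x - y) = q ^ 2 / t := by rw [← hq]; ring
      rw [hp, e2]
      have := sq_nonneg (t * c * p - q)
      rw [← sub_nonneg]
      have : t * c ^ 2 * p ^ 2 + q ^ 2 / t - 2 * (c * (p * q)) = (t * c * p - q) ^ 2 / t := by
        field_simp; ring
      rw [this]; positivity
    calc |(2:ℝ)| * (|∑ j, (S.a i j x - S.a i j y) * S.d j ρ (x - y)| * |f y|)
        ≤ 2 * (c * Real.sqrt (C * ρ (x - y) * bx ε (x - y)) * |f y|) := by
          rw [abs_of_pos (by norm_num : (0:ℝ) < 2)]; gcongr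
      _ = 2 * (c * Real.sqrt (C * ρ (x - y) * bx ε (x - y))) * |f y| := by ring
      _ ≤ (t * c ^ 2 * ρ (x - y) + C / t * bx ε (x - y)) * |f y| := by gcongr
      _ = _ := by ring
  rw [integral_add (i1.const_mul _) (i2.const_mul _), integral_const_mul, integral_const_mul] at hle
  change 2 * |cF S i ρ f x| ≤ t * c ^ 2 * cv (fun y => |f y|) ρ x + C / t * cv (fun y => |f y|) (bx ε) x at hle
  have := mul_le_mul_of_nonneg_right hle ht.le
  calc _ ≤ _ := this
    _ = _ := by field_simp

theorem bxcv_integral {f : V → ℝ} (hf : Integrable f) {ε : ℝ} (hε : 0 < ε) :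
    Integrable (cv (fun y => |f y|) (bx ε)) ∧
    ∫ x, cv (fun y => |f y|) (bx ε) x = (∫ y, |f y|) * (volume (closedBall (0:V) 1)).toReal := by
  rw [cv_eq]
  refine ⟨hf.abs.integrable_convolution _ (bx_int hε), ?_⟩
  rw [integral_convolution _ hf.abs (bx_int hε), bx_integral hε]
  simp

end kato1

end APerron

end

open MeasureTheory Filter Topology Complex Metric

set_option linter.unusedSectionVars false
set_option linter.unusedSimpArgs false
set_option linter.unusedVariables false

noncomputable section

namespace APerron

open Module

section beta

/-- smooth approximation of the positive part -/
def be (δ t : ℝ) : ℝ := (t + Real.sqrt (t ^ 2 + δ ^ 2)) / 2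
def be1 (δ t : ℝ) : ℝ := (1 + t / Real.sqrt (t ^ 2 + δ ^ 2)) / 2
def be2 (δ t : ℝ) : ℝ := δ ^ 2 / (2 * Real.sqrt (t ^ 2 + δ ^ 2) ^ 3)

variable {δ : ℝ} (hδ : 0 < δ)

theorem be_sq (hδ : 0 < δ) (t : ℝ) : 0 < t ^ 2 + δ ^ 2 := by positivity
theorem be_sqrt (hδ : 0 < δ) (t : ℝ) : 0 < Real.sqrt (t ^ 2 + δ ^ 2) := Real.sqrt_pos.mpr (be_sq hδ t)
theorem be_sqrt_ge (hδ : 0 < δ) (t : ℝ) : |t| ≤ Real.sqrt (t ^ 2 + δ ^ 2) :=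
  Real.abs_le_sqrt (by nlinarith)
theorem be_sqrt_ge' (hδ : 0 < δ) (t : ℝ) : δ ≤ Real.sqrt (t ^ 2 + δ ^ 2) :=
  Real.le_sqrt_of_sq_le (by nlinarith [sq_nonneg t])

theorem be_sqrt_hasDeriv (hδ : 0 < δ) (t : ℝ) :
    HasDerivAt (fun t => Real.sqrt (t ^ 2 + δ ^ 2)) (t / Real.sqrt (t ^ 2 + δ ^ 2)) t := by
  have h1 : HasDerivAt (fun t : ℝ => t ^ 2 + δ ^ 2) (2 * t) t := by
    simpa using (hasDerivAt_pow 2 t).add_const (δ ^ 2)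
  have := h1.sqrt (be_sq hδ t).ne'
  convert this using 1
  field_simp

theorem be_hasDeriv (hδ : 0 < δ) (t : ℝ) : HasDerivAt (be δ) (be1 δ t) t :=
  ((hasDerivAt_id t).add (be_sqrt_hasDeriv hδ t)).div_const 2

theorem be1_hasDeriv (hδ : 0 < δ) (t : ℝ) : HasDerivAt (be1 δ) (be2 δ t) t := by
  have h := (((hasDerivAt_id t).div (be_sqrt_hasDeriv hδ t) (be_sqrt hδ t).ne').const_add 1).div_const 2
  have hs := be_sqrt hδ t
  have e : be2 δ t = (1 * Real.sqrt (t ^ 2 + δ ^ 2) - id t * (t / Real.sqrt (t ^ 2 + δ ^ 2))) /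
      Real.sqrt (t ^ 2 + δ ^ 2) ^ 2 / 2 := by
    unfold be2
    have h2 : Real.sqrt (t ^ 2 + δ ^ 2) ^ 2 = t ^ 2 + δ ^ 2 := Real.sq_sqrt (be_sq hδ t).le
    set s := Real.sqrt (t ^ 2 + δ ^ 2)
    have : δ ^ 2 = s ^ 2 - t ^ 2 := by linarith
    rw [this]
    simp only [id]
    field_simp
  rw [e]
  exact h

theorem be_contDiff (hδ : 0 < δ) : ContDiff ℝ (⊤ : ℕ∞) (be δ) := by
  have : ContDiff ℝ (⊤ : ℕ∞) (fun t : ℝ => Real.sqrt (t ^ 2 + δ ^ 2)) :=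
    ContDiff.sqrt (by fun_prop) fun t => (be_sq hδ t).ne'
  exact (contDiff_id.add this).div_const 2

theorem be1_contDiff (hδ : 0 < δ) : ContDiff ℝ (⊤ : ℕ∞) (be1 δ) := by
  have : ContDiff ℝ (⊤ : ℕ∞) (fun t : ℝ => Real.sqrt (t ^ 2 + δ ^ 2)) :=
    ContDiff.sqrt (by fun_prop) fun t => (be_sq hδ t).ne'
  exact (contDiff_const.add (contDiff_id.div this fun t => (be_sqrt hδ t).ne')).div_const 2

theorem be2_cont (hδ : 0 < δ) : Continuous (be2 δ) := by
  unfold be2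
  refine continuous_const.div (by fun_prop) fun t => ?_
  have := be_sqrt hδ t
  positivity

theorem be2_nonneg (hδ : 0 < δ) (t : ℝ) : 0 ≤ be2 δ t := by
  have := be_sqrt hδ t
  unfold be2; positivity

theorem be1_mem (hδ : 0 < δ) (t : ℝ) : 0 ≤ be1 δ t ∧ be1 δ t ≤ 1 := by
  have h := be_sqrt hδ t
  have h2 := abs_le.mp (be_sqrt_ge hδ t)
  have h3 : -1 ≤ t / Real.sqrt (t ^ 2 + δ ^ 2) := by rw [le_div_iff₀ h]; linarith
  have h4 : t / Real.sqrt (t ^ 2 + δ ^ 2) ≤ 1 := by rw [div_le_one h]; linarith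
  unfold be1
  constructor <;> linarith

theorem be2_le (hδ : 0 < δ) (t : ℝ) : be2 δ t ≤ 1 / (2 * δ) := by
  have h := be_sqrt hδ t
  have h2 := be_sqrt_ge' hδ t
  unfold be2
  set s := Real.sqrt (t ^ 2 + δ ^ 2)
  rw [div_le_div_iff₀ (by positivity) (by positivity)]
  have : δ ^ 3 ≤ s ^ 3 := by gcongr
  nlinarith

theorem be2_mul_le (hδ : 0 < δ) (t : ℝ) : be2 δ t * |t| ≤ 1 / 2 := by
  have h := be_sqrt hδ t
  have h1 := be_sqrt_ge hδ t
  have h2 := be_sqrt_ge' hδ t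
  unfold be2
  set s := Real.sqrt (t ^ 2 + δ ^ 2)
  rw [div_mul_eq_mul_div, div_le_div_iff₀ (by positivity) (by positivity)]
  have : δ ^ 2 * |t| ≤ s ^ 2 * s := by gcongr
  nlinarith

theorem be_lip (hδ : 0 < δ) (s t : ℝ) : |be δ s - be δ t| ≤ |s - t| := by
  have := (convex_univ (𝕜 := ℝ) (E := ℝ)).norm_image_sub_le_of_norm_hasDerivWithin_le
    (f := be δ) (f' := be1 δ) (C := 1) (x := t) (y := s) (fun x _ => (be_hasDeriv hδ x).hasDerivWithinAt)
    (fun x _ => by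
      have := be1_mem hδ x
      rw [Real.norm_eq_abs, abs_le]; constructor <;> linarith) trivial trivial
  simpa using this

theorem be_max (hδ : 0 < δ) (t : ℝ) : |be δ t - max t 0| ≤ δ := by
  have h1 := be_sqrt_ge hδ t
  have h2 : Real.sqrt (t ^ 2 + δ ^ 2) ≤ |t| + δ := by
    rw [Real.sqrt_le_left (by positivity)]
    have := sq_abs t
    nlinarith [abs_nonneg t]
  unfold be
  rw [abs_le]
  rcases le_total 0 t with h | h
  · rw [max_eq_left h]; rw [abs_of_nonneg h] at h1 h2; constructor <;> linarith
  · rw [max_eq_right h]; rw [abs_of_nonpos h] at h1 h2; constructor <;> linarith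

end beta

section kato2

variable {V : Type*} [NormedAddCommGroup V] [NormedSpace ℝ V] [FiniteDimensional ℝ V]
  [MeasureSpace V] [BorelSpace V] [(volume : Measure V).IsAddHaarMeasure]
  {ι : Type*} [Fintype ι] (S : EF V ι)

/-- abstract Kato inequality for smooth functions with commutator errors -/
theorem kato_smooth {δ l : ℝ} (hδ : 0 < δ) (hl : 0 < l) {φ f h : V → ℝ}
    (hφ : ContDiff ℝ (⊤ : ℕ∞) φ) (hφc : HasCompactSupport φ) (hφ0 : ∀ x, 0 ≤ φ x)
    (hf : ContDiff ℝ (⊤ : ℕ∞) f) (hh : ContDiff ℝ (⊤ : ℕ∞) h)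
    (hell : ∀ x ∈ tsupport φ, ∀ ξ : ι → ℝ, l * ∑ i, ξ i ^ 2 ≤ ∑ i, ∑ j, S.a i j x * ξ i * ξ j)
    {F H : ι → V → ℝ} (hF : ∀ i, Continuous (F i)) (hH : ∀ i, Continuous (H i))
    (pf : ∀ θ : V → ℝ, ContDiff ℝ (⊤ : ℕ∞) θ → tsupport θ ⊆ tsupport φ → (∀ x, 0 ≤ θ x) →
      0 ≤ (∫ x, θ x * S.L f x) + ∫ x, ∑ i, S.d i θ x * F i x)
    (ph : ∀ θ : V → ℝ, ContDiff ℝ (⊤ : ℕ∞) θ → tsupport θ ⊆ tsupport φ → (∀ x, 0 ≤ θ x) →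
      0 ≤ (∫ x, θ x * S.L h x) + ∫ x, ∑ i, S.d i θ x * H i x) :
    - (∫ x, ∑ i, |S.d i φ x| * (|F i x| + |H i x|)) -
      (∫ x, 1 / (4 * l) * (φ x * be2 δ (f x - h x) * ∑ i, (F i x - H i x) ^ 2)) ≤
      ∫ x, (h x + be δ (f x - h x)) * S.L φ x := by
  have h2t : (2 : WithTop ℕ∞) ≤ ((⊤ : ℕ∞) : WithTop ℕ∞) := by norm_cast
  have h1t : (1 : WithTop ℕ∞) ≤ ((⊤ : ℕ∞) : WithTop ℕ∞) := by simp
  set w : V → ℝ := fun x => f x - h x with hw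
  have hws : ContDiff ℝ (⊤ : ℕ∞) w := hf.sub hh
  set b1 : V → ℝ := fun x => be1 δ (w x) with hb1
  have hb1s : ContDiff ℝ (⊤ : ℕ∞) b1 := (be1_contDiff hδ).comp hws
  have hbs : ContDiff ℝ (⊤ : ℕ∞) (fun x => be δ (w x)) := (be_contDiff hδ).comp hws
  have hΨs : ContDiff ℝ (⊤ : ℕ∞) (fun x => h x + be δ (w x)) := hh.add hbs
  have hb2c : Continuous (fun x => be2 δ (w x)) := (be2_cont hδ).comp hws.continuous
  set θ1 : V → ℝ := fun x => φ x * b1 x with hθ1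
  set θ2 : V → ℝ := fun x => φ x * (1 - b1 x) with hθ2
  have s1 : ContDiff ℝ (⊤ : ℕ∞) θ1 := hφ.mul hb1s
  have s2 : ContDiff ℝ (⊤ : ℕ∞) θ2 := hφ.mul (contDiff_const.sub hb1s)
  have t1 : tsupport θ1 ⊆ tsupport φ := tsupport_mul_subset_left
  have t2 : tsupport θ2 ⊆ tsupport φ := tsupport_mul_subset_left
  have c1 : HasCompactSupport θ1 := hφc.mul_right
  have c2 : HasCompactSupport θ2 := hφc.mul_right
  have p1 := pf θ1 s1 t1 fun x => mul_nonneg (hφ0 x) (be1_mem hδ _).1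
  have p2 := ph θ2 s2 t2 fun x => mul_nonneg (hφ0 x) (by have := (be1_mem hδ (w x)).2; simp only [hb1]; linarith)
  have Lf := L_cont S (hf.of_le h2t)
  have Lh := L_cont S (hh.of_le h2t)
  have dw : ∀ i, Continuous (S.d i w) := fun i => d_cont S i (hws.of_le h1t)
  have db1 : ∀ i x, S.d i b1 x = be2 δ (w x) * S.d i w x := fun i x =>
    d_comp S i (hws.differentiable (by simp) x) (be1_hasDeriv hδ _)
  have d1 : ∀ i x, S.d i θ1 x = S.d i φ x * b1 x + φ x * (be2 δ (w x) * S.d i w x) := fun i x => by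
    rw [hθ1, d_mul S i (hφ.of_le h1t) (hb1s.of_le h1t), db1]
  have d2 : ∀ i x, S.d i θ2 x = S.d i φ x * (1 - b1 x) - φ x * (be2 δ (w x) * S.d i w x) := fun i x => by
    rw [hθ2, d_mul S i (hφ.of_le h1t) ((contDiff_const.sub hb1s).of_le h1t)]
    have : S.d i (fun y => 1 - b1 y) x = - (be2 δ (w x) * S.d i w x) := by
      rw [← db1]; unfold EF.d; rw [fderiv_const_sub]; simp
    rw [this]; ring
  have LΨ : ∀ x, S.L (fun x => h x + be δ (w x)) x = S.L h x + (b1 x * (S.L f x - S.L h x) +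
      be2 δ (w x) * ∑ i, ∑ j, S.a i j x * S.d i w x * S.d j w x) := by
    intro x
    rw [L_add S (hh.of_le h2t) (hbs.of_le h2t)]
    simp only
    rw [L_comp S (hws.of_le h2t) (g1 := be1 δ) (Eventually.of_forall fun t => be_hasDeriv hδ t)
      (be1_hasDeriv hδ _)]
    have : S.L f = fun x => S.L w x + S.L h x := by
      rw [← L_add S (hws.of_le h2t) (hh.of_le h2t)]; simp [hw]
    rw [this]; simp only [hb1]; ring
  rw [← L_symm S (hΨs.of_le h2t) (hφ.of_le h2t) (Or.inl hφc)]
  have i1 : Integrable (fun x => θ1 x * S.L f x) := int_hcs (s1.continuous.mul Lf) c1.mul_right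
  have i2 : Integrable (fun x => θ2 x * S.L h x) := int_hcs (s2.continuous.mul Lh) c2.mul_right
  have i3 : Integrable (fun x => ∑ i, S.d i θ1 x * F i x) := integrable_finsetSum _ fun i _ =>
    int_hcs ((d_cont S i (s1.of_le h1t)).mul (hF i)) (d_hcs S i c1).mul_right
  have i4 : Integrable (fun x => ∑ i, S.d i θ2 x * H i x) := integrable_finsetSum _ fun i _ =>
    int_hcs ((d_cont S i (s2.of_le h1t)).mul (hH i)) (d_hcs S i c2).mul_right
  have i5 : Integrable (fun x => ∑ i, |S.d i φ x| * (|F i x| + |H i x|)) :=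
    integrable_finsetSum _ fun i _ => int_hcs
      ((d_cont S i (hφ.of_le h1t)).abs.mul ((hF i).abs.add (hH i).abs))
      ((d_hcs S i hφc).norm.mul_right)
  have i6 : Integrable (fun x => 1 / (4 * l) * (φ x * be2 δ (f x - h x) * ∑ i, (F i x - H i x) ^ 2)) := by
    refine Integrable.const_mul (int_hcs ((hφ.continuous.mul hb2c).mul
      (continuous_finsetSum _ fun i _ => ((hF i).sub (hH i)).pow 2)) ?_) _
    exact (hφc.mul_right).mul_right
  have i7 : Integrable (fun x => φ x * S.L (fun x => h x + be δ (w x)) x) :=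
    int_hcs (hφ.continuous.mul (L_cont S (hΨs.of_le h2t))) hφc.mul_right
  have key : (∫ x, ((θ1 x * S.L f x + ∑ i, S.d i θ1 x * F i x) +
      (θ2 x * S.L h x + ∑ i, S.d i θ2 x * H i x))) ≤
      ∫ x, (φ x * S.L (fun x => h x + be δ (w x)) x + (∑ i, |S.d i φ x| * (|F i x| + |H i x|)) +
        1 / (4 * l) * (φ x * be2 δ (f x - h x) * ∑ i, (F i x - H i x) ^ 2)) := by
    refine integral_mono ((i1.add i3).add (i2.add i4)) ((i7.add i5).add i6) fun x => ?_
    simp only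
    rw [LΨ]
    have hb := be1_mem hδ (w x)
    have hb2 := be2_nonneg hδ (w x)
    have hφx := hφ0 x
    have q1 : ∑ i, S.d i θ1 x * F i x + ∑ i, S.d i θ2 x * H i x ≤
        (∑ i, |S.d i φ x| * (|F i x| + |H i x|)) +
        φ x * be2 δ (w x) * ∑ i, S.d i w x * (F i x - H i x) := by
      rw [Finset.mul_sum, ← Finset.sum_add_distrib, ← Finset.sum_add_distrib]
      refine Finset.sum_le_sum fun i _ => ?_
      rw [d1, d2]
      have e1 : S.d i φ x * (b1 x * F i x) ≤ |S.d i φ x| * |F i x| := by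
        refine (le_abs_self _).trans ?_
        rw [abs_mul, abs_mul, abs_of_nonneg hb.1]
        gcongr
        exact mul_le_of_le_one_left (abs_nonneg _) hb.2
      have e2 : S.d i φ x * ((1 - b1 x) * H i x) ≤ |S.d i φ x| * |H i x| := by
        refine (le_abs_self _).trans ?_
        rw [abs_mul, abs_mul, abs_of_nonneg (by simp only [hb1]; linarith : 0 ≤ 1 - b1 x)]
        gcongr
        exact mul_le_of_le_one_left (abs_nonneg _) (by simp only [hb1]; linarith)
      linarith
    have q2 : φ x * be2 δ (w x) * ∑ i, S.d i w x * (F i x - H i x) ≤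
        φ x * (be2 δ (w x) * ∑ i, ∑ j, S.a i j x * S.d i w x * S.d j w x) +
        1 / (4 * l) * (φ x * be2 δ (f x - h x) * ∑ i, (F i x - H i x) ^ 2) := by
      by_cases hx : x ∈ tsupport φ
      · have hq := hell x hx (fun i => S.d i w x)
        have : ∑ i, S.d i w x * (F i x - H i x) ≤ l * ∑ i, (S.d i w x) ^ 2 +
            1 / (4 * l) * ∑ i, (F i x - H i x) ^ 2 := by
          rw [Finset.mul_sum, Finset.mul_sum, ← Finset.sum_add_distrib]
          refine Finset.sum_le_sum fun i _ => ?_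
          rw [← sub_nonneg]
          have : l * S.d i w x ^ 2 + 1 / (4 * l) * (F i x - H i x) ^ 2 - S.d i w x * (F i x - H i x) =
            (2 * l * S.d i w x - (F i x - H i x)) ^ 2 / (4 * l) := by field_simp; ring
          rw [this]; positivity
        have hp : 0 ≤ φ x * be2 δ (w x) := mul_nonneg hφx hb2
        have := mul_le_mul_of_nonneg_left (this.trans (add_le_add_left hq _)) hp
        calc _ ≤ _ := this
          _ = _ := by simp only [hw]; ring
      · simp [image_eq_zero_of_notMem_tsupport hx]
    have e : φ x * (S.L h x + (b1 x * (S.L f x - S.L h x) +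
      be2 δ (w x) * ∑ i, ∑ j, S.a i j x * S.d i w x * S.d j w x)) = θ1 x * S.L f x + θ2 x * S.L h x +
      φ x * (be2 δ (w x) * ∑ i, ∑ j, S.a i j x * S.d i w x * S.d j w x) := by
      simp only [hθ1, hθ2]; ring
    rw [e]
    linarith
  have j1 : Integrable (fun x => θ1 x * S.L f x + ∑ i, S.d i θ1 x * F i x) := i1.add i3
  have j2 : Integrable (fun x => θ2 x * S.L h x + ∑ i, S.d i θ2 x * H i x) := i2.add i4
  have j3 : Integrable (fun x => φ x * S.L (fun x => h x + be δ (w x)) x +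
      (∑ i, |S.d i φ x| * (|F i x| + |H i x|))) := i7.add i5
  rw [integral_add j1 j2, integral_add i1 i3, integral_add i2 i4,
    integral_add j3 i6, integral_add i7 i5] at key
  linarith

/-- weak subsolutions -/
def WSub (D : Set V) (u : V → ℝ) : Prop :=
  LocallyIntegrableOn u D ∧ ∀ φ : V → ℝ, ContDiff ℝ (⊤ : ℕ∞) φ → HasCompactSupport φ →
    tsupport φ ⊆ D → (∀ z, 0 ≤ φ z) → 0 ≤ ∫ z, u z * S.L φ z

theorem cF_add {C ε : ℝ} {ρ : V → ℝ} (h : IsMoll S C ε ρ) {f g : V → ℝ} (hf : Integrable f)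
    (hg : Integrable g) (i : ι) (x : V) :
    cF S i ρ (fun y => f y + g y) x = cF S i ρ f x + cF S i ρ g x := by
  have hρ1 : ContDiff ℝ 1 ρ := h.smooth.of_le (by simp)
  have hcont : Continuous (fun y => ∑ j, (S.a i j x - S.a i j y) * S.d j ρ (x - y)) := by
    refine continuous_finsetSum _ fun j _ => ?_
    have := d_cont S j hρ1
    have := (S.smooth i j).continuous
    fun_prop
  have hcs : HasCompactSupport (fun y => ∑ j, (S.a i j x - S.a i j y) * S.d j ρ (x - y)) := by
    apply HasCompactSupport.intro (isCompact_closedBall x ε)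
    intro y hy
    refine Finset.sum_eq_zero fun j _ => ?_
    rw [h.dsupp S j, mul_zero]
    rw [mem_closedBall, dist_comm, dist_eq_norm] at hy
    exact not_le.mp hy
  obtain ⟨B, -, hB⟩ := bdd_of_hcs hcont hcs
  have i1 := fun {f : V → ℝ} (hf : Integrable f) => hf.bdd_mul (c := B) hcont.aestronglyMeasurable
    (Eventually.of_forall hB)
  unfold cF
  rw [← integral_add (i1 hf) (i1 hg)]
  congr 1; ext y; ring

theorem cF_tendsto' {f : V → ℝ} (hf : Integrable f) (hfc : HasCompactSupport f)
    {C : ℝ} {ε : ℕ → ℝ} {ρ : ℕ → V → ℝ}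
    (hε : ∀ m, 0 < ε m) (hε0 : Tendsto ε atTop (𝓝 0)) (hρ : ∀ m, IsMoll S C (ε m) (ρ m))
    {K : Set V} (hK : IsCompact K) (i : ι) :
    Tendsto (fun m => ∫ x in K, |cF S i (ρ m) f x|) atTop (𝓝 0) := by
  have := (ENNReal.tendsto_toReal ENNReal.zero_ne_top).comp (cF_tendsto S hf hε hε0 hρ hK i)
  simp only [ENNReal.toReal_zero] at this
  refine this.congr fun m => ?_
  rw [Function.comp, ← integral_norm_eq_lintegral_enorm
    (cF_cont S (hρ m) hf hfc i).aestronglyMeasurable]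
  rfl

theorem cv_tendsto' {f : V → ℝ} (hf : Integrable f) {C : ℝ} {ε : ℕ → ℝ} {ρ : ℕ → V → ℝ}
    (hε : ∀ m, 0 < ε m) (hε0 : Tendsto ε atTop (𝓝 0)) (hρ : ∀ m, IsMoll S C (ε m) (ρ m)) :
    Tendsto (fun m => ∫ x, |cv f (ρ m) x - f x|) atTop (𝓝 0) := by
  have := (ENNReal.tendsto_toReal ENNReal.zero_ne_top).comp (cv_tendsto S hf hε hε0 hρ)
  simp only [ENNReal.toReal_zero] at this
  refine this.congr fun m => ?_
  have hm : AEStronglyMeasurable (fun x => cv f (ρ m) x - f x) volume :=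
    (cv_contDiff hf (hρ m).smooth ((hρ m).hcs S)).continuous.aestronglyMeasurable.sub
      hf.aestronglyMeasurable
  rw [Function.comp, ← integral_norm_eq_lintegral_enorm hm]
  rfl

end kato2

end APerron

end

open MeasureTheory Filter Topology Complex Metric

set_option linter.unusedSectionVars false
set_option linter.unusedSimpArgs false
set_option linter.unusedVariables false

noncomputable section

namespace APerron

open Module

section kato3

variable {V : Type*} [NormedAddCommGroup V] [NormedSpace ℝ V] [FiniteDimensional ℝ V]
  [MeasureSpace V] [BorelSpace V] [(volume : Measure V).IsAddHaarMeasure]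
  {ι : Type*} [Fintype ι] (S : EF V ι)

theorem cv_nonneg {f g : V → ℝ} (hf : ∀ x, 0 ≤ f x) (hg : ∀ x, 0 ≤ g x) (x : V) : 0 ≤ cv f g x :=
  integral_nonneg fun t => mul_nonneg (hf t) (hg _)

theorem cv_abs_le {C ε : ℝ} {ρ : V → ℝ} (h : IsMoll S C ε ρ) {f : V → ℝ} (hf : Integrable f) {M : ℝ}
    (hM : ∀ x, |f x| ≤ M) (x : V) : |cv f ρ x| ≤ M := by
  have hρi : Integrable (fun t => ρ (x - t)) :=
    int_hcs (by have := h.smooth.continuous; fun_prop) ((h.hcs S).comp_homeomorph (Homeomorph.subLeft x))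
  unfold cv
  calc |∫ t, f t * ρ (x - t)| ≤ ∫ t, |f t * ρ (x - t)| := abs_integral_le_integral_abs
    _ ≤ ∫ t, M * ρ (x - t) := by
        refine integral_mono (cv_int hf h.smooth.continuous (h.hcs S) x).abs (hρi.const_mul M) fun t => ?_
        simp only
        rw [abs_mul, abs_of_nonneg (h.nonneg _)]
        exact mul_le_mul_of_nonneg_right (hM t) (h.nonneg _)
    _ = M := by
        rw [integral_const_mul, integral_sub_left_eq_self (fun z => ρ z), h.one, mul_one]

theorem cv_supp {C ε : ℝ} (hε : 0 < ε) {ρ : V → ℝ} (h : IsMoll S C ε ρ) {f : V → ℝ} :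
    tsupport (cv f ρ) ⊆ cthickening ε (tsupport f) := by
  apply closure_minimal _ isClosed_cthickening
  intro x hx
  by_contra hc
  apply hx
  unfold cv
  apply integral_eq_zero_of_ae
  refine Eventually.of_forall fun t => ?_
  by_cases ht : t ∈ tsupport f
  · have : ε < ‖x - t‖ := by
      by_contra h'
      exact hc (mem_cthickening_of_dist_le x t ε _ ht (by rw [dist_eq_norm]; exact not_lt.mp h'))
    simp [h.supp _ this]
  · simp [image_eq_zero_of_notMem_tsupport ht]

theorem wsub_pos {D K' : Set V} {u : V → ℝ} (hu : WSub S D u) (hK' : IsCompact K')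
    (hK'D : K' ⊆ D) {C ε : ℝ} (hε : 0 < ε) {ρ : V → ℝ} (h : IsMoll S C ε ρ) {θ : V → ℝ}
    (hθ : ContDiff ℝ (⊤ : ℕ∞) θ) (hθc : HasCompactSupport θ) (ht : cthickening ε (tsupport θ) ⊆ K')
    (h0 : ∀ x, 0 ≤ θ x) :
    0 ≤ (∫ x, θ x * S.L (cv (K'.indicator u) ρ) x) +
      ∫ x, ∑ i, S.d i θ x * cF S i ρ (K'.indicator u) x := by
  have hi : Integrable (K'.indicator u) :=
    (integrable_indicator_iff hK'.measurableSet).mpr (hu.1.integrableOn_compact_subset hK'D hK')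
  have hc : HasCompactSupport (K'.indicator u) := HasCompactSupport.intro hK' fun x hx =>
    Set.indicator_of_notMem hx _
  rw [comm_id S h hi hc hθ hθc, sub_add_cancel]
  have hts : tsupport (cv θ ρ) ⊆ K' := (cv_supp S hε h).trans ht
  have h1 := hu.2 (cv θ ρ) (cv_contDiff (int_hcs hθ.continuous hθc) h.smooth (h.hcs S))
    (hK'.of_isClosed_subset (isClosed_tsupport _) hts) (hts.trans hK'D) (cv_nonneg h0 h.nonneg)
  refine h1.trans (le_of_eq (integral_congr_ae (Eventually.of_forall fun x => ?_)))
  simp only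
  by_cases hx : x ∈ K'
  · rw [Set.indicator_of_mem hx]
  · have : S.L (cv θ ρ) x = 0 := image_eq_zero_of_notMem_tsupport fun h' => hx (hts (L_tsupport S h'))
    simp [this]

theorem err_tendsto {δ : ℝ} (hδ : 0 < δ) {f h : V → ℝ} (hf : Integrable f) (hfc : HasCompactSupport f)
    (hh : Integrable h) (hhc : HasCompactSupport h) (sg : (∀ x, 0 ≤ f x) ∨ (∀ x, f x ≤ 0))
    {M : ℝ} (hM : ∀ x, |h x| ≤ M) {C : ℝ} (hC : 0 < C) {ε : ℕ → ℝ} {ρ : ℕ → V → ℝ}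
    (hε : ∀ m, 0 < ε m) (hε1 : ∀ m, ε m ≤ 1)
    (hε0 : Tendsto ε atTop (𝓝 0)) (hρ : ∀ m, IsMoll S C (ε m) (ρ m))
    {K : Set V} (hK : IsCompact K) (i : ι) :
    Tendsto (fun m => ∫ x in K, be2 δ (cv f (ρ m) x - cv h (ρ m) x) *
      (cF S i (ρ m) f x - cF S i (ρ m) h x) ^ 2) atTop (𝓝 0) := by
  have hM0 : 0 ≤ M := (abs_nonneg _).trans (hM 0)
  obtain ⟨r, hr⟩ := hK.isBounded.subset_closedBall (0:V)
  obtain ⟨Λ, hΛ, hlip⟩ := a_lip S (r + 1)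
  have hxr : ∀ x ∈ K, ‖x‖ + 1 ≤ r + 1 := fun x hx => by simpa using hr hx
  set vB := (volume (closedBall (0:V) 1)).toReal with hvB
  have hvB0 : 0 ≤ vB := ENNReal.toReal_nonneg
  set c1 := (Fintype.card ι * (Λ * C)) * vB with hc1
  have hc10 : 0 ≤ c1 := by positivity
  set c2 := (Fintype.card ι * Λ) ^ 2 * C with hc2
  have hc20 : 0 ≤ c2 := by positivity
  set c3 := c2 * (1 / 2 + M / (2 * δ)) with hc3
  have hc30 : 0 ≤ c3 := by positivity
  -- truncations
  let g1 : ℕ → V → ℝ := fun T x => max (-(T:ℝ)) (min (f x) T)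
  let g2 : ℕ → V → ℝ := fun T x => f x - g1 T x
  have g1T : ∀ T x, |g1 T x| ≤ T := fun T x => by
    have hT : (0:ℝ) ≤ T := Nat.cast_nonneg T
    rw [abs_le]
    exact ⟨le_max_left _ _, max_le (by linarith) (min_le_right _ _)⟩
  have g1f : ∀ T x, |g1 T x| ≤ |f x| := fun T x => by
    have hT : (0:ℝ) ≤ T := Nat.cast_nonneg T
    simp only [g1]
    grind
  have g2f : ∀ T x, |g2 T x| ≤ |f x| := fun T x => by
    have hT : (0:ℝ) ≤ T := Nat.cast_nonneg T
    simp only [g2, g1]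
    grind
  have g1i : ∀ T, Integrable (g1 T) := fun T => hf.mono
    (aestronglyMeasurable_const.sup (hf.aestronglyMeasurable.inf aestronglyMeasurable_const))
    (Eventually.of_forall fun x => g1f T x)
  have g2i : ∀ T, Integrable (g2 T) := fun T => hf.sub (g1i T)
  have g1c : ∀ T, HasCompactSupport (g1 T) := fun T => hfc.mono' fun x hx => by
    apply subset_tsupport
    intro h0
    have := g1f T x
    rw [h0] at this
    exact hx (by simpa using this)
  have g2c : ∀ T, HasCompactSupport (g2 T) := fun T => hfc.mono' fun x hx => by
    apply subset_tsupport
    intro h0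
    have := g2f T x
    rw [h0] at this
    exact hx (by simpa using this)
  have g20 : Tendsto (fun T => ∫ x, |g2 T x|) atTop (𝓝 0) := by
    have := tendsto_integral_of_dominated_convergence (F := fun T x => |g2 T x|) (f := fun _ => (0:ℝ))
      (μ := volume) (fun x => |f x|) (fun T => (g2i T).aestronglyMeasurable.norm) hf.abs
      (fun T => Eventually.of_forall fun x => by simpa using g2f T x)
      (Eventually.of_forall fun x => by
        obtain ⟨N, hN⟩ := exists_nat_ge |f x|
        refine tendsto_const_nhds.congr' ?_
        filter_upwards [eventually_ge_atTop N] with T hT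
        have : |f x| ≤ T := hN.trans (by exact_mod_cast hT)
        have h2 := abs_le.mp this
        simp only [g2, g1]
        rw [min_eq_left h2.2, max_eq_right h2.1]; simp)
    simpa using this
  have hFc : ∀ m, Continuous (cF S i (ρ m) f) := fun m => cF_cont S (hρ m) hf hfc i
  have hF1c : ∀ T m, Continuous (cF S i (ρ m) (g1 T)) := fun T m => cF_cont S (hρ m) (g1i T) (g1c T) i
  have hHc : ∀ m, Continuous (cF S i (ρ m) h) := fun m => cF_cont S (hρ m) hh hhc i
  have hwc : ∀ m, Continuous (fun x => cv f (ρ m) x - cv h (ρ m) x) := fun m =>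
    (cv_cont hf (hρ m).smooth.continuous ((hρ m).hcs S)).sub
    (cv_cont hh (hρ m).smooth.continuous ((hρ m).hcs S))
  -- pointwise bound
  have pw : ∀ T m, ∀ x ∈ K, be2 δ (cv f (ρ m) x - cv h (ρ m) x) *
      (cF S i (ρ m) f x - cF S i (ρ m) h x) ^ 2 ≤
      3 / (2 * δ) * (c1 * T) * |cF S i (ρ m) (g1 T) x| + 3 / (2 * δ) * (c1 * M) * |cF S i (ρ m) h x|
      + 3 * c3 * cv (fun y => |g2 T y|) (bx (ε m)) x := by
    intro T m x hx
    have e : cF S i (ρ m) f x = cF S i (ρ m) (g1 T) x + cF S i (ρ m) (g2 T) x := by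
      rw [← cF_add S (hρ m) (g1i T) (g2i T)]
      congr 1; ext y; simp [g2]
    have b1 := cF_bound S hΛ hlip (hε m) (hε1 m) hC (hρ m) i (hxr x hx) (Nat.cast_nonneg T) (g1T T)
    have b2 := cF_bound S hΛ hlip (hε m) (hε1 m) hC (hρ m) i (hxr x hx) hM0 hM
    have b3 := cF_sq S hΛ hlip (hε m) (hε1 m) hC (hρ m) i (hxr x hx) (g2i T)
    rw [← hvB, ← hc1] at b1 b2
    rw [← hc2] at b3
    have hb0 := be2_nonneg hδ (cv f (ρ m) x - cv h (ρ m) x)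
    have hb1 := be2_le hδ (cv f (ρ m) x - cv h (ρ m) x)
    have hb2 := be2_mul_le hδ (cv f (ρ m) x - cv h (ρ m) x)
    have hcvh := cv_abs_le S (hρ m) hh hM x
    have hcvf : cv (fun y => |g2 T y|) (ρ m) x ≤ |cv f (ρ m) x| := by
      have i1 := cv_int hf (hρ m).smooth.continuous ((hρ m).hcs S) x
      have i2 := cv_int (g2i T).abs (hρ m).smooth.continuous ((hρ m).hcs S) x
      unfold cv
      rcases sg with sg | sg
      · refine le_trans (integral_mono i2 i1 fun t => ?_) (le_abs_self _)
        refine mul_le_mul_of_nonneg_right ?_ ((hρ m).nonneg _)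
        have := g2f T t
        rwa [abs_of_nonneg (sg t)] at this
      · refine le_trans (le_trans (integral_mono i2 i1.neg fun t => ?_) ?_) (neg_le_abs _)
        · simp only [Pi.neg_apply]
          rw [← neg_mul]
          refine mul_le_mul_of_nonneg_right ?_ ((hρ m).nonneg _)
          have := g2f T t
          rwa [abs_of_nonpos (sg t)] at this
        · rw [← integral_neg]; rfl
    have hbx : 0 ≤ cv (fun y => |g2 T y|) (bx (ε m)) x :=
      cv_nonneg (fun y => abs_nonneg _) (bx_nonneg (hε m)) x
    rw [e]
    set b := be2 δ (cv f (ρ m) x - cv h (ρ m) x)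
    set F1 := cF S i (ρ m) (g1 T) x
    set F2 := cF S i (ρ m) (g2 T) x
    set H := cF S i (ρ m) h x
    set P := cv (fun y => |g2 T y|) (ρ m) x
    set Q := cv (fun y => |g2 T y|) (bx (ε m)) x
    have hbP : b * P ≤ 1 / 2 + M / (2 * δ) := by
      calc b * P ≤ b * (|cv f (ρ m) x - cv h (ρ m) x| + |cv h (ρ m) x|) := by
            gcongr
            refine hcvf.trans ?_
            have := abs_add_le (cv f (ρ m) x - cv h (ρ m) x) (cv h (ρ m) x)
            simpa using this
        _ = b * |cv f (ρ m) x - cv h (ρ m) x| + b * |cv h (ρ m) x| := by ring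
        _ ≤ 1 / 2 + 1 / (2 * δ) * M := by gcongr
        _ = _ := by ring
    have t1 : b * F1 ^ 2 ≤ 1 / (2 * δ) * (c1 * T * |F1|) := by
      rw [← sq_abs, pow_two]; gcongr
    have t2 : b * H ^ 2 ≤ 1 / (2 * δ) * (c1 * M * |H|) := by
      rw [← sq_abs, pow_two]; gcongr
    have t3 : b * F2 ^ 2 ≤ c3 * Q := by
      calc b * F2 ^ 2 ≤ b * (c2 * (P * Q)) := by gcongr
        _ = c2 * (b * P) * Q := by ring
        _ ≤ c2 * (1 / 2 + M / (2 * δ)) * Q := by gcongr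
    have t0 : (F1 + F2 - H) ^ 2 ≤ 3 * (F1 ^ 2 + F2 ^ 2 + H ^ 2) := by
      nlinarith [sq_nonneg (F1 - F2), sq_nonneg (F1 + H), sq_nonneg (F2 + H)]
    calc b * (F1 + F2 - H) ^ 2 ≤ b * (3 * (F1 ^ 2 + F2 ^ 2 + H ^ 2)) := by gcongr
      _ = 3 * (b * F1 ^ 2 + b * H ^ 2 + b * F2 ^ 2) := by ring
      _ ≤ 3 * (1 / (2 * δ) * (c1 * T * |F1|) + 1 / (2 * δ) * (c1 * M * |H|) + c3 * Q) := by gcongr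
      _ = _ := by ring
  have ib : ∀ T m, (∫ x in K, be2 δ (cv f (ρ m) x - cv h (ρ m) x) *
      (cF S i (ρ m) f x - cF S i (ρ m) h x) ^ 2) ≤
      3 / (2 * δ) * (c1 * T) * (∫ x in K, |cF S i (ρ m) (g1 T) x|) +
      3 / (2 * δ) * (c1 * M) * (∫ x in K, |cF S i (ρ m) h x|) + 3 * c3 * ((∫ y, |g2 T y|) * vB) := by
    intro T m
    have k1 : IntegrableOn (fun x => |cF S i (ρ m) (g1 T) x|) K := (hF1c T m).abs.continuousOn.integrableOn_compact hK
    have k2 : IntegrableOn (fun x => |cF S i (ρ m) h x|) K := (hHc m).abs.continuousOn.integrableOn_compact hK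
    have k3 := bxcv_integral (g2i T) (hε m)
    have k4 : IntegrableOn (fun x => 3 / (2 * δ) * (c1 * T) * |cF S i (ρ m) (g1 T) x| +
      3 / (2 * δ) * (c1 * M) * |cF S i (ρ m) h x|) K := (k1.const_mul _).add (k2.const_mul _)
    have k5 : IntegrableOn (fun x => 3 * c3 * cv (fun y => |g2 T y|) (bx (ε m)) x) K :=
      k3.1.integrableOn.const_mul _
    have := setIntegral_mono_on (f := fun x => be2 δ (cv f (ρ m) x - cv h (ρ m) x) *
      (cF S i (ρ m) f x - cF S i (ρ m) h x) ^ 2) ((((be2_cont hδ).comp (hwc m)).mul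
        (((hFc m).sub (hHc m)).pow 2)).continuousOn.integrableOn_compact hK) (k4.add k5)
      hK.measurableSet (pw T m)
    refine this.trans ?_
    simp only [Pi.add_apply]
    rw [integral_add k4 k5, integral_add (k1.const_mul _) (k2.const_mul _), integral_const_mul,
      integral_const_mul, integral_const_mul, ← k3.2]
    gcongr
    · exact Eventually.of_forall (cv_nonneg (fun y => abs_nonneg _) (bx_nonneg (hε m)))
    · exact k3.1
    · exact Measure.restrict_le_self
  rw [Metric.tendsto_atTop]
  intro η hη
  have : Tendsto (fun T => 3 * c3 * ((∫ y, |g2 T y|) * vB)) atTop (𝓝 (3 * c3 * (0 * vB))) :=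
    (g20.mul_const _).const_mul _
  rw [zero_mul, mul_zero] at this
  obtain ⟨T, hT⟩ := (this.eventually (gt_mem_nhds (half_pos hη))).exists
  have l1 := ((cF_tendsto' S (g1i T) (g1c T) hε hε0 hρ hK i).const_mul (3 / (2 * δ) * (c1 * T))).add
    ((cF_tendsto' S hh hhc hε hε0 hρ hK i).const_mul (3 / (2 * δ) * (c1 * M)))
  simp only [mul_zero, add_zero] at l1
  obtain ⟨N, hN⟩ := eventually_atTop.mp (l1.eventually (gt_mem_nhds (half_pos hη)))
  refine ⟨N, fun m hm => ?_⟩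
  have h1 := hN m hm
  have h2 := ib T m
  rw [Real.dist_eq, sub_zero, abs_of_nonneg]
  · linarith
  · exact setIntegral_nonneg hK.measurableSet fun x _ => mul_nonneg (be2_nonneg hδ _) (sq_nonneg _)

theorem kato_sgn {D : Set V} (hD : IsOpen D) {u v : V → ℝ} (hu : WSub S D u) (hv : WSub S D v)
    (sg : (∀ x ∈ D, 0 ≤ u x) ∨ (∀ x ∈ D, u x ≤ 0)) {M : ℝ} (hM : ∀ x ∈ D, |v x| ≤ M) (hM0 : 0 ≤ M) :
    WSub S D (fun x => max (u x) (v x)) := by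
  have h1t : (1 : WithTop ℕ∞) ≤ ((⊤ : ℕ∞) : WithTop ℕ∞) := by simp
  have h2t : (2 : WithTop ℕ∞) ≤ ((⊤ : ℕ∞) : WithTop ℕ∞) := by norm_cast
  refine ⟨?_, fun φ hφ hφc hφD hφ0 => ?_⟩
  · intro x hx
    obtain ⟨s, hs, hi⟩ := hu.1 x hx
    obtain ⟨t, ht, hj⟩ := hv.1 x hx
    exact ⟨s ∩ t, inter_mem hs ht, Integrable.sup (hi.mono_set Set.inter_subset_left)
      (hj.mono_set Set.inter_subset_right)⟩
  set K := tsupport φ with hK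
  have hKc : IsCompact K := hφc
  obtain ⟨r0, hr0, hr0D⟩ := hKc.exists_cthickening_subset_open hD hφD
  set K' := cthickening r0 K with hK'
  have hK'c : IsCompact K' := hKc.cthickening
  have hKK' : K ⊆ K' := self_subset_cthickening _
  set f := K'.indicator u with hf
  set h := K'.indicator v with hh
  have hfi : Integrable f :=
    (integrable_indicator_iff hK'c.measurableSet).mpr (hu.1.integrableOn_compact_subset hr0D hK'c)
  have hfc : HasCompactSupport f := HasCompactSupport.intro hK'c fun x hx => Set.indicator_of_notMem hx _
  have hhi : Integrable h :=
    (integrable_indicator_iff hK'c.measurableSet).mpr (hv.1.integrableOn_compact_subset hr0D hK'c)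
  have hhc : HasCompactSupport h := HasCompactSupport.intro hK'c fun x hx => Set.indicator_of_notMem hx _
  have hsg : (∀ x, 0 ≤ f x) ∨ (∀ x, f x ≤ 0) := by
    rcases sg with sg | sg
    · left; intro x; exact Set.indicator_apply_nonneg fun hx => sg x (hr0D hx)
    · right; intro x; exact Set.indicator_apply_nonpos fun hx => sg x (hr0D hx)
  have hhM : ∀ x, |h x| ≤ M := fun x => by
    by_cases hx : x ∈ K'
    · rw [hh, Set.indicator_of_mem hx]; exact hM x (hr0D hx)
    · rw [hh, Set.indicator_of_notMem hx]; simpa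
  obtain ⟨C, hC, hmoll⟩ := exists_moll S
  set r1 := min r0 1 with hr1
  have hr1p : 0 < r1 := lt_min hr0 one_pos
  set ε : ℕ → ℝ := fun m => r1 * (1 / ((m:ℝ) + 1)) with hεd
  have hε : ∀ m, 0 < ε m := fun m => by positivity
  have hεr : ∀ m, ε m ≤ r1 := fun m => by
    have : 1 / ((m:ℝ) + 1) ≤ 1 := by rw [div_le_one (by positivity)]; linarith [(Nat.cast_nonneg m : (0:ℝ) ≤ m)]
    exact mul_le_of_le_one_right hr1p.le this
  have hε0 : Tendsto ε atTop (𝓝 0) := by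
    have := (tendsto_one_div_add_atTop_nhds_zero_nat (𝕜 := ℝ)).const_mul r1
    rwa [mul_zero] at this
  choose ρ hρ using fun m => hmoll (ε m) (hε m)
  obtain ⟨l, hl, hell⟩ := a_ell S hKc
  have hLc := L_cont S (hφ.of_le h2t)
  have hLs : HasCompactSupport (S.L φ) := L_hcs S hφc
  obtain ⟨BL, hBL0, hBL⟩ := bdd_of_hcs hLc hLs
  -- zero outside
  have outK : ∀ x, x ∉ K → S.L φ x = 0 := fun x hx =>
    image_eq_zero_of_notMem_tsupport fun h' => hx (L_tsupport S h')
  have step : ∀ δ > 0, 0 ≤ ∫ x, (h x + be δ (f x - h x)) * S.L φ x := by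
    intro δ hδ
    have ineq : ∀ m, - (∫ x, ∑ i, |S.d i φ x| * (|cF S i (ρ m) f x| + |cF S i (ρ m) h x|)) -
      (∫ x, 1 / (4 * l) * (φ x * be2 δ (cv f (ρ m) x - cv h (ρ m) x) *
        ∑ i, (cF S i (ρ m) f x - cF S i (ρ m) h x) ^ 2)) ≤
      ∫ x, (cv h (ρ m) x + be δ (cv f (ρ m) x - cv h (ρ m) x)) * S.L φ x := by
      intro m
      refine kato_smooth S hδ hl hφ hφc hφ0 (cv_contDiff hfi (hρ m).smooth ((hρ m).hcs S))
        (cv_contDiff hhi (hρ m).smooth ((hρ m).hcs S)) hell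
        (fun i => cF_cont S (hρ m) hfi hfc i) (fun i => cF_cont S (hρ m) hhi hhc i) ?_ ?_
      · intro θ hθ ht h0
        refine wsub_pos S hu hK'c hr0D (hε m) (hρ m) hθ (hKc.of_isClosed_subset (isClosed_tsupport _) ht) ?_ h0
        exact (cthickening_subset_of_subset _ ht).trans
          (cthickening_mono ((hεr m).trans (min_le_left _ _)) _)
      · intro θ hθ ht h0
        refine wsub_pos S hv hK'c hr0D (hε m) (hρ m) hθ (hKc.of_isClosed_subset (isClosed_tsupport _) ht) ?_ h0
        exact (cthickening_subset_of_subset _ ht).trans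
          (cthickening_mono ((hεr m).trans (min_le_left _ _)) _)
    -- first error
    have A0 : Tendsto (fun m => ∫ x, ∑ i, |S.d i φ x| * (|cF S i (ρ m) f x| + |cF S i (ρ m) h x|))
        atTop (𝓝 0) := by
      have e : ∀ m, (∫ x, ∑ i, |S.d i φ x| * (|cF S i (ρ m) f x| + |cF S i (ρ m) h x|)) =
          ∑ i, ∫ x, |S.d i φ x| * (|cF S i (ρ m) f x| + |cF S i (ρ m) h x|) := fun m => by
        refine integral_finsetSum _ fun i _ => int_hcs ((d_cont S i (hφ.of_le h1t)).abs.mul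
          ((cF_cont S (hρ m) hfi hfc i).abs.add (cF_cont S (hρ m) hhi hhc i).abs))
          ((d_hcs S i hφc).norm.mul_right)
      simp only [e]
      rw [show (0:ℝ) = ∑ i : ι, 0 by simp]
      refine tendsto_finsetSum _ fun i _ => ?_
      obtain ⟨B, hB0, hB⟩ := bdd_of_hcs (d_cont S i (hφ.of_le h1t)) (d_hcs S i hφc)
      have lim := ((cF_tendsto' S hfi hfc hε hε0 hρ hKc i).add
        (cF_tendsto' S hhi hhc hε hε0 hρ hKc i)).const_mul B
      simp only [add_zero, mul_zero] at lim
      refine squeeze_zero (fun m => integral_nonneg fun x => by positivity) (fun m => ?_) lim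
      have k1 : IntegrableOn (fun x => |cF S i (ρ m) f x|) K :=
        (cF_cont S (hρ m) hfi hfc i).abs.continuousOn.integrableOn_compact hKc
      have k2 : IntegrableOn (fun x => |cF S i (ρ m) h x|) K :=
        (cF_cont S (hρ m) hhi hhc i).abs.continuousOn.integrableOn_compact hKc
      rw [← integral_add k1 k2, ← integral_const_mul]
      rw [← setIntegral_eq_integral_of_forall_compl_eq_zero (s := K)]
      · refine setIntegral_mono_on ?_ ((k1.add k2).const_mul _) hKc.measurableSet fun x _ => ?_
        · exact ((d_cont S i (hφ.of_le h1t)).abs.mul ((cF_cont S (hρ m) hfi hfc i).abs.add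
            (cF_cont S (hρ m) hhi hhc i).abs)).continuousOn.integrableOn_compact hKc
        · gcongr; exact hB x
      · intro x hx
        rw [image_eq_zero_of_notMem_tsupport fun h' => hx (d_tsupport S i h')]; simp
    have B0 : Tendsto (fun m => ∫ x, 1 / (4 * l) * (φ x * be2 δ (cv f (ρ m) x - cv h (ρ m) x) *
        ∑ i, (cF S i (ρ m) f x - cF S i (ρ m) h x) ^ 2)) atTop (𝓝 0) := by
      obtain ⟨B, hB0, hB⟩ := bdd_of_hcs hφ.continuous hφc
      have lim : Tendsto (fun m => 1 / (4 * l) * (B * ∑ i, ∫ x in K, be2 δ (cv f (ρ m) x - cv h (ρ m) x) *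
          (cF S i (ρ m) f x - cF S i (ρ m) h x) ^ 2)) atTop (𝓝 (1 / (4 * l) * (B * ∑ i : ι, 0))) := by
        refine ((tendsto_finsetSum _ fun i _ => ?_).const_mul _).const_mul _
        exact err_tendsto S hδ hfi hfc hhi hhc hsg hhM hC hε (fun m => (hεr m).trans (min_le_right _ _))
          hε0 hρ hKc i
      simp only [Finset.sum_const_zero, mul_zero] at lim
      have hcw : ∀ m, Continuous (fun x => be2 δ (cv f (ρ m) x - cv h (ρ m) x)) := fun m =>
        (be2_cont hδ).comp ((cv_cont hfi (hρ m).smooth.continuous ((hρ m).hcs S)).sub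
          (cv_cont hhi (hρ m).smooth.continuous ((hρ m).hcs S)))
      have hcF : ∀ m i, Continuous (fun x => (cF S i (ρ m) f x - cF S i (ρ m) h x) ^ 2) := fun m i =>
        ((cF_cont S (hρ m) hfi hfc i).sub (cF_cont S (hρ m) hhi hhc i)).pow 2
      refine squeeze_zero (fun m => integral_nonneg fun x => ?_) (fun m => ?_) lim
      · have := hφ0 x
        have := be2_nonneg hδ (cv f (ρ m) x - cv h (ρ m) x)
        positivity
      have k1 : ∀ i, IntegrableOn (fun x => be2 δ (cv f (ρ m) x - cv h (ρ m) x) *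
          (cF S i (ρ m) f x - cF S i (ρ m) h x) ^ 2) K := fun i =>
        ((hcw m).mul (hcF m i)).continuousOn.integrableOn_compact hKc
      rw [← integral_finsetSum _ (fun i _ => k1 i), ← integral_const_mul, ← integral_const_mul]
      rw [← setIntegral_eq_integral_of_forall_compl_eq_zero (s := K)]
      · refine setIntegral_mono_on ?_ (((integrable_finsetSum _ fun i _ => k1 i).const_mul _).const_mul _)
          hKc.measurableSet fun x _ => ?_
        · exact (continuous_const.mul ((hφ.continuous.mul (hcw m)).mul
            (continuous_finsetSum _ fun i _ => hcF m i))).continuousOn.integrableOn_compact hKc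
        · rw [mul_assoc, Finset.mul_sum]
          have : 0 ≤ ∑ i, be2 δ (cv f (ρ m) x - cv h (ρ m) x) *
            (cF S i (ρ m) f x - cF S i (ρ m) h x) ^ 2 := Finset.sum_nonneg fun i _ =>
              mul_nonneg (be2_nonneg hδ _) (sq_nonneg _)
          gcongr
          exact (le_abs_self _).trans (hB x)
      · intro x hx
        rw [image_eq_zero_of_notMem_tsupport hx]; simp
    have I0 : Tendsto (fun m => ∫ x, (cv h (ρ m) x + be δ (cv f (ρ m) x - cv h (ρ m) x)) * S.L φ x)
        atTop (𝓝 (∫ x, (h x + be δ (f x - h x)) * S.L φ x)) := by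
      have lim := (((cv_tendsto' S hfi hε hε0 hρ).add
        ((cv_tendsto' S hhi hε hε0 hρ).const_mul 2))).const_mul BL
      simp only [add_zero, mul_zero] at lim
      have hbc : Continuous (be δ) := (be_contDiff hδ).continuous
      rw [tendsto_iff_dist_tendsto_zero]
      refine squeeze_zero (fun m => dist_nonneg) (fun m => ?_) lim
      have cf := cv_cont hfi (hρ m).smooth.continuous ((hρ m).hcs S)
      have ch := cv_cont hhi (hρ m).smooth.continuous ((hρ m).hcs S)
      have k1 : Integrable (fun x => (cv h (ρ m) x + be δ (cv f (ρ m) x - cv h (ρ m) x)) * S.L φ x) :=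
        int_hcs ((ch.add (hbc.comp (cf.sub ch))).mul hLc) hLs.mul_left
      have di : ∀ {g : V → ℝ}, Integrable g → Integrable (fun x => |cv g (ρ m) x - g x|) := fun {g} hg => by
        have : Integrable (cv g (ρ m)) := by
          rw [cv_eq]; exact hg.integrable_convolution _ (int_hcs (hρ m).smooth.continuous ((hρ m).hcs S))
        exact (this.sub hg).abs
      have pw : ∀ x, |(cv h (ρ m) x + be δ (cv f (ρ m) x - cv h (ρ m) x)) - (h x + be δ (f x - h x))| ≤
          |cv f (ρ m) x - f x| + 2 * |cv h (ρ m) x - h x| := fun x => by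
        have h1 := be_lip hδ (cv f (ρ m) x - cv h (ρ m) x) (f x - h x)
        have h2 := abs_sub (cv f (ρ m) x - f x) (cv h (ρ m) x - h x)
        rw [show cv f (ρ m) x - cv h (ρ m) x - (f x - h x) = cv f (ρ m) x - f x - (cv h (ρ m) x - h x) by ring] at h1
        calc _ = |(cv h (ρ m) x - h x) + (be δ (cv f (ρ m) x - cv h (ρ m) x) - be δ (f x - h x))| := by
              congr 1; ring
          _ ≤ _ := abs_add_le _ _
          _ ≤ _ := by linarith [abs_sub (cv f (ρ m) x - f x) (cv h (ρ m) x - h x)]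
      have kd : Integrable (fun x => BL * (|cv f (ρ m) x - f x| + 2 * |cv h (ρ m) x - h x|)) :=
        ((di hfi).add ((di hhi).const_mul 2)).const_mul BL
      have k3 : Integrable (fun x => ((cv h (ρ m) x + be δ (cv f (ρ m) x - cv h (ρ m) x)) -
          (h x + be δ (f x - h x))) * S.L φ x) := by
        refine kd.mono ?_ (Eventually.of_forall fun x => ?_)
        · exact (((ch.add (hbc.comp (cf.sub ch))).aestronglyMeasurable.sub
            (hhi.aestronglyMeasurable.add (hbc.comp_aestronglyMeasurable
              (hfi.aestronglyMeasurable.sub hhi.aestronglyMeasurable)))).mul hLc.aestronglyMeasurable)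
        · rw [Real.norm_eq_abs, abs_mul, mul_comm]
          refine le_trans ?_ (le_abs_self _)
          exact mul_le_mul (hBL x) (pw x) (abs_nonneg _) hBL0
      have k2 : Integrable (fun x => (h x + be δ (f x - h x)) * S.L φ x) := by
        refine (k1.sub k3).congr (Eventually.of_forall fun x => ?_)
        simp only [Pi.sub_apply]; ring
      rw [Real.dist_eq, ← integral_sub k1 k2]
      calc _ ≤ ∫ x, |(cv h (ρ m) x + be δ (cv f (ρ m) x - cv h (ρ m) x)) * S.L φ x -
            (h x + be δ (f x - h x)) * S.L φ x| := abs_integral_le_integral_abs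
        _ ≤ ∫ x, BL * (|cv f (ρ m) x - f x| + 2 * |cv h (ρ m) x - h x|) := by
            refine integral_mono (k1.sub k2).abs kd fun x => ?_
            simp only
            rw [← sub_mul, abs_mul, mul_comm]
            exact mul_le_mul (hBL x) (pw x) (abs_nonneg _) hBL0
        _ = _ := by rw [integral_const_mul, integral_add (di hfi) ((di hhi).const_mul 2), integral_const_mul]
    have := le_of_tendsto_of_tendsto ((A0.neg).sub B0) I0 (Eventually.of_forall ineq)
    simpa using this
  have e : ∫ z, max (u z) (v z) * S.L φ z = ∫ z, max (f z) (h z) * S.L φ z := by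
    congr 1; ext z
    by_cases hz : z ∈ K
    · rw [hf, hh, Set.indicator_of_mem (hKK' hz), Set.indicator_of_mem (hKK' hz)]
    · rw [outK z hz]; simp
  rw [e]
  have hLi : Integrable (S.L φ) := int_hcs hLc hLs
  have fin : ∀ δ > 0, - (δ * ∫ x, |S.L φ x|) ≤ ∫ z, max (f z) (h z) * S.L φ z := by
    intro δ hδ
    have hbc : Continuous (be δ) := (be_contDiff hδ).continuous
    have k1 : Integrable (fun z => max (f z) (h z) * S.L φ z) :=
      (hfi.sup hhi).mul_bdd (c := BL) hLc.aestronglyMeasurable (Eventually.of_forall hBL)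
    have pw : ∀ x, |(h x + be δ (f x - h x)) - max (f x) (h x)| ≤ δ := fun x => by
      have := be_max hδ (f x - h x)
      have e2 : max (f x) (h x) = h x + max (f x - h x) 0 := by
        rw [← max_add_add_left]; simp [max_comm]
      rw [e2]; convert this using 2; ring
    have k3 : Integrable (fun x => ((h x + be δ (f x - h x)) - max (f x) (h x)) * S.L φ x) :=
      hLi.bdd_mul (c := δ) ((hhi.aestronglyMeasurable.add (hbc.comp_aestronglyMeasurable
              (hfi.aestronglyMeasurable.sub hhi.aestronglyMeasurable))).sub
              (hfi.sup hhi).aestronglyMeasurable) (Eventually.of_forall pw)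
    have h1 : ∫ x, ((h x + be δ (f x - h x)) - max (f x) (h x)) * S.L φ x ≤ δ * ∫ x, |S.L φ x| := by
      rw [← integral_const_mul]
      refine integral_mono k3 (hLi.abs.const_mul δ) fun x => ?_
      refine (le_abs_self _).trans ?_
      simp only
      rw [abs_mul]; exact mul_le_mul_of_nonneg_right (pw x) (abs_nonneg _)
    have h2 : ∫ x, (h x + be δ (f x - h x)) * S.L φ x =
      (∫ x, ((h x + be δ (f x - h x)) - max (f x) (h x)) * S.L φ x) + ∫ z, max (f z) (h z) * S.L φ z := by
      rw [← integral_add k3 k1]; congr 1; ext x; ring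
    have h3 := step δ hδ
    linarith
  have lim : Tendsto (fun δ : ℝ => - (δ * ∫ x, |S.L φ x|)) (𝓝[>] 0) (𝓝 (- (0 * ∫ x, |S.L φ x|))) :=
    (Continuous.tendsto (by fun_prop) 0).mono_left nhdsWithin_le_nhds
  have := le_of_tendsto lim (by filter_upwards [self_mem_nhdsWithin] with δ hδ using fin δ hδ)
  simpa using this

theorem WSub.int_mul {D : Set V} {u : V → ℝ} (hu : LocallyIntegrableOn u D) {g : V → ℝ}
    (hg : Continuous g) (hgc : HasCompactSupport g) (hgD : tsupport g ⊆ D) :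
    Integrable (fun x => u x * g x) := by
  have h1 : Integrable ((tsupport g).indicator u) :=
    (integrable_indicator_iff (isClosed_tsupport g).measurableSet).mpr
      (hu.integrableOn_compact_subset hgD hgc)
  obtain ⟨B, -, hB⟩ := bdd_of_hcs hg hgc
  refine (h1.mul_bdd (c := B) hg.aestronglyMeasurable (Eventually.of_forall hB)).congr
    (Eventually.of_forall fun x => ?_)
  simp only
  by_cases hx : x ∈ tsupport g
  · rw [Set.indicator_of_mem hx]
  · simp [image_eq_zero_of_notMem_tsupport hx]

theorem WSub.int_mul_L {D : Set V} {u : V → ℝ} (hu : LocallyIntegrableOn u D) {φ : V → ℝ}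
    (hφ : ContDiff ℝ (⊤ : ℕ∞) φ) (hφc : HasCompactSupport φ) (hφD : tsupport φ ⊆ D) :
    Integrable (fun x => u x * S.L φ x) :=
  WSub.int_mul hu (L_cont S (hφ.of_le (by norm_cast))) (L_hcs S hφc) ((L_tsupport S).trans hφD)

theorem WSub.const (D : Set V) (c : ℝ) : WSub S D (fun _ => c) := by
  refine ⟨(locallyIntegrable_const c).locallyIntegrableOn D, fun φ hφ hφc hφD hφ0 => ?_⟩
  rw [integral_const_mul, int_L_zero S (hφ.of_le (by norm_cast)) hφc, mul_zero]

theorem WSub.add {D : Set V} {u v : V → ℝ} (hu : WSub S D u) (hv : WSub S D v) :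
    WSub S D (fun x => u x + v x) := by
  refine ⟨hu.1.add hv.1, fun φ hφ hφc hφD hφ0 => ?_⟩
  have h1 := hu.2 φ hφ hφc hφD hφ0
  have h2 := hv.2 φ hφ hφc hφD hφ0
  simp only [add_mul]
  rw [integral_add (WSub.int_mul_L S hu.1 hφ hφc hφD) (WSub.int_mul_L S hv.1 hφ hφc hφD)]
  linarith

theorem WSub.congr {D : Set V} (hD : IsOpen D) {u v : V → ℝ} (hu : WSub S D u)
    (h : ∀ᵐ x, x ∈ D → u x = v x) : WSub S D v := by
  refine ⟨?_, fun φ hφ hφc hφD hφ0 => ?_⟩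
  · intro x hx
    obtain ⟨s, hs, hi⟩ := hu.1 x hx
    refine ⟨s ∩ D, inter_mem hs self_mem_nhdsWithin, ?_⟩
    refine (hi.mono_set Set.inter_subset_left).congr ?_
    have h2 : ∀ᵐ x ∂(volume.restrict D), u x = v x := (ae_restrict_iff' hD.measurableSet).mpr h
    exact ae_mono (Measure.restrict_mono Set.inter_subset_right le_rfl) h2
  · have h1 := hu.2 φ hφ hφc hφD hφ0
    refine h1.trans (le_of_eq (integral_congr_ae ?_))
    filter_upwards [h] with x hx
    by_cases hxD : x ∈ D
    · rw [hx hxD]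
    · have : S.L φ x = 0 := image_eq_zero_of_notMem_tsupport fun h' => hxD (hφD (L_tsupport S h'))
      simp [this]

theorem WSub.mono_set {D D' : Set V} (h : D' ⊆ D) {u : V → ℝ} (hu : WSub S D u) : WSub S D' u :=
  ⟨hu.1.mono_set h, fun φ hφ hφc hφD hφ0 => hu.2 φ hφ hφc (hφD.trans h) hφ0⟩

/-- Kato: the maximum of a one-sidedly bounded and a bounded subsolution is a subsolution. -/
theorem kato {D : Set V} (hD : IsOpen D) {u v : V → ℝ} (hu : WSub S D u) (hv : WSub S D v) {c : ℝ}
    (sg : (∀ x ∈ D, c ≤ u x) ∨ (∀ x ∈ D, u x ≤ c)) {M : ℝ} (hM : ∀ x ∈ D, |v x| ≤ M) :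
    WSub S D (fun x => max (u x) (v x)) := by
  have h1 := kato_sgn S hD (hu.add S (WSub.const S D (-c))) (hv.add S (WSub.const S D (-c)))
    (M := |M| + |c|) ?_ ?_ (by positivity)
  · refine (h1.add S (WSub.const S D c)).congr S hD (Eventually.of_forall fun x _ => ?_)
    rw [max_add_add_right]; ring
  · rcases sg with sg | sg
    · left; intro x hx; have := sg x hx; linarith
    · right; intro x hx; have := sg x hx; linarith
  · intro x hx
    refine (abs_add_le _ _).trans ?_
    rw [abs_neg]
    have := (hM x hx).trans (le_abs_self M)
    linarith

end kato3

end APerron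

end

open MeasureTheory Filter Topology Complex Metric

set_option linter.unusedSectionVars false
set_option linter.unusedSimpArgs false
set_option linter.unusedVariables false

noncomputable section

namespace APerron

open Module

section profile

theorem st_deriv_nonneg (t : ℝ) : 0 ≤ deriv Real.smoothTransition t :=
  Real.smoothTransition.monotone.deriv_nonneg

theorem st_deriv_zero {t : ℝ} (h : t ≤ 0 ∨ 1 ≤ t) : deriv Real.smoothTransition t = 0 := by
  rcases h with h | h
  · apply IsLocalMin.deriv_eq_zero
    refine Eventually.of_forall fun x => ?_
    rw [Real.smoothTransition.zero_of_nonpos h]; exact Real.smoothTransition.nonneg x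
  · apply IsLocalMax.deriv_eq_zero
    refine Eventually.of_forall fun x => ?_
    rw [Real.smoothTransition.one_of_one_le h]; exact Real.smoothTransition.le_one x

theorem st_deriv_cont : Continuous (deriv Real.smoothTransition) :=
  (Real.smoothTransition.contDiff (n := 1)).continuous_deriv (by norm_num)

theorem st_deriv_bound : ∃ M : ℝ, 0 < M ∧ ∀ t, deriv Real.smoothTransition t ≤ M := by
  obtain ⟨B, hB⟩ := (isCompact_Icc (a := (0:ℝ)) (b := 1)).exists_bound_of_continuousOn
    st_deriv_cont.continuousOn
  refine ⟨|B| + 1, by positivity, fun t => ?_⟩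
  by_cases ht : t ∈ Set.Icc (0:ℝ) 1
  · have := (le_abs_self _).trans (hB t ht)
    linarith [le_abs_self B]
  · rw [st_deriv_zero]
    · positivity
    · by_contra hc; push Not at hc; exact ht ⟨hc.1.le, hc.2.le⟩

def pe (c R τ : ℝ) : ℝ := Real.exp (-c * √τ) * (deriv Real.smoothTransition (2 - τ / R ^ 2) / R ^ 2)
def pf (n : ℕ) (c R τ : ℝ) : ℝ := Real.exp (-c * √τ) * Real.smoothTransition (2 - τ / R ^ 2) / τ ^ n
def pd (n : ℕ) (c R τ : ℝ) : ℝ := -(pf n c R τ * (n + c * √τ / 2) + pe c R τ * τ / τ ^ n) / τ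
def pg (n : ℕ) (c R p : ℝ) : ℝ := ∫ τ in p..(2 * R ^ 2), pf n c R τ

variable {n : ℕ} {c R τ : ℝ}

theorem pe_nonneg : 0 ≤ pe c R τ := by
  have := st_deriv_nonneg (2 - τ / R ^ 2)
  unfold pe; positivity

theorem pe_zero_ge (hR : 0 < R) (h : 2 * R ^ 2 ≤ τ) : pe c R τ = 0 := by
  have : 2 ≤ τ / R ^ 2 := by rw [le_div_iff₀ (by positivity)]; exact h
  unfold pe
  rw [st_deriv_zero (Or.inl (by linarith))]; simp

theorem pe_zero_le (hR : 0 < R) (h : τ ≤ R ^ 2) : pe c R τ = 0 := by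
  have : τ / R ^ 2 ≤ 1 := by rw [div_le_one (by positivity)]; exact h
  unfold pe
  rw [st_deriv_zero (Or.inr (by linarith))]; simp

theorem pf_nonneg (hτ : 0 < τ) : 0 ≤ pf n c R τ := by
  have := Real.smoothTransition.nonneg (2 - τ / R ^ 2)
  unfold pf; positivity

theorem exp_le (hc : 0 ≤ c) : Real.exp (-c * √τ) ≤ 1 := by
  rw [Real.exp_le_one_iff]
  have : 0 ≤ c * √τ := by positivity
  linarith

theorem pf_le (hc : 0 ≤ c) (hτ : 0 < τ) : pf n c R τ ≤ 1 / τ ^ n := by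
  unfold pf
  gcongr
  exact mul_le_one₀ (exp_le hc) (Real.smoothTransition.nonneg _) (Real.smoothTransition.le_one _)

theorem pf_zero (hR : 0 < R) (h : 2 * R ^ 2 ≤ τ) : pf n c R τ = 0 := by
  have : 2 ≤ τ / R ^ 2 := by rw [le_div_iff₀ (by positivity)]; exact h
  unfold pf
  rw [Real.smoothTransition.zero_of_nonpos (by linarith)]; simp

theorem pf_ge (hc : 0 ≤ c) (hR : 0 < R) (hR1 : R ≤ 1) (hτ : 0 < τ) (h : τ ≤ R ^ 2) :
    Real.exp (-c) / τ ^ n ≤ pf n c R τ := by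
  have h1 : τ / R ^ 2 ≤ 1 := by rw [div_le_one (by positivity)]; exact h
  unfold pf
  rw [Real.smoothTransition.one_of_one_le (by linarith), mul_one]
  gcongr
  have : √τ ≤ 1 := by rw [Real.sqrt_le_one]; nlinarith
  nlinarith

theorem pd_zero (hR : 0 < R) (h : 2 * R ^ 2 ≤ τ) : pd n c R τ = 0 := by
  unfold pd; rw [pf_zero hR h, pe_zero_ge hR h]; simp

theorem pd_nonpos (hc : 0 ≤ c) (hτ : 0 < τ) : pd n c R τ ≤ 0 := by
  have h1 := pf_nonneg (n := n) (c := c) (R := R) hτ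
  have h2 := pe_nonneg (c := c) (R := R) (τ := τ)
  unfold pd
  rw [neg_div]
  have : 0 ≤ (pf n c R τ * (n + c * √τ / 2) + pe c R τ * τ / τ ^ n) / τ := by positivity
  linarith

theorem pd_mul (hτ : 0 < τ) : -(pd n c R τ) * τ = pf n c R τ * (n + c * √τ / 2) + pe c R τ * τ / τ ^ n := by
  unfold pd; field_simp

theorem pf_hasDeriv (hR : 0 < R) (hτ : 0 < τ) : HasDerivAt (pf n c R) (pd n c R τ) τ := by
  have h1 : HasDerivAt (fun τ => Real.exp (-c * √τ)) (Real.exp (-c * √τ) * (-c * (1 / (2 * √τ)))) τ :=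
    ((Real.hasDerivAt_sqrt hτ.ne').const_mul (-c)).exp
  have h2 : HasDerivAt (fun τ => Real.smoothTransition (2 - τ / R ^ 2))
      (deriv Real.smoothTransition (2 - τ / R ^ 2) * (-(1 / R ^ 2))) τ := by
    have h3 : HasDerivAt (fun τ : ℝ => 2 - τ / R ^ 2) (-(1 / R ^ 2)) τ :=
      ((hasDerivAt_id τ).div_const (R ^ 2)).const_sub 2
    have h4 : HasDerivAt Real.smoothTransition (deriv Real.smoothTransition (2 - τ / R ^ 2)) (2 - τ / R ^ 2) :=
      ((Real.smoothTransition.contDiff (n := 1)).differentiable (by norm_num) _).hasDerivAt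
    exact h4.comp τ h3
  have h5 := (h1.mul h2).div (hasDerivAt_pow n τ) (by positivity)
  have hs : 0 < √τ := Real.sqrt_pos.mpr hτ
  have hss : √τ ^ 2 = τ := Real.sq_sqrt hτ.le
  have hn : (n:ℝ) * τ ^ (n - 1) * τ = n * τ ^ n := by
    rcases n with _ | n
    · simp
    · simp [pow_succ]; ring
  refine h5.congr_deriv ?_
  unfold pd pf pe
  simp only [Pi.mul_apply]
  have hn' : (n:ℝ) * τ ^ (n - 1) = n * τ ^ n / τ := by field_simp; linarith
  rw [hn']
  set s := √τ
  rw [← hss]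
  field_simp
  ring

theorem pf_contDiffOn : ContDiffOn ℝ (⊤ : ℕ∞) (pf n c R) (Set.Ioi 0) := by
  unfold pf
  refine ContDiffOn.div (ContDiffOn.mul ?_ ?_) (by fun_prop) fun x hx => (pow_pos hx n).ne'
  · refine ContDiffOn.exp (contDiffOn_const.mul ?_)
    exact ContDiffOn.sqrt contDiffOn_id fun x hx => (ne_of_gt hx)
  · exact (Real.smoothTransition.contDiff (n := ⊤)).comp_contDiffOn (by fun_prop)

theorem pf_contOn : ContinuousOn (pf n c R) (Set.Ioi 0) := pf_contDiffOn.continuousOn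

theorem pd_contOn : ContinuousOn (pd n c R) (Set.Ioi 0) := by
  have h1 : ContinuousOn (pe c R) (Set.Ioi 0) := by
    unfold pe
    have := st_deriv_cont
    fun_prop
  unfold pd
  refine ContinuousOn.div (ContinuousOn.neg (ContinuousOn.add (pf_contOn.mul (by fun_prop)) ?_)) (by fun_prop)
    fun x hx => ne_of_gt hx
  exact (h1.mul (by fun_prop)).div (by fun_prop) fun x hx => (pow_pos hx n).ne'

theorem pf_ii {p q : ℝ} (hp : 0 < p) (hq : 0 < q) : IntervalIntegrable (pf n c R) volume p q :=
  (pf_contOn.mono fun x hx => lt_of_lt_of_le (lt_min hp hq) hx.1).intervalIntegrable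

theorem pg_hasDeriv (hR : 0 < R) {p : ℝ} (hp : 0 < p) : HasDerivAt (pg n c R) (-pf n c R p) p :=
  intervalIntegral.integral_hasDerivAt_left (pf_ii hp (by positivity))
    (pf_contOn.stronglyMeasurableAtFilter isOpen_Ioi p hp) (pf_contOn.continuousAt (Ioi_mem_nhds hp))

theorem pg_contDiffOn (hR : 0 < R) : ContDiffOn ℝ (⊤ : ℕ∞) (pg n c R) (Set.Ioi 0) := by
  rw [contDiffOn_infty_iff_deriv_of_isOpen isOpen_Ioi]
  refine ⟨fun p hp => (pg_hasDeriv hR hp).differentiableAt.differentiableWithinAt, ?_⟩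
  exact pf_contDiffOn.neg.congr fun p hp => (pg_hasDeriv hR hp).deriv

theorem pg_zero (hR : 0 < R) {p : ℝ} (hp : 2 * R ^ 2 ≤ p) : pg n c R p = 0 := by
  unfold pg
  rw [intervalIntegral.integral_congr (g := fun _ => 0)]
  · simp
  · intro x hx
    rw [Set.uIcc_of_ge hp] at hx
    exact pf_zero hR hx.1

theorem pg_nonneg (hR : 0 < R) {p : ℝ} (hp : 0 < p) : 0 ≤ pg n c R p := by
  rcases le_total (2 * R ^ 2) p with h | h
  · rw [pg_zero hR h]
  · exact intervalIntegral.integral_nonneg h fun x hx => pf_nonneg (hp.trans_le hx.1)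

theorem pg_anti (hR : 0 < R) : AntitoneOn (pg n c R) (Set.Ioi 0) := by
  refine antitoneOn_of_deriv_nonpos (convex_Ioi 0) (pg_contDiffOn hR).continuousOn ?_ ?_
  · rw [interior_Ioi]
    exact fun p hp => (pg_hasDeriv hR hp).differentiableAt.differentiableWithinAt
  · rw [interior_Ioi]
    intro p hp
    rw [(pg_hasDeriv hR hp).deriv]
    linarith [pf_nonneg (n := n) (c := c) (R := R) hp]

theorem pg_pos (hc : 0 ≤ c) (hR : 0 < R) (hR1 : R ≤ 1) : 0 < pg n c R (R ^ 2 / 2) := by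
  have h0 : 0 < R ^ 2 / 2 := by positivity
  refine intervalIntegral.intervalIntegral_pos_of_pos_on (pf_ii h0 (by positivity)) ?_ (by nlinarith)
  intro x hx
  have hx0 : 0 < x := h0.trans hx.1
  unfold pf
  have : 0 < 2 - x / R ^ 2 := by
    have : x / R ^ 2 < 2 := by rw [div_lt_iff₀ (by positivity)]; exact hx.2
    linarith
  have := Real.smoothTransition.pos_of_pos this
  positivity

theorem pg_le (hn : 1 ≤ n) (hc : 0 ≤ c) (hR : 0 < R) (hR1 : R ≤ 1) {p : ℝ} (hp : 0 < p) :
    pg n c R p ≤ 4 * (√p / p ^ n) := by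
  rcases le_total (2 * R ^ 2) p with h | h
  · rw [pg_zero hR h]; positivity
  have hd : ∀ t > 0, HasDerivAt (fun t => pg n c R t - 4 * (√t / t ^ n))
      (-pf n c R t - 4 * ((1 / 2 - n) / (√t * t ^ n))) t := fun t ht => by
    have h1 := ((Real.hasDerivAt_sqrt ht.ne').div (hasDerivAt_pow n t) (by positivity)).const_mul 4
    refine ((pg_hasDeriv hR ht).sub h1).congr_deriv ?_
    have hs : 0 < √t := Real.sqrt_pos.mpr ht
    have hss : √t ^ 2 = t := Real.sq_sqrt ht.le
    have hn' : (n:ℝ) * t ^ (n - 1) = n * t ^ n / t := by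
      obtain ⟨k, rfl⟩ : ∃ k, n = k + 1 := ⟨n - 1, by omega⟩
      simp [pow_succ]; field_simp
    rw [hn']
    set s := √t
    congr 2
    rw [← hss]
    field_simp
  have hm : MonotoneOn (fun t => pg n c R t - 4 * (√t / t ^ n)) (Set.Icc p (2 * R ^ 2)) := by
    refine monotoneOn_of_deriv_nonneg (convex_Icc _ _) ?_ ?_ ?_
    · exact fun t ht => (hd t (hp.trans_le ht.1)).continuousAt.continuousWithinAt
    · rw [interior_Icc]
      exact fun t ht => (hd t (hp.trans ht.1)).differentiableAt.differentiableWithinAt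
    · rw [interior_Icc]
      intro t ht
      have ht0 : 0 < t := hp.trans ht.1
      rw [(hd t ht0).deriv]
      have h1 := pf_le (n := n) (R := R) hc ht0
      have hs : 0 < √t := Real.sqrt_pos.mpr ht0
      have hs2 : √t ≤ 2 := by
        rw [Real.sqrt_le_left (by norm_num)]; nlinarith [ht.2]
      have hn1 : (1:ℝ) ≤ n := by exact_mod_cast hn
      have h2 : 1 / t ^ n ≤ 4 * ((n - 1 / 2) / (√t * t ^ n)) := by
        rw [mul_div_assoc', div_le_div_iff₀ (by positivity) (by positivity)]
        have : √t ≤ 4 * ((n:ℝ) - 1 / 2) := by linarith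
        nlinarith [pow_pos ht0 n]
      have h3 : (1 / 2 - (n:ℝ)) / (√t * t ^ n) = - ((n - 1 / 2) / (√t * t ^ n)) := by ring
      rw [h3]; linarith
  have := hm ⟨le_rfl, h⟩ ⟨h, le_rfl⟩ h
  simp only [pg_zero hR le_rfl] at this
  have h5 : 0 ≤ 4 * (√(2 * R ^ 2) / (2 * R ^ 2) ^ n) := by positivity
  linarith

/-- the regular part of the kernel -/
def pE (n : ℕ) (c R s p A B : ℝ) : ℝ := -(pd n c R p) * (A + 4 * s) - pf n c R p * B

theorem pE_zero {s p A B : ℝ} (hR : 0 < R) (hp : 2 * R ^ 2 ≤ p) : pE n c R s p A B = 0 := by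
  unfold pE; rw [pd_zero hR hp, pf_zero hR hp]; simp

theorem pE_nonneg {s p q A B K : ℝ} (hn : 1 ≤ n) (hR : 0 < R) (hK : 0 ≤ K) (hKR : 4 * K * R ≤ 1)
    (hc : 8 * n * K ≤ c) (hp : 0 < p) (hs : 0 ≤ s) (hq : 0 ≤ q) (hpq : p = q + s)
    (hA : p < 2 * R ^ 2 → |A - 4 * q| ≤ 4 * K * √p * q)
    (hB : p < 2 * R ^ 2 → |B - 4 * n| ≤ 4 * n * K * √p) : 0 ≤ pE n c R s p A B := by
  rcases le_or_gt (2 * R ^ 2) p with h | h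
  · rw [pE_zero hR h]
  have hc0 : 0 ≤ c := le_trans (by positivity) hc
  have hA := (abs_le.mp (hA h)).1
  have hB := (abs_le.mp (hB h)).2
  have hf := pf_nonneg (n := n) (c := c) (R := R) hp
  have hd : 0 ≤ -(pd n c R p) := by linarith [pd_nonpos (n := n) (R := R) hc0 hp]
  have hm := pd_mul (n := n) (c := c) (R := R) hp
  have he : 0 ≤ pe c R p * p / p ^ n := by
    have := pe_nonneg (c := c) (R := R) (τ := p)
    positivity
  unfold pE
  set ρ := √p with hρ
  have hρ0 : 0 ≤ ρ := Real.sqrt_nonneg _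
  have hρR : ρ ≤ 2 * R := by
    rw [hρ, Real.sqrt_le_left (by positivity)]; nlinarith
  have hKρ : K * ρ ≤ 1 / 2 := by nlinarith
  have h1 : 4 * (1 - K * ρ) * p ≤ A + 4 * s := by
    have : 0 ≤ K * ρ * s := by positivity
    rw [hpq]; nlinarith
  have h2 : B ≤ 4 * n * (1 + K * ρ) := by linarith
  set d := -(pd n c R p)
  set f := pf n c R p
  have h3 : d * (4 * (1 - K * ρ) * p) ≤ d * (A + 4 * s) := by gcongr
  have h4 : f * B ≤ f * (4 * n * (1 + K * ρ)) := by gcongr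
  have h5 : d * (4 * (1 - K * ρ) * p) = 4 * (1 - K * ρ) * (d * p) := by ring
  have h6 : 4 * (1 - K * ρ) * (f * (n + c * ρ / 2)) ≤ 4 * (1 - K * ρ) * (d * p) := by
    have h0 : 0 ≤ 4 * (1 - K * ρ) := by linarith
    exact mul_le_mul_of_nonneg_left (by linarith) h0
  have h7 : 0 ≤ 4 * f * ρ * (c / 2 * (1 - K * ρ) - 2 * n * K) := by
    have : 0 ≤ c / 2 * (1 - K * ρ) - 2 * n * K := by nlinarith
    positivity
  have h8 : 4 * (1 - K * ρ) * (f * (n + c * ρ / 2)) - f * (4 * n * (1 + K * ρ)) =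
      4 * f * ρ * (c / 2 * (1 - K * ρ) - 2 * n * K) := by ring
  linarith

theorem pE_le {K : ℝ} (hn : 1 ≤ n) (hK : 0 ≤ K) (hc : 0 ≤ c) : ∃ C : ℝ, 0 < C ∧ ∀ {R s p q A B : ℝ},
    0 < R → R ≤ 1 → 4 * K * R ≤ 1 → 0 < p → 0 ≤ s → 0 ≤ q → p = q + s →
    (p < 2 * R ^ 2 → |A - 4 * q| ≤ 4 * K * √p * q) →
    (p < 2 * R ^ 2 → |B - 4 * n| ≤ 4 * n * K * √p) →
    pE n c R s p A B ≤ C * (√p / p ^ n + (R⁻¹) ^ (2 * n)) := by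
  obtain ⟨M, hM, hMb⟩ := st_deriv_bound
  refine ⟨4 * (2 * n * K + c) + 12 * M + 1, by positivity, ?_⟩
  intro R s p q A B hR hR1 hKR hp hs hq hpq hA hB
  rcases le_or_gt (2 * R ^ 2) p with h | h
  · rw [pE_zero hR h]; positivity
  have hA := (abs_le.mp (hA h)).2
  have hB := (abs_le.mp (hB h)).1
  have hf := pf_nonneg (n := n) (c := c) (R := R) hp
  have hf2 := pf_le (n := n) (R := R) hc hp
  have hd : 0 ≤ -(pd n c R p) := by linarith [pd_nonpos (n := n) (R := R) hc hp]
  have hm := pd_mul (n := n) (c := c) (R := R) hp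
  have he0 : 0 ≤ pe c R p * p / p ^ n := by
    have := pe_nonneg (c := c) (R := R) (τ := p)
    positivity
  have he : pe c R p * p / p ^ n ≤ 2 * M * (R⁻¹) ^ (2 * n) := by
    rcases le_total p (R ^ 2) with h' | h'
    · rw [pe_zero_le hR h']; simp; positivity
    · have h1 : pe c R p ≤ M / R ^ 2 := by
        unfold pe
        refine (mul_le_of_le_one_left ?_ (exp_le hc)).trans ?_
        · have := st_deriv_nonneg (2 - p / R ^ 2); positivity
        · gcongr; exact hMb _
      have h2 : R ^ (2 * n) ≤ p ^ n := by rw [pow_mul]; gcongr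
      calc pe c R p * p / p ^ n ≤ M / R ^ 2 * (2 * R ^ 2) / R ^ (2 * n) := by gcongr
        _ = _ := by rw [inv_pow]; field_simp
  unfold pE
  set ρ := √p with hρ
  have hρ0 : 0 ≤ ρ := Real.sqrt_nonneg _
  have hρR : ρ ≤ 2 * R := by
    rw [hρ, Real.sqrt_le_left (by positivity)]; nlinarith
  have hKρ : K * ρ ≤ 1 / 2 := by nlinarith
  have h1 : A + 4 * s ≤ 4 * (1 + K * ρ) * p := by
    have : 0 ≤ K * ρ * s := by positivity
    rw [hpq]; nlinarith
  have h2 : 4 * n * (1 - K * ρ) ≤ B := by linarith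
  set d := -(pd n c R p)
  set f := pf n c R p
  set e := pe c R p * p / p ^ n
  have h3 : d * (A + 4 * s) ≤ d * (4 * (1 + K * ρ) * p) := by gcongr
  have h4 : f * (4 * n * (1 - K * ρ)) ≤ f * B := by gcongr
  have h5 : d * (4 * (1 + K * ρ) * p) = 4 * (1 + K * ρ) * (f * (n + c * ρ / 2) + e) := by
    rw [← hm]; ring
  have h6 : 4 * (1 + K * ρ) * (f * (n + c * ρ / 2) + e) - f * (4 * n * (1 - K * ρ)) =
      f * ρ * (4 * (2 * n * K + c / 2 * (1 + K * ρ))) + 4 * (1 + K * ρ) * e := by ring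
  have h7 : f * ρ * (4 * (2 * n * K + c / 2 * (1 + K * ρ))) ≤
      (1 / p ^ n) * ρ * (4 * (2 * n * K + c)) := by
    gcongr
    nlinarith
  have h8 : 4 * (1 + K * ρ) * e ≤ 6 * (2 * M * (R⁻¹) ^ (2 * n)) := by
    have : 4 * (1 + K * ρ) ≤ 6 := by linarith
    gcongr
  have h9 : 0 ≤ ρ / p ^ n := by positivity
  have h10 : 0 ≤ (R⁻¹) ^ (2 * n) := by positivity
  have h11 : (1 / p ^ n) * ρ * (4 * (2 * n * K + c)) = (4 * (2 * n * K + c)) * (ρ / p ^ n) := by ring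
  have h12 : 0 ≤ 4 * (2 * n * K + c) := by positivity
  nlinarith [mul_nonneg hM.le h9, mul_nonneg h12 h10]

theorem pd_le (hn : 1 ≤ n) (hc : 0 ≤ c) : ∃ C : ℝ, 0 < C ∧ ∀ {R p : ℝ},
    0 < R → R ≤ 1 → 0 < p → -(pd n c R p) ≤ C / p ^ (n + 1) := by
  obtain ⟨M, hM, hMb⟩ := st_deriv_bound
  refine ⟨n + c + 2 * M, by positivity, ?_⟩
  intro R p hR hR1 hp
  rcases le_or_gt (2 * R ^ 2) p with h | h
  · rw [pd_zero hR h]; simp; positivity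
  have hf := pf_nonneg (n := n) (c := c) (R := R) hp
  have hf2 := pf_le (n := n) (R := R) hc hp
  have hm := pd_mul (n := n) (c := c) (R := R) hp
  have hρ2 : √p ≤ 2 := by rw [Real.sqrt_le_left (by norm_num)]; nlinarith
  have h1 : pe c R p * p ≤ 2 * M := by
    have h1 : pe c R p ≤ M / R ^ 2 := by
      unfold pe
      refine (mul_le_of_le_one_left ?_ (exp_le hc)).trans ?_
      · have := st_deriv_nonneg (2 - p / R ^ 2); positivity
      · gcongr; exact hMb _
    calc pe c R p * p ≤ M / R ^ 2 * (2 * R ^ 2) := by gcongr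
      _ = _ := by field_simp
  rw [pow_succ, ← div_div, le_div_iff₀ hp, hm]
  calc _ ≤ 1 / p ^ n * (n + c) + 2 * M / p ^ n := by
        gcongr
        nlinarith
    _ = _ := by ring

theorem pd_ge (hc : 0 ≤ c) (hR : 0 < R) (hR1 : R ≤ 1) {p : ℝ} (hp : 0 < p) (h : p ≤ R ^ 2) :
    n * Real.exp (-c) / p ^ (n + 1) ≤ -(pd n c R p) := by
  have hf := pf_ge (n := n) hc hR hR1 hp h
  have hf0 := pf_nonneg (n := n) (c := c) (R := R) hp
  have hm := pd_mul (n := n) (c := c) (R := R) hp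
  have he : 0 ≤ pe c R p * p / p ^ n := by
    have := pe_nonneg (c := c) (R := R) (τ := p)
    positivity
  rw [pow_succ, ← div_div, div_le_iff₀ hp, hm]
  have h1 : n * Real.exp (-c) / p ^ n = Real.exp (-c) / p ^ n * n := by ring
  rw [h1]
  have h2 : 0 ≤ pf n c R p * (c * √p / 2) := by positivity
  have h3 : Real.exp (-c) / p ^ n * n ≤ pf n c R p * n := by gcongr
  linarith

end profile

end APerron

end

open MeasureTheory Filter Topology Complex Metric

set_option linter.unusedSectionVars false
set_option linter.unusedSimpArgs false
set_option linter.unusedVariables false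

noncomputable section

namespace APerron

open Module

section quad

variable {V : Type*} [NormedAddCommGroup V] [NormedSpace ℝ V] [FiniteDimensional ℝ V]
  [MeasureSpace V] [BorelSpace V] [(volume : Measure V).IsAddHaarMeasure]
  {ι : Type*} [Fintype ι] (S : EF V ι)

/-- the coefficient matrix -/
def EF.mat (x : V) : Matrix ι ι ℝ := Matrix.of fun i j => S.a i j x

open Classical in
/-- the inverse matrix -/
def EF.bi (y : V) (i j : ι) : ℝ := (S.mat y).det⁻¹ * (S.mat y).adjugate i j

open Classical in
theorem mat_det (x : V) : (S.mat x).det ≠ 0 := by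
  intro h
  obtain ⟨v, hv, hv0⟩ := Matrix.exists_mulVec_eq_zero_iff.mpr h
  have h1 := S.pos x v hv
  have h2 : ∑ i, ∑ j, S.a i j x * v i * v j = ∑ i, v i * (S.mat x).mulVec v i := by
    refine Finset.sum_congr rfl fun i _ => ?_
    rw [Matrix.mulVec, dotProduct, Finset.mul_sum]
    refine Finset.sum_congr rfl fun j _ => ?_
    simp only [EF.mat, Matrix.of_apply]; ring
  rw [h2, hv0] at h1
  simp at h1

open Classical in
theorem bi_eq (y : V) : (Matrix.of fun i j => S.bi y i j) = (S.mat y)⁻¹ := by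
  ext i j
  rw [Matrix.inv_def, Ring.inverse_eq_inv']
  simp [EF.bi]

open Classical in
theorem ab_one (y : V) (i j : ι) : ∑ k, S.a i k y * S.bi y k j = if i = j then 1 else 0 := by
  have h := Matrix.mul_nonsing_inv (S.mat y) (isUnit_iff_ne_zero.mpr (mat_det S y))
  rw [← bi_eq] at h
  have := congrFun (congrFun h i) j
  rw [Matrix.mul_apply, Matrix.one_apply] at this
  simpa [EF.mat] using this

open Classical in
theorem bi_symm (y : V) (i j : ι) : S.bi y i j = S.bi y j i := by
  have h : (S.mat y).transpose = S.mat y := by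
    ext i j; simp [EF.mat, S.symm]
  have h2 := Matrix.transpose_nonsing_inv (S.mat y)
  rw [h, ← bi_eq] at h2
  exact (congrFun (congrFun h2 j) i)

open Classical in
theorem bi_cont (i j : ι) : Continuous fun y => S.bi y i j := by
  have hm : Continuous S.mat := by
    unfold EF.mat
    exact continuous_matrix fun i j => (S.smooth i j).continuous
  unfold EF.bi
  exact (hm.matrix_det.inv₀ fun y => mat_det S y).mul (hm.matrix_adjugate.matrix_elem i j)

/-- coordinates -/
def EF.co (i : ι) : V →L[ℝ] ℝ := LinearMap.toContinuousLinearMap (S.e.coord i)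

open Classical in
theorem co_e (i j : ι) : S.co i (S.e j) = if i = j then 1 else 0 := by
  simp [EF.co, Finsupp.single_apply, eq_comm]

theorem co_ne {z : V} (hz : z ≠ 0) : (fun i => S.co i z) ≠ 0 := by
  intro h
  apply hz
  apply S.e.repr.injective
  ext i
  simpa [EF.co] using congrFun h i

/-- `b z` -/
def EF.w (y : V) (i : ι) (z : V) : ℝ := ∑ j, S.bi y i j * S.co j z

/-- the quadratic form `⟨b z, z⟩`. -/
def EF.q (y z : V) : ℝ := ∑ i, ∑ j, S.bi y i j * S.co i z * S.co j z

theorem w_cont (i : ι) : Continuous fun p : V × V => S.w p.1 i p.2 := by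
  unfold EF.w
  refine continuous_finsetSum _ fun j _ => ?_
  exact ((bi_cont S i j).comp continuous_fst).mul ((S.co j).continuous.comp continuous_snd)

theorem q_cont : Continuous fun p : V × V => S.q p.1 p.2 := by
  unfold EF.q
  refine continuous_finsetSum _ fun i _ => continuous_finsetSum _ fun j _ => ?_
  exact (((bi_cont S i j).comp continuous_fst).mul ((S.co i).continuous.comp continuous_snd)).mul
    ((S.co j).continuous.comp continuous_snd)

theorem q_eq (y z : V) : S.q y z = ∑ i, S.w y i z * S.co i z := by
  unfold EF.q EF.w
  refine Finset.sum_congr rfl fun i _ => ?_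
  rw [Finset.sum_mul]
  exact Finset.sum_congr rfl fun j _ => by ring

theorem aw (y z : V) (i : ι) : ∑ j, S.a i j y * S.w y j z = S.co i z := by
  classical
  unfold EF.w
  simp_rw [Finset.mul_sum, ← mul_assoc]
  rw [Finset.sum_comm]
  simp_rw [← Finset.sum_mul, ab_one]
  simp

theorem aww (y z : V) : ∑ i, ∑ j, S.a i j y * S.w y i z * S.w y j z = S.q y z := by
  rw [q_eq]
  refine Finset.sum_congr rfl fun i _ => ?_
  rw [← aw S y z i, Finset.mul_sum]
  exact Finset.sum_congr rfl fun j _ => by ring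

theorem q_pos (y : V) {z : V} (hz : z ≠ 0) : 0 < S.q y z := by
  rw [← aww]
  refine S.pos y (fun i => S.w y i z) ?_
  intro h
  apply co_ne S hz
  funext i
  rw [← aw S y z i]
  simp [fun j => congrFun h j]

theorem q_zero (y : V) : S.q y 0 = 0 := by simp [EF.q]

theorem q_nonneg (y z : V) : 0 ≤ S.q y z := by
  rcases eq_or_ne z 0 with rfl | h
  · rw [q_zero]
  · exact (q_pos S y h).le

theorem q_smul (y z : V) (t : ℝ) : S.q y (t • z) = t ^ 2 * S.q y z := by
  unfold EF.q
  simp only [map_smul, smul_eq_mul, Finset.mul_sum]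
  exact Finset.sum_congr rfl fun i _ => Finset.sum_congr rfl fun j _ => by ring

theorem q_bounds (r : ℝ) : ∃ m M : ℝ, 0 < m ∧ 0 < M ∧ ∀ y ∈ closedBall (0:V) r, ∀ z,
    m * ‖z‖ ^ 2 ≤ S.q y z ∧ S.q y z ≤ M * ‖z‖ ^ 2 := by
  have hK : IsCompact (closedBall (0:V) r ×ˢ sphere (0:V) 1) :=
    (isCompact_closedBall _ _).prod (isCompact_sphere _ _)
  have hne : ∀ p ∈ closedBall (0:V) r ×ˢ sphere (0:V) 1, S.q p.1 p.2 ≠ 0 := by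
    intro p hp
    refine (q_pos S _ ?_).ne'
    intro h
    have := hp.2
    rw [h] at this
    simp at this
  obtain ⟨M, hM⟩ := hK.exists_bound_of_continuousOn (q_cont S).continuousOn
  obtain ⟨m, hm⟩ := hK.exists_bound_of_continuousOn ((q_cont S).continuousOn.inv₀ hne)
  refine ⟨(|m| + 1)⁻¹, |M| + 1, by positivity, by positivity, fun y hy z => ?_⟩
  rcases eq_or_ne z 0 with rfl | hz
  · simp [q_zero]
  have hz0 : 0 < ‖z‖ := norm_pos_iff.mpr hz
  have hu : ‖z‖⁻¹ • z ∈ sphere (0:V) 1 := by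
    simp [norm_smul, hz0.ne']
  have he : S.q y z = ‖z‖ ^ 2 * S.q y (‖z‖⁻¹ • z) := by
    rw [q_smul]; field_simp
  have h1 := hM (y, ‖z‖⁻¹ • z) ⟨hy, hu⟩
  have h2 := hm (y, ‖z‖⁻¹ • z) ⟨hy, hu⟩
  have hp : 0 < S.q y (‖z‖⁻¹ • z) := by
    refine lt_of_le_of_ne (q_nonneg S _ _) (Ne.symm (hne (y, _) ⟨hy, hu⟩))
  simp only [Real.norm_eq_abs, Pi.inv_apply] at h1 h2
  rw [abs_of_pos hp] at h1
  rw [abs_of_pos (inv_pos.mpr hp)] at h2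
  have h3 : (|m| + 1)⁻¹ ≤ S.q y (‖z‖⁻¹ • z) := by
    rw [inv_le_comm₀ (by positivity) hp]
    linarith [le_abs_self m]
  rw [he]
  constructor
  · rw [mul_comm]; gcongr
  · rw [mul_comm]; gcongr; linarith [le_abs_self M]

theorem d_q (y x : V) (k : ι) : S.d k (fun x => S.q y (x - y)) x = 2 * S.w y k (x - y) := by
  classical
  have h : HasFDerivAt (fun x => S.q y (x - y))
      (∑ i, ∑ j, ((S.bi y i j * S.co i (x - y)) • S.co j + S.co j (x - y) • (S.bi y i j • S.co i))) x := by
    unfold EF.q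
    refine HasFDerivAt.fun_sum fun i _ => HasFDerivAt.fun_sum fun j _ => ?_
    have hc : ∀ i, HasFDerivAt (fun x => S.co i (x - y)) (S.co i) x := fun i => by
      have := (S.co i).hasFDerivAt.comp x ((hasFDerivAt_id x).sub_const y)
      exact this
    exact ((hc i).const_mul _).mul (hc j)
  unfold EF.d
  rw [h.fderiv]
  simp only [_root_.sum_apply, _root_.add_apply,
    _root_.smul_apply, smul_eq_mul, co_e, Finset.sum_add_distrib]
  simp only [mul_ite, mul_one, mul_zero, Finset.sum_ite_eq', Finset.sum_ite_eq, Finset.mem_univ, if_true]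
  rw [Finset.sum_comm]
  simp only [mul_ite, mul_one, mul_zero, Finset.sum_ite_eq', Finset.sum_ite_eq, Finset.mem_univ, if_true]
  unfold EF.w
  rw [two_mul]
  congr 1
  · exact Finset.sum_congr rfl fun i _ => by rw [bi_symm]
  · exact Finset.sum_congr rfl fun i _ => by ring

theorem d_w (y x : V) (k i : ι) : S.d k (fun x => S.w y i (x - y)) x = S.bi y i k := by
  classical
  have h : HasFDerivAt (fun x => S.w y i (x - y)) (∑ j, S.bi y i j • S.co j) x := by
    unfold EF.w
    refine HasFDerivAt.fun_sum fun j _ => ?_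
    have hc : ∀ i, HasFDerivAt (fun x => S.co i (x - y)) (S.co i) x := fun i => by
      have := (S.co i).hasFDerivAt.comp x ((hasFDerivAt_id x).sub_const y)
      exact this
    exact ((hc j).const_mul _)
  unfold EF.d
  rw [h.fderiv]
  simp [_root_.sum_apply, co_e]

theorem q_smooth (y : V) {k : WithTop ℕ∞} : ContDiff ℝ k fun x => S.q y (x - y) := by
  unfold EF.q
  refine ContDiff.sum fun i _ => ContDiff.sum fun j _ => ?_
  have hc : ∀ i, ContDiff ℝ k fun x => S.co i (x - y) := fun i =>
    (S.co i).contDiff.comp (contDiff_id.sub contDiff_const)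
  exact (contDiff_const.mul (hc i)).mul (hc j)

/-- `a(x):b(y)` -/
def EF.trB (x y : V) : ℝ := 2 * ∑ i, ∑ j, S.a i j x * S.bi y i j

def EF.grA (x y : V) : ℝ := 4 * ∑ i, ∑ j, S.a i j x * S.w y i (x - y) * S.w y j (x - y)

theorem L_q (y x : V) : S.L (fun x => S.q y (x - y)) x = S.trB x y := by
  unfold EF.L EF.trB
  rw [Finset.mul_sum]
  refine Finset.sum_congr rfl fun i _ => ?_
  rw [Finset.mul_sum]
  refine Finset.sum_congr rfl fun j _ => ?_
  have h1 : S.d j (fun x => S.q y (x - y)) = fun x => 2 * S.w y j (x - y) := by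
    funext x; exact d_q S y x j
  have hw : ContDiff ℝ 1 (fun x => S.w y j (x - y)) := by
    unfold EF.w
    refine ContDiff.sum fun i _ => ?_
    exact contDiff_const.mul ((S.co i).contDiff.comp (contDiff_id.sub contDiff_const))
  rw [h1, d_const_mul S i _ hw]
  beta_reduce
  rw [d_w, bi_symm]; ring

theorem trB_self {n : ℕ} (hN : Fintype.card ι = 2 * n) (y : V) : S.trB y y = 4 * n := by
  classical
  unfold EF.trB
  have : ∑ i, ∑ j, S.a i j y * S.bi y i j = ∑ i : ι, 1 := by
    refine Finset.sum_congr rfl fun i _ => ?_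
    have := ab_one S y i i
    rw [if_pos rfl] at this
    rw [← this]
    exact Finset.sum_congr rfl fun j _ => by rw [bi_symm]
  rw [this]
  simp [hN]; ring

/-- Perturbation bounds. -/
theorem perturb {n : ℕ} (hn : 1 ≤ n) (hN : Fintype.card ι = 2 * n) (r : ℝ) :
    ∃ K : ℝ, 0 ≤ K ∧ ∀ y ∈ closedBall (0:V) r, ∀ x, ‖x - y‖ ≤ 1 →
    |S.grA x y - 4 * S.q y (x - y)| ≤ 4 * K * √(S.q y (x - y)) * S.q y (x - y) ∧
    |S.trB x y - 4 * n| ≤ 4 * n * K * √(S.q y (x - y)) := by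
  obtain ⟨m, M, hm, hM, hq⟩ := q_bounds S r
  obtain ⟨Λ, hΛ, hL⟩ := a_lip S (r + 1)
  have hb : ∃ B : ℝ, 0 < B ∧ ∀ y ∈ closedBall (0:V) r, ∀ i j, |S.bi y i j| ≤ B := by
    have : ∀ i j, ∃ B : ℝ, ∀ y ∈ closedBall (0:V) r, |S.bi y i j| ≤ B := fun i j =>
      (isCompact_closedBall (0:V) r).exists_bound_of_continuousOn (bi_cont S i j).continuousOn
    choose B hB using this
    refine ⟨1 + ∑ i, ∑ j, |B i j|, by positivity, fun y hy i j => (hB i j y hy).trans ?_⟩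
    have h1 : |B i j| ≤ ∑ j, |B i j| :=
      Finset.single_le_sum (f := fun j => |B i j|) (fun _ _ => abs_nonneg _) (Finset.mem_univ j)
    have h2 : ∑ j, |B i j| ≤ ∑ i, ∑ j, |B i j| :=
      Finset.single_le_sum (f := fun i => ∑ j, |B i j|)
        (fun _ _ => Finset.sum_nonneg fun _ _ => abs_nonneg _) (Finset.mem_univ i)
    linarith [le_abs_self (B i j)]
  obtain ⟨B, hB, hb⟩ := hb
  have hco : ∃ T : ℝ, 0 < T ∧ ∀ i z, |S.co i z| ≤ T * ‖z‖ := by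
    refine ⟨1 + ∑ i, ‖S.co i‖, by positivity, fun i z => ?_⟩
    have := (S.co i).le_opNorm z
    rw [Real.norm_eq_abs] at this
    refine this.trans ?_
    gcongr
    have h2 : ‖S.co i‖ ≤ ∑ i, ‖S.co i‖ :=
      Finset.single_le_sum (f := fun i => ‖S.co i‖) (fun _ _ => norm_nonneg _) (Finset.mem_univ i)
    linarith
  obtain ⟨T, hT, hco⟩ := hco
  set N : ℝ := (Fintype.card ι : ℝ) with hNdef
  have hN0 : 0 ≤ N := by positivity
  have hw : ∀ y ∈ closedBall (0:V) r, ∀ i z, |S.w y i z| ≤ N * (B * (T * ‖z‖)) := by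
    intro y hy i z
    unfold EF.w
    refine (Finset.abs_sum_le_sum_abs _ _).trans ?_
    refine (Finset.sum_le_sum fun j _ => (?_ : _ ≤ B * (T * ‖z‖))).trans (by simp [hNdef])
    rw [abs_mul]
    gcongr
    · exact hb y hy i j
    · exact hco j z
  set W : ℝ := N * (B * T) with hW
  refine ⟨N * N * (Λ * W ^ 2) / (m * √m) + N * N * (Λ * B) / √m, by positivity, ?_⟩
  intro y hy x hxy
  have hy1 : y ∈ closedBall (0:V) (r + 1) := closedBall_subset_closedBall (by linarith) hy
  have hx1 : x ∈ closedBall (0:V) (r + 1) := by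
    rw [mem_closedBall_zero_iff] at hy ⊢
    calc ‖x‖ = ‖y + (x - y)‖ := by congr 1; abel
      _ ≤ ‖y‖ + ‖x - y‖ := norm_add_le _ _
      _ ≤ r + 1 := by linarith
  set z := x - y with hz
  have hsum : ∀ (t : ι → ι → ℝ) (c : ℝ), (∀ i j, |t i j| ≤ c) → |∑ i, ∑ j, t i j| ≤ N * N * c := by
    intro t c h
    refine (Finset.abs_sum_le_sum_abs _ _).trans ?_
    refine (Finset.sum_le_sum fun i _ => (Finset.abs_sum_le_sum_abs _ _).trans
      (Finset.sum_le_sum fun j _ => h i j)).trans ?_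
    simp [hNdef, mul_assoc]
  have hqz := (hq y hy z).1
  have hq0 := q_nonneg S y z
  have hsq : √m * ‖z‖ ≤ √(S.q y z) := by
    rw [← Real.sqrt_sq (norm_nonneg z), ← Real.sqrt_mul hm.le]
    exact Real.sqrt_le_sqrt hqz
  have hsm : 0 < √m := Real.sqrt_pos.mpr hm
  constructor
  · have e : S.grA x y - 4 * S.q y z =
        4 * ∑ i, ∑ j, (S.a i j x - S.a i j y) * S.w y i z * S.w y j z := by
      rw [← aww S y z]
      unfold EF.grA
      rw [← mul_sub, ← Finset.sum_sub_distrib]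
      congr 1
      refine Finset.sum_congr rfl fun i _ => ?_
      rw [← Finset.sum_sub_distrib]
      exact Finset.sum_congr rfl fun j _ => by rw [← hz]; ring
    rw [e, abs_mul]
    have h1 := hsum (fun i j => (S.a i j x - S.a i j y) * S.w y i z * S.w y j z)
      (Λ * W ^ 2 * (‖z‖ * ‖z‖ ^ 2)) (by
        intro i j
        rw [abs_mul, abs_mul]
        calc |S.a i j x - S.a i j y| * |S.w y i z| * |S.w y j z|
            ≤ (Λ * ‖z‖) * (N * (B * (T * ‖z‖))) * (N * (B * (T * ‖z‖))) := by
              gcongr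
              · exact hL i j x hx1 y hy1
              · exact hw y hy i z
              · exact hw y hy j z
          _ = _ := by rw [hW]; ring)
    have h2 : ‖z‖ * ‖z‖ ^ 2 ≤ √(S.q y z) * S.q y z / (m * √m) := by
      rw [le_div_iff₀ (by positivity)]
      calc ‖z‖ * ‖z‖ ^ 2 * (m * √m) = (√m * ‖z‖) * (m * ‖z‖ ^ 2) := by ring
        _ ≤ _ := by gcongr
    have h3 : 0 ≤ N * N * (Λ * B) / √m * (√(S.q y z) * S.q y z) := by positivity
    calc |(4:ℝ)| * |∑ i, ∑ j, (S.a i j x - S.a i j y) * S.w y i z * S.w y j z|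
        ≤ 4 * (N * N * (Λ * W ^ 2 * (‖z‖ * ‖z‖ ^ 2))) := by
          rw [abs_of_pos (by norm_num : (0:ℝ) < 4)]; gcongr
      _ ≤ 4 * (N * N * (Λ * W ^ 2 * (√(S.q y z) * S.q y z / (m * √m)))) := by gcongr
      _ = 4 * (N * N * (Λ * W ^ 2) / (m * √m)) * (√(S.q y z) * S.q y z) := by ring
      _ ≤ _ := by linarith
  · have e : S.trB x y - 4 * n = 2 * ∑ i, ∑ j, (S.a i j x - S.a i j y) * S.bi y i j := by
      rw [← trB_self S hN y]
      unfold EF.trB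
      rw [← mul_sub, ← Finset.sum_sub_distrib]
      congr 1
      refine Finset.sum_congr rfl fun i _ => ?_
      rw [← Finset.sum_sub_distrib]
      exact Finset.sum_congr rfl fun j _ => by ring
    rw [e, abs_mul]
    have h1 := hsum (fun i j => (S.a i j x - S.a i j y) * S.bi y i j)
      (Λ * B * ‖z‖) (by
        intro i j
        rw [abs_mul]
        calc |S.a i j x - S.a i j y| * |S.bi y i j|
            ≤ (Λ * ‖z‖) * B := by
              gcongr
              · exact hL i j x hx1 y hy1
              · exact hb y hy i j
          _ = _ := by ring)
    have h2 : ‖z‖ ≤ √(S.q y z) / √m := by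
      rw [le_div_iff₀ (by positivity)]; linarith
    have hn1 : (1:ℝ) ≤ n := by exact_mod_cast hn
    have h3 : 0 ≤ 4 * n * (N * N * (Λ * W ^ 2) / (m * √m)) * √(S.q y z) := by positivity
    have h4 : 0 ≤ (N * N * (Λ * B) / √m) * √(S.q y z) := by positivity
    calc |(2:ℝ)| * |∑ i, ∑ j, (S.a i j x - S.a i j y) * S.bi y i j|
        ≤ 2 * (N * N * (Λ * B * ‖z‖)) := by
          rw [abs_of_pos (by norm_num : (0:ℝ) < 2)]; gcongr
      _ ≤ 2 * (N * N * (Λ * B * (√(S.q y z) / √m))) := by gcongr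
      _ = 2 * ((N * N * (Λ * B) / √m) * √(S.q y z)) := by ring
      _ ≤ 4 * n * ((N * N * (Λ * B) / √m) * √(S.q y z)) := by gcongr; linarith
      _ ≤ _ := by linarith

end quad

end APerron
end

open MeasureTheory Filter Topology Complex Metric

set_option linter.unusedSectionVars false
set_option linter.unusedSimpArgs false
set_option linter.unusedVariables false

noncomputable section

namespace APerron

open Module

section kern

variable {V : Type*} [NormedAddCommGroup V] [NormedSpace ℝ V] [FiniteDimensional ℝ V]
  [MeasureSpace V] [BorelSpace V] [(volume : Measure V).IsAddHaarMeasure]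
  {ι : Type*} [Fintype ι]

/-- A family of approximate fundamental solutions. -/
structure Ker (S : EF V ι) (n : ℕ) (r : ℝ) where
  R0 : ℝ
  C : ℝ
  m : ℝ
  G : ℝ → ℝ → V → V → ℝ
  E : ℝ → ℝ → V → V → ℝ
  H : ℝ → ℝ → V → V → ℝ
  R0_pos : 0 < R0
  R0_le : R0 ≤ 1
  C_ge : 1 ≤ C
  m_pos : 0 < m
  G_cont : ∀ {R s}, 0 < R → R ≤ R0 → 0 < s → Continuous fun p : V × V => G R s p.1 p.2
  H_cont : ∀ {R s}, 0 < R → R ≤ R0 → 0 < s → Continuous fun p : V × V => H R s p.1 p.2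
  G_smooth : ∀ {R s y}, 0 < R → R ≤ R0 → 0 < s → ContDiff ℝ (⊤ : ℕ∞) (G R s y)
  G_nonneg : ∀ {R s y x}, 0 < R → R ≤ R0 → 0 < s → 0 ≤ G R s y x
  G_zero : ∀ {R s y x}, 0 < R → R ≤ R0 → 0 < s → y ∈ closedBall (0:V) r → C * R ≤ ‖x - y‖ → G R s y x = 0
  H_zero : ∀ {R s y x}, 0 < R → R ≤ R0 → 0 < s → y ∈ closedBall (0:V) r → C * R ≤ ‖x - y‖ → H R s y x = 0
  E_zero : ∀ {R s y x}, 0 < R → R ≤ R0 → 0 < s → y ∈ closedBall (0:V) r → C * R ≤ ‖x - y‖ → E R s y x = 0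
  G_anti : ∀ {R s t y x}, 0 < R → R ≤ R0 → 0 < s → s ≤ t → G R t y x ≤ G R s y x
  G_le : ∀ {R s y x}, 0 < R → R ≤ R0 → 0 < s → y ∈ closedBall (0:V) r → x ≠ y →
    G R s y x ≤ C * (‖x - y‖ ^ (2 * n - 1))⁻¹
  G_ge : ∀ {R}, 0 < R → R ≤ R0 → ∃ γ > 0, ∀ {s y x}, 0 < s → s ≤ m * R ^ 2 → y ∈ closedBall (0:V) r →
    ‖x - y‖ ≤ m * R → γ ≤ G R s y x
  LG : ∀ {R s y x}, 0 < R → R ≤ R0 → 0 < s → S.L (G R s y) x = E R s y x - H R s y x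
  E_nonneg : ∀ {R s y x}, 0 < R → R ≤ R0 → 0 < s → y ∈ closedBall (0:V) r → 0 ≤ E R s y x
  E_le : ∀ {R s y x}, 0 < R → R ≤ R0 → 0 < s → y ∈ closedBall (0:V) r → x ≠ y →
    E R s y x ≤ C * ((‖x - y‖ ^ (2 * n - 1))⁻¹ + (R⁻¹) ^ (2 * n))
  H_nonneg : ∀ {R s y x}, 0 < R → R ≤ R0 → 0 < s → 0 ≤ H R s y x
  H_le : ∀ {R s y x}, 0 < R → R ≤ R0 → 0 < s → y ∈ closedBall (0:V) r →
    H R s y x ≤ C * (s / (s + ‖x - y‖ ^ 2) ^ (n + 1))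
  H_ge : ∀ {R s y x}, 0 < R → R ≤ R0 → 0 < s → s ≤ m * R ^ 2 → y ∈ closedBall (0:V) r →
    ‖x - y‖ ^ 2 ≤ s → m / s ^ n ≤ H R s y x

theorem sqrt_div_pow {n : ℕ} (hn : 1 ≤ n) {m t p : ℝ} (hm : 0 < m) (ht : 0 < t) (h : m * t ^ 2 ≤ p) :
    √p / p ^ n ≤ (√m ^ (2 * n - 1))⁻¹ * (t ^ (2 * n - 1))⁻¹ := by
  have hp : 0 < p := lt_of_lt_of_le (by positivity) h
  have hρ : 0 < √p := Real.sqrt_pos.mpr hp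
  have hle : √m * t ≤ √p := by
    rw [← Real.sqrt_sq ht.le, ← Real.sqrt_mul hm.le]; exact Real.sqrt_le_sqrt h
  have e : √p / p ^ n = (√p ^ (2 * n - 1))⁻¹ := by
    conv_lhs => rw [← Real.sq_sqrt hp.le, Real.sqrt_sq hρ.le, ← pow_mul]
    obtain ⟨k, rfl⟩ : ∃ k, n = k + 1 := ⟨n - 1, by omega⟩
    have : 2 * (k + 1) = (2 * (k + 1) - 1) + 1 := by omega
    rw [this, pow_succ]
    have h2 : 2 * (k + 1) - 1 + 1 - 1 = 2 * (k + 1) - 1 := by omega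
    rw [h2]
    field_simp
  have hsm : 0 < √m := Real.sqrt_pos.mpr hm
  rw [e, ← mul_inv, ← mul_pow]
  gcongr

set_option maxHeartbeats 1000000 in
theorem exists_ker (S : EF V ι) {n : ℕ} (hn : 1 ≤ n) (hN : Fintype.card ι = 2 * n) (r : ℝ) :
    Nonempty (Ker S n r) := by
  obtain ⟨m0, M, hm0, hM, hq0⟩ := q_bounds S r
  obtain ⟨K, hK, hper⟩ := perturb S hn hN r
  set c : ℝ := 8 * n * K with hc
  have hc0 : 0 ≤ c := by positivity
  obtain ⟨C1, hC1, hE⟩ := pE_le (n := n) (c := c) hn hK hc0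
  obtain ⟨C2, hC2, hpd⟩ := pd_le (n := n) (c := c) hn hc0
  -- lower ellipticity constant at most one
  obtain ⟨m, hm, hm1, hq⟩ : ∃ m : ℝ, 0 < m ∧ m ≤ 1 ∧ ∀ y ∈ closedBall (0:V) r, ∀ z,
      m * ‖z‖ ^ 2 ≤ S.q y z ∧ S.q y z ≤ M * ‖z‖ ^ 2 := by
    refine ⟨min m0 1, lt_min hm0 one_pos, min_le_right _ _, fun y hy z => ⟨?_, (hq0 y hy z).2⟩⟩
    refine le_trans ?_ (hq0 y hy z).1
    gcongr
    exact min_le_left _ _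
  set R0 : ℝ := min (m / 2) (1 / (4 * K + 1)) with hR0
  have hR0p : 0 < R0 := by rw [hR0]; positivity
  have hR01 : R0 ≤ m / 2 := min_le_left _ _
  have hR02 : R0 ≤ 1 / (4 * K + 1) := min_le_right _ _
  have hR1 : ∀ {R}, R ≤ R0 → R ≤ 1 := fun h => by linarith
  have hKR : ∀ {R}, 0 < R → R ≤ R0 → 4 * K * R ≤ 1 := fun {R} h0 h => by
    have h1 : R ≤ 1 / (4 * K + 1) := h.trans hR02
    rw [le_div_iff₀ (by positivity)] at h1
    nlinarith
  set P : ℝ → V → V → ℝ := fun s y x => S.q y (x - y) + s with hP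
  have hPs : ∀ {s y x}, 0 < s → 0 < P s y x := fun {s y x} hs => by
    have := q_nonneg S y (x - y); simp only [hP]; linarith
  have hPcont : ∀ s, Continuous fun p : V × V => P s p.1 p.2 := fun s => by
    have := (q_cont S).comp (continuous_fst.prodMk (continuous_snd.sub continuous_fst) : Continuous fun p : V × V => (p.1, p.2 - p.1))
    exact this.add continuous_const
  have hbig : ∀ {R s y x}, 0 < R → 0 < s → y ∈ closedBall (0:V) r → (1 + 2 / m) * R ≤ ‖x - y‖ →
      2 * R ^ 2 ≤ P s y x := fun {R s y x} hR hs hy h => by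
    have h1 := (hq y hy (x - y)).1
    have h2 : ((1 + 2 / m) * R) ^ 2 ≤ ‖x - y‖ ^ 2 := by gcongr
    have h3 : m * ((1 + 2 / m) * R) ^ 2 = (m + 4 + 4 / m) * R ^ 2 := by field_simp; ring
    have h4 : m * ((1 + 2 / m) * R) ^ 2 ≤ m * ‖x - y‖ ^ 2 := by gcongr
    have h5 : 0 ≤ 4 / m * R ^ 2 := by positivity
    simp only [hP]
    nlinarith [sq_nonneg R]
  have hsmall : ∀ {R s y x}, 0 < R → R ≤ R0 → 0 < s → y ∈ closedBall (0:V) r → P s y x < 2 * R ^ 2 →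
      ‖x - y‖ ≤ 1 := fun {R s y x} hR hRR hs hy h => by
    have h1 := (hq y hy (x - y)).1
    simp only [hP] at h
    have h2 : 2 * R ^ 2 ≤ m := by nlinarith [hR1 hRR]
    have h3 : m * ‖x - y‖ ^ 2 < m * 1 := by linarith
    have h4 : ‖x - y‖ ^ 2 < 1 := lt_of_mul_lt_mul_left h3 hm.le
    nlinarith [norm_nonneg (x - y)]
  have hA : ∀ {R s y x}, 0 < R → R ≤ R0 → 0 < s → y ∈ closedBall (0:V) r → P s y x < 2 * R ^ 2 →
      |S.grA x y - 4 * S.q y (x - y)| ≤ 4 * K * √(P s y x) * S.q y (x - y) :=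
      fun {R s y x} hR hRR hs hy h => by
    refine (hper y hy x (hsmall hR hRR hs hy h)).1.trans ?_
    have := q_nonneg S y (x - y)
    gcongr
    simp only [hP]; linarith
  have hB : ∀ {R s y x}, 0 < R → R ≤ R0 → 0 < s → y ∈ closedBall (0:V) r → P s y x < 2 * R ^ 2 →
      |S.trB x y - 4 * n| ≤ 4 * n * K * √(P s y x) :=
      fun {R s y x} hR hRR hs hy h => by
    refine (hper y hy x (hsmall hR hRR hs hy h)).2.trans ?_
    gcongr
    simp only [hP]; linarith
  set C : ℝ := (1 + 2 / m) + (4 + C1) * ((√m ^ (2 * n - 1))⁻¹ + 1) + 4 * C2 / m ^ (n + 1) with hC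
  have hCa : 1 + 2 / m ≤ C := by
    have h1 : 0 ≤ (4 + C1) * ((√m ^ (2 * n - 1))⁻¹ + 1) := by positivity
    have h2 : 0 ≤ 4 * C2 / m ^ (n + 1) := by positivity
    linarith
  have hCb : (4 + C1) * ((√m ^ (2 * n - 1))⁻¹ + 1) ≤ C := by
    have h1 : 0 ≤ 2 / m := by positivity
    have h2 : 0 ≤ 4 * C2 / m ^ (n + 1) := by positivity
    linarith
  have hCc : 4 * C2 / m ^ (n + 1) ≤ C := by
    have h1 : 0 ≤ (4 + C1) * ((√m ^ (2 * n - 1))⁻¹ + 1) := by positivity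
    have h2 : 0 ≤ 2 / m := by positivity
    linarith
  have hC0 : 0 < C := lt_of_lt_of_le (by positivity) hCa
  have hzero : ∀ {R s y x}, 0 < R → 0 < s → y ∈ closedBall (0:V) r → C * R ≤ ‖x - y‖ →
      2 * R ^ 2 ≤ P s y x := fun {R s y x} hR hs hy h =>
    hbig hR hs hy (le_trans (by gcongr) h)
  have hPlow : ∀ {s y x}, 0 < s → y ∈ closedBall (0:V) r → m * ‖x - y‖ ^ 2 ≤ P s y x :=
      fun {s y x} hs hy => by
    have := (hq y hy (x - y)).1; simp only [hP]; linarith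
  set m1 : ℝ := min (1 / (2 * (M + 1))) (4 * n * Real.exp (-c) / (M + 1) ^ (n + 1)) with hm1d
  have hn0 : (0:ℝ) < n := by exact_mod_cast hn
  have hm1p : 0 < m1 := by rw [hm1d]; positivity
  have hm1a : (M + 1) * m1 ≤ 1 / 2 := by
    have : m1 ≤ 1 / (2 * (M + 1)) := min_le_left _ _
    calc (M + 1) * m1 ≤ (M + 1) * (1 / (2 * (M + 1))) := by gcongr
      _ = 1 / 2 := by field_simp
  have hm1b : m1 ≤ 1 := by nlinarith
  refine ⟨{ R0 := R0, C := C, m := m1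
            G := fun R s y x => pg n c R (P s y x)
            E := fun R s y x => pE n c R s (P s y x) (S.grA x y) (S.trB x y)
            H := fun R s y x => 4 * s * (-(pd n c R (P s y x)))
            R0_pos := hR0p, R0_le := hR1 le_rfl
            C_ge := le_trans (by have : 0 ≤ 2 / m := by positivity
                                 linarith) hCa
            m_pos := hm1p
            G_cont := ?_, H_cont := ?_, G_smooth := ?_, G_nonneg := ?_, G_zero := ?_, H_zero := ?_, E_zero := ?_
            G_anti := ?_, G_le := ?_, G_ge := ?_, LG := ?_, E_nonneg := ?_, E_le := ?_, H_nonneg := ?_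
            H_le := ?_, H_ge := ?_ }⟩
  · intro R s hR hRR hs
    exact (pg_contDiffOn hR).continuousOn.comp_continuous (hPcont s) fun p => hPs hs
  · intro R s hR hRR hs
    exact continuous_const.mul (pd_contOn.comp_continuous (hPcont s) fun p => hPs hs).neg
  · intro R s y hR hRR hs
    have h1 : ContDiff ℝ (⊤ : ℕ∞) (P s y) := (q_smooth S y).add contDiff_const
    exact (pg_contDiffOn hR).comp_contDiff h1 fun x => hPs hs
  · intro R s y x hR hRR hs
    exact pg_nonneg hR (hPs hs)
  · intro R s y x hR hRR hs hy h
    exact pg_zero hR (hzero hR hs hy h)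
  · intro R s y x hR hRR hs hy h
    simp only [pd_zero hR (hzero hR hs hy h)]; simp
  · intro R s y x hR hRR hs hy h
    exact pE_zero hR (hzero hR hs hy h)
  · intro R s t y x hR hRR hs hst
    exact pg_anti hR (hPs hs) (hPs (hs.trans_le hst)) (by simp only [hP]; linarith)
  · intro R s y x hR hRR hs hy hxy
    have hz : 0 < ‖x - y‖ := norm_pos_iff.mpr (sub_ne_zero.mpr hxy)
    refine (pg_le hn hc0 hR (hR1 hRR) (hPs hs)).trans ?_
    have h1 := sqrt_div_pow hn hm hz (hPlow hs hy)
    have h2 : 4 * (√m ^ (2 * n - 1))⁻¹ ≤ C := by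
      refine le_trans ?_ hCb
      have : 0 ≤ (√m ^ (2 * n - 1))⁻¹ := by positivity
      nlinarith
    calc _ ≤ 4 * ((√m ^ (2 * n - 1))⁻¹ * (‖x - y‖ ^ (2 * n - 1))⁻¹) := by gcongr
      _ = 4 * (√m ^ (2 * n - 1))⁻¹ * (‖x - y‖ ^ (2 * n - 1))⁻¹ := by ring
      _ ≤ _ := by gcongr
  · intro R hR hRR
    refine ⟨pg n c R (R ^ 2 / 2), pg_pos hc0 hR (hR1 hRR), ?_⟩
    intro s y x hs hsm hy hx
    refine pg_anti hR (hPs hs) (by simp only [Set.mem_Ioi]; positivity) ?_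
    have h1 := (hq y hy (x - y)).2
    have h2 : ‖x - y‖ ^ 2 ≤ (m1 * R) ^ 2 := by gcongr
    have h3 : M * ‖x - y‖ ^ 2 ≤ M * (m1 * R) ^ 2 := by gcongr
    have h4 : M * (m1 * R) ^ 2 ≤ M * m1 * R ^ 2 := by
      have : M * (m1 * R) ^ 2 = m1 * (M * m1 * R ^ 2) := by ring
      rw [this]
      exact mul_le_of_le_one_left (by positivity) hm1b
    have h5 : (M + 1) * m1 * R ^ 2 ≤ 1 / 2 * R ^ 2 := by gcongr
    simp only [hP]
    linarith
  · intro R s y x hR hRR hs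
    have h0 : ContDiff ℝ 2 (P s y) := (q_smooth S y).add contDiff_const
    have h1 := L_comp S (f := P s y) (x := x) h0 (g := pg n c R) (g1 := fun t => -pf n c R t)
      (g2 := -pd n c R (P s y x))
      (by filter_upwards [Ioi_mem_nhds (hPs hs)] with t ht using pg_hasDeriv hR ht)
      (pf_hasDeriv hR (hPs hs)).neg
    have h2 : S.L (P s y) x = S.trB x y := by
      have : P s y = fun x => S.q y (x - y) + s := rfl
      rw [this, L_add S (q_smooth S y) contDiff_const]; beta_reduce; rw [L_q, L_const]; simp
    have h3 : ∀ i, S.d i (P s y) x = 2 * S.w y i (x - y) := fun i => by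
      have : P s y = fun x => S.q y (x - y) + s := rfl
      rw [this, d_add S i (q_smooth S y) contDiff_const]; beta_reduce; rw [d_q, d_const]; simp
    have h4 : ∑ i, ∑ j, S.a i j x * S.d i (P s y) x * S.d j (P s y) x = S.grA x y := by
      unfold EF.grA
      simp only [h3, Finset.mul_sum]
      exact Finset.sum_congr rfl fun i _ => Finset.sum_congr rfl fun j _ => by ring
    rw [h2, h4] at h1
    simp only [pE]
    refine Eq.trans h1 ?_
    ring
  · intro R s y x hR hRR hs hy
    exact pE_nonneg hn hR hK (hKR hR hRR) le_rfl (hPs hs) hs.le (q_nonneg S y (x - y)) rfl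
      (hA hR hRR hs hy) (hB hR hRR hs hy)
  · intro R s y x hR hRR hs hy hxy
    have hz : 0 < ‖x - y‖ := norm_pos_iff.mpr (sub_ne_zero.mpr hxy)
    refine (hE hR (hR1 hRR) (hKR hR hRR) (hPs hs) hs.le (q_nonneg S y (x - y)) rfl
      (hA hR hRR hs hy) (hB hR hRR hs hy)).trans ?_
    have h1 := sqrt_div_pow hn hm hz (hPlow hs hy)
    set u := (√m ^ (2 * n - 1))⁻¹
    have hu : 0 ≤ u := by positivity
    have h2 : C1 * u ≤ C := by refine le_trans ?_ hCb; nlinarith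
    have h3 : C1 ≤ C := by refine le_trans ?_ hCb; nlinarith
    calc _ ≤ C1 * (u * (‖x - y‖ ^ (2 * n - 1))⁻¹ + R⁻¹ ^ (2 * n)) := by gcongr
      _ = C1 * u * (‖x - y‖ ^ (2 * n - 1))⁻¹ + C1 * R⁻¹ ^ (2 * n) := by ring
      _ ≤ C * (‖x - y‖ ^ (2 * n - 1))⁻¹ + C * R⁻¹ ^ (2 * n) := by gcongr
      _ = _ := by ring
  · intro R s y x hR hRR hs
    have := pd_nonpos (n := n) (R := R) hc0 (hPs (s := s) (y := y) (x := x) hs)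
    have h2 : 0 ≤ -pd n c R (P s y x) := by linarith
    positivity
  · intro R s y x hR hRR hs hy
    have h1 := hpd hR (hR1 hRR) (hPs (s := s) (y := y) (x := x) hs)
    have h2 : m * (s + ‖x - y‖ ^ 2) ≤ P s y x := by
      have := (hq y hy (x - y)).1
      simp only [hP]; nlinarith
    calc 4 * s * (-pd n c R (P s y x)) ≤ 4 * s * (C2 / (P s y x) ^ (n + 1)) := by gcongr
      _ ≤ 4 * s * (C2 / (m * (s + ‖x - y‖ ^ 2)) ^ (n + 1)) := by gcongr
      _ = 4 * C2 / m ^ (n + 1) * (s / (s + ‖x - y‖ ^ 2) ^ (n + 1)) := by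
        rw [mul_pow]; field_simp
      _ ≤ _ := by gcongr
  · intro R s y x hR hRR hs hsm hy hx
    have h1 := (hq y hy (x - y)).2
    have h2 : P s y x ≤ (M + 1) * s := by
      have : M * ‖x - y‖ ^ 2 ≤ M * s := by gcongr
      simp only [hP]; linarith
    have h3 : P s y x ≤ R ^ 2 := by
      have h5 : (M + 1) * s ≤ (M + 1) * (m1 * R ^ 2) := by gcongr
      have h6 : (M + 1) * m1 * R ^ 2 ≤ 1 / 2 * R ^ 2 := by gcongr
      nlinarith [sq_nonneg R]
    have h4 := pd_ge (n := n) hc0 hR (hR1 hRR) (hPs (s := s) (y := y) (x := x) hs) h3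
    have hPp := hPs (s := s) (y := y) (x := x) hs
    calc m1 / s ^ n ≤ (4 * n * Real.exp (-c) / (M + 1) ^ (n + 1)) / s ^ n := by
          gcongr; exact min_le_right _ _
      _ = 4 * s * (n * Real.exp (-c) / ((M + 1) * s) ^ (n + 1)) := by
          rw [mul_pow]; field_simp; ring
      _ ≤ 4 * s * (n * Real.exp (-c) / (P s y x) ^ (n + 1)) := by gcongr
      _ ≤ _ := by gcongr

end kern

end APerron
end

open MeasureTheory Filter Topology Complex Metric

set_option linter.unusedSectionVars false
set_option linter.unusedSimpArgs false
set_option linter.unusedVariables false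

noncomputable section

namespace APerron

open Module

section kint

variable {V : Type*} [NormedAddCommGroup V] [NormedSpace ℝ V] [FiniteDimensional ℝ V]
  [MeasureSpace V] [BorelSpace V] [(volume : Measure V).IsAddHaarMeasure]
  {ι : Type*} [Fintype ι]

def th (n : ℕ) (s : ℝ) (z : V) : ℝ := s / (s + ‖z‖ ^ 2) ^ (n + 1)

theorem th_nonneg {n : ℕ} {s : ℝ} (hs : 0 < s) (z : V) : 0 ≤ th n s z := by
  unfold th; positivity

theorem th_cont {n : ℕ} {s : ℝ} (hs : 0 < s) : Continuous (th n s : V → ℝ) := by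
  unfold th
  refine continuous_const.div (by fun_prop) fun z => ?_
  positivity

theorem th_one_bound (n : ℕ) (z : V) :
    (1 + ‖z‖) * th n 1 z ≤ 2 ^ (n + 1) * (1 + ‖z‖) ^ (-((2 * n + 1 : ℕ) : ℝ)) := by
  have h0 : 0 ≤ ‖z‖ := norm_nonneg z
  rw [Real.rpow_neg (by positivity), Real.rpow_natCast]
  unfold th
  rw [mul_one_div, ← div_eq_mul_inv, div_le_div_iff₀ (by positivity) (by positivity)]
  have h1 : (1 + ‖z‖) * (1 + ‖z‖) ^ (2 * n + 1) = ((1 + ‖z‖) ^ 2) ^ (n + 1) := by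
    rw [← pow_mul, ← pow_succ']; congr 1
  rw [h1, ← mul_pow]
  gcongr
  nlinarith [sq_nonneg (1 - ‖z‖)]

theorem th_scale {n : ℕ} {s : ℝ} (hs : 0 < s) (z : V) :
    th n s z = (s ^ n)⁻¹ * th n 1 ((√s)⁻¹ • z) := by
  unfold th
  have h1 : ‖(√s)⁻¹ • z‖ ^ 2 = ‖z‖ ^ 2 / s := by
    rw [norm_smul, mul_pow, norm_inv, Real.norm_eq_abs, abs_of_nonneg (Real.sqrt_nonneg s), inv_pow,
      Real.sq_sqrt hs.le]
    ring
  rw [h1]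
  have h2 : s + ‖z‖ ^ 2 = s * (1 + ‖z‖ ^ 2 / s) := by field_simp
  rw [h2, mul_pow, pow_succ s]
  have : 0 < 1 + ‖z‖ ^ 2 / s := by positivity
  field_simp

theorem th_int {n : ℕ} (hd : finrank ℝ V = 2 * n) : ∃ C : ℝ, 0 < C ∧ ∀ s : ℝ, 0 < s →
    Integrable (th n s : V → ℝ) ∧ ∫ z : V, th n s z ≤ C ∧ Integrable (fun z : V => ‖z‖ * th n s z) ∧
    ∫ z : V, ‖z‖ * th n s z ≤ C * √s := by
  have hInt0 : Integrable (fun z : V => (1 + ‖z‖) * th n 1 z) := by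
    have h1 : Integrable (fun z : V => (2:ℝ) ^ (n + 1) * (1 + ‖z‖) ^ (-((2 * n + 1 : ℕ) : ℝ))) :=
      (integrable_one_add_norm (by rw [hd]; push_cast; linarith)).const_mul _
    refine h1.mono' ?_ (Eventually.of_forall fun z => ?_)
    · exact ((by fun_prop : Continuous fun z : V => 1 + ‖z‖).mul (th_cont one_pos)).aestronglyMeasurable
    · have := th_nonneg (n := n) one_pos z
      rw [Real.norm_eq_abs, abs_of_nonneg (by positivity)]
      exact th_one_bound n z
  have hi0 : Integrable (th n 1 : V → ℝ) := by
    refine hInt0.mono' (th_cont one_pos).aestronglyMeasurable (Eventually.of_forall fun z => ?_)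
    have := th_nonneg (n := n) one_pos z
    rw [Real.norm_eq_abs, abs_of_nonneg this]
    nlinarith [norm_nonneg z]
  have hi1 : Integrable (fun z : V => ‖z‖ * th n 1 z) := by
    have := hInt0.sub hi0
    refine this.congr (Eventually.of_forall fun z => ?_)
    simp only [Pi.sub_apply]; ring
  set C := 1 + (∫ z : V, th n 1 z) + ∫ z : V, ‖z‖ * th n 1 z with hC
  have hp0 : 0 ≤ ∫ z : V, th n 1 z := integral_nonneg fun z => th_nonneg one_pos z
  have hp1 : 0 ≤ ∫ z : V, ‖z‖ * th n 1 z :=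
    integral_nonneg fun z => mul_nonneg (norm_nonneg _) (th_nonneg one_pos z)
  refine ⟨C, by positivity, fun s hs => ?_⟩
  have hq : 0 < √s := Real.sqrt_pos.mpr hs
  have e0 : (th n s : V → ℝ) = fun z => (s ^ n)⁻¹ * th n 1 ((√s)⁻¹ • z) := funext fun z => th_scale hs z
  have e1 : (fun z : V => ‖z‖ * th n s z) =
      fun z => (√s * (s ^ n)⁻¹) * (‖(√s)⁻¹ • z‖ * th n 1 ((√s)⁻¹ • z)) := by
    funext z
    rw [th_scale hs z, norm_smul, norm_inv, Real.norm_eq_abs, abs_of_pos hq]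
    field_simp
  have hsc : |(((√s)⁻¹) ^ finrank ℝ V)⁻¹| = s ^ n := by
    rw [hd, inv_pow, inv_inv, pow_mul, Real.sq_sqrt hs.le, abs_of_pos (by positivity)]
  refine ⟨?_, ?_, ?_, ?_⟩
  · rw [e0]
    exact ((integrable_comp_smul_iff volume (th n 1 : V → ℝ) (inv_ne_zero hq.ne')).mpr hi0).const_mul _
  · rw [e0, integral_const_mul, Measure.integral_comp_smul volume (th n 1 : V → ℝ), hsc, smul_eq_mul,
      ← mul_assoc, inv_mul_cancel₀ (by positivity), one_mul]
    linarith
  · rw [e1]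
    exact ((integrable_comp_smul_iff volume (fun z : V => ‖z‖ * th n 1 z)
      (inv_ne_zero hq.ne')).mpr hi1).const_mul _
  · rw [e1, integral_const_mul, Measure.integral_comp_smul volume (fun z : V => ‖z‖ * th n 1 z), hsc, smul_eq_mul]
    have : √s * (s ^ n)⁻¹ * (s ^ n * ∫ z : V, ‖z‖ * th n 1 z) = (∫ z : V, ‖z‖ * th n 1 z) * √s := by
      field_simp
    rw [this]
    gcongr
    linarith

/-- the weakly singular kernel -/
def hk (n : ℕ) (ρ : ℝ) (z : V) : ℝ := (Set.Iio ρ).indicator (fun t : ℝ => (t ^ (2 * n - 1))⁻¹) ‖z‖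

theorem hk_nonneg (n : ℕ) (ρ : ℝ) (z : V) : 0 ≤ hk n ρ z := by
  unfold hk
  exact Set.indicator_apply_nonneg fun _ => by positivity

theorem hk_eq {n : ℕ} {ρ : ℝ} {z : V} (h : ‖z‖ < ρ) : hk n ρ z = (‖z‖ ^ (2 * n - 1))⁻¹ := by
  unfold hk; rw [Set.indicator_of_mem (by exact h)]

theorem hk_int {n : ℕ} (hn : 1 ≤ n) (hd : finrank ℝ V = 2 * n) : ∃ C : ℝ, 0 < C ∧ ∀ ρ : ℝ, 0 < ρ →
    Integrable (hk n ρ : V → ℝ) ∧ ∫ z : V, hk n ρ z ≤ C * ρ := by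
  have hnt : Nontrivial V := by
    apply Module.nontrivial_of_finrank_pos (R := ℝ); omega
  have e : ∀ ρ : ℝ, Set.EqOn (fun y : ℝ => y ^ (finrank ℝ V - 1) •
      (Set.Iio ρ).indicator (fun t : ℝ => (t ^ (2 * n - 1))⁻¹) y)
      ((Set.Iio ρ).indicator fun _ => (1:ℝ)) (Set.Ioi 0) := by
    intro ρ y hy
    have hy : 0 < y := hy
    simp only [hd, Set.indicator]
    split_ifs
    · simp; field_simp
    · simp
  refine ⟨1 + (finrank ℝ V) * (volume : Measure V).real (ball 0 1), by positivity, fun ρ hρ => ⟨?_, ?_⟩⟩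
  · unfold hk
    rw [integrable_fun_norm_addHaar volume, integrableOn_congr_fun (e ρ) measurableSet_Ioi]
    unfold IntegrableOn
    rw [integrable_indicator_iff measurableSet_Iio]
    unfold IntegrableOn
    rw [Measure.restrict_restrict measurableSet_Iio]
    refine integrableOn_const ?_
    have : Set.Iio ρ ∩ Set.Ioi 0 = Set.Ioo 0 ρ := by ext; simp [and_comm]
    rw [this]; simp
  · unfold hk
    rw [integral_fun_norm_addHaar volume, setIntegral_congr_fun measurableSet_Ioi (e ρ),
      integral_indicator measurableSet_Iio, Measure.restrict_restrict measurableSet_Iio]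
    have : Set.Iio ρ ∩ Set.Ioi 0 = Set.Ioo 0 ρ := by ext; simp [and_comm]
    rw [this]
    simp [hρ.le]
    nlinarith [hρ]

variable {S : EF V ι} {n : ℕ} {r : ℝ} (K : Ker S n r)

theorem finrank_eq_two (S : EF V ι) (hN : Fintype.card ι = 2 * n) : finrank ℝ V = 2 * n := by
  rw [Module.finrank_eq_card_basis S.e, hN]

theorem Ker.Cpos : 0 < K.C := by linarith [K.C_ge]

section
variable {R s : ℝ} {y : V}

theorem Ker.hcs (f : ℝ → ℝ → V → V → ℝ)
    (h : ∀ {x}, K.C * R ≤ ‖x - y‖ → f R s y x = 0) : HasCompactSupport (f R s y) := by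
  refine HasCompactSupport.intro (isCompact_closedBall y (K.C * R)) fun x hx => h ?_
  rw [mem_closedBall, dist_eq_norm, not_le] at hx
  exact hx.le

theorem Ker.G_hcs (hR : 0 < R) (hRR : R ≤ K.R0) (hs : 0 < s) (hy : y ∈ closedBall (0:V) r) :
    HasCompactSupport (K.G R s y) := K.hcs K.G (K.G_zero hR hRR hs hy)

theorem Ker.G_tsupport (hR : 0 < R) (hRR : R ≤ K.R0) (hs : 0 < s) (hy : y ∈ closedBall (0:V) r) :
    tsupport (K.G R s y) ⊆ closedBall y (K.C * R) := by
  refine closure_minimal ?_ isClosed_closedBall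
  intro x hx
  by_contra h
  rw [mem_closedBall, dist_eq_norm, not_le] at h
  exact hx (K.G_zero hR hRR hs hy h.le)

theorem Ker.H_hcs (hR : 0 < R) (hRR : R ≤ K.R0) (hs : 0 < s) (hy : y ∈ closedBall (0:V) r) :
    HasCompactSupport (K.H R s y) := K.hcs K.H (K.H_zero hR hRR hs hy)

theorem Ker.H_contx (hR : 0 < R) (hRR : R ≤ K.R0) (hs : 0 < s) : Continuous (K.H R s y) :=
  (K.H_cont hR hRR hs).comp (continuous_const.prodMk continuous_id)

theorem Ker.E_eq (hR : 0 < R) (hRR : R ≤ K.R0) (hs : 0 < s) :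
    K.E R s y = fun x => S.L (K.G R s y) x + K.H R s y x := by
  funext x; rw [K.LG hR hRR hs]; ring

theorem Ker.G_two (hR : 0 < R) (hRR : R ≤ K.R0) (hs : 0 < s) : ContDiff ℝ 2 (K.G R s y) :=
  (K.G_smooth hR hRR hs).of_le (by norm_cast)

theorem Ker.E_cont (hR : 0 < R) (hRR : R ≤ K.R0) (hs : 0 < s) : Continuous (K.E R s y) := by
  rw [K.E_eq hR hRR hs]
  exact (L_cont S (K.G_two hR hRR hs)).add (K.H_contx hR hRR hs)

theorem Ker.E_hcs (hR : 0 < R) (hRR : R ≤ K.R0) (hs : 0 < s) (hy : y ∈ closedBall (0:V) r) :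
    HasCompactSupport (K.E R s y) := K.hcs K.E (K.E_zero hR hRR hs hy)

theorem Ker.H_int (hR : 0 < R) (hRR : R ≤ K.R0) (hs : 0 < s) (hy : y ∈ closedBall (0:V) r) :
    Integrable (K.H R s y) := (K.H_contx hR hRR hs).integrable_of_hasCompactSupport (K.H_hcs hR hRR hs hy)

theorem Ker.H_le_th (hR : 0 < R) (hRR : R ≤ K.R0) (hs : 0 < s) (hy : y ∈ closedBall (0:V) r) (x : V) :
    K.H R s y x ≤ K.C * th n s (x - y) := K.H_le hR hRR hs hy

theorem Ker.H_mass_le (hN : Fintype.card ι = 2 * n) : ∃ κ : ℝ, 0 < κ ∧ ∀ {R s y}, 0 < R → R ≤ K.R0 → 0 < s →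
    y ∈ closedBall (0:V) r → ∫ x, K.H R s y x ≤ κ ∧ ∫ x, K.H R s y x * ‖x - y‖ ≤ κ * √s := by
  obtain ⟨C, hC, hth⟩ := th_int (V := V) (finrank_eq_two S hN)
  have hCp := K.Cpos
  refine ⟨K.C * C, by positivity, fun {R s y} hR hRR hs hy => ?_⟩
  obtain ⟨i0, b0, i1, b1⟩ := hth s hs
  constructor
  · calc ∫ x, K.H R s y x ≤ ∫ x, K.C * th n s (x - y) :=
        integral_mono (K.H_int hR hRR hs hy) ((i0.comp_sub_right y).const_mul _) (K.H_le_th hR hRR hs hy)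
      _ = K.C * ∫ x : V, th n s x := by
        rw [integral_const_mul, integral_sub_right_eq_self (fun x : V => th n s x)]
      _ ≤ _ := by gcongr
  · calc ∫ x, K.H R s y x * ‖x - y‖ ≤ ∫ x, K.C * (‖x - y‖ * th n s (x - y)) := by
          refine integral_mono ?_ ((i1.comp_sub_right y).const_mul _) fun x => ?_
          · exact ((K.H_contx hR hRR hs).mul (by fun_prop)).integrable_of_hasCompactSupport
              (K.H_hcs hR hRR hs hy).mul_right
          · have := K.H_le_th hR hRR hs hy x
            calc K.H R s y x * ‖x - y‖ ≤ (K.C * th n s (x - y)) * ‖x - y‖ := by gcongr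
              _ = _ := by ring
      _ = K.C * ∫ x : V, ‖x‖ * th n s x := by
        rw [integral_const_mul, integral_sub_right_eq_self (fun x : V => ‖x‖ * th n s x)]
      _ ≤ K.C * (C * √s) := by gcongr
      _ = _ := by ring

theorem Ker.H_mass_ge (hN : Fintype.card ι = 2 * n) : ∃ κ : ℝ, 0 < κ ∧ ∀ {R s y}, 0 < R → R ≤ K.R0 → 0 < s →
    s ≤ K.m * R ^ 2 → y ∈ closedBall (0:V) r → κ ≤ ∫ x, K.H R s y x := by
  have hb : 0 < (volume : Measure V).real (closedBall (0:V) 1) :=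
    ENNReal.toReal_pos (measure_closedBall_pos _ _ one_pos).ne' measure_closedBall_lt_top.ne
  have hm := K.m_pos
  refine ⟨K.m * (volume : Measure V).real (closedBall (0:V) 1), by positivity, fun {R s y} hR hRR hs hsm hy => ?_⟩
  have h1 : ∫ x in closedBall y √s, K.m / s ^ n ≤ ∫ x in closedBall y √s, K.H R s y x := by
    refine setIntegral_mono_on (by simp [measure_closedBall_lt_top]) (K.H_int hR hRR hs hy).integrableOn
      measurableSet_closedBall fun x hx => ?_
    refine K.H_ge hR hRR hs hsm hy ?_
    rw [mem_closedBall, dist_eq_norm] at hx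
    calc ‖x - y‖ ^ 2 ≤ (√s) ^ 2 := by gcongr
      _ = s := Real.sq_sqrt hs.le
  have h2 := setIntegral_le_integral (K.H_int hR hRR hs hy) (s := closedBall y √s)
    (Eventually.of_forall fun x => K.H_nonneg hR hRR hs)
  refine le_trans ?_ (h1.trans h2)
  rw [setIntegral_const, Measure.addHaar_real_closedBall' _ _ (Real.sqrt_nonneg s), finrank_eq_two S hN,
    pow_mul, Real.sq_sqrt hs.le, smul_eq_mul]
  apply le_of_eq; field_simp
end

end kint

end APerron
end

open MeasureTheory Filter Topology Complex Metric

set_option linter.unusedSectionVars false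
set_option linter.unusedSimpArgs false
set_option linter.unusedVariables false

noncomputable section

namespace APerron

open Module

section regu

variable {V : Type*} [NormedAddCommGroup V] [NormedSpace ℝ V] [FiniteDimensional ℝ V]
  [MeasureSpace V] [BorelSpace V] [(volume : Measure V).IsAddHaarMeasure]
  {ι : Type*} [Fintype ι]

theorem conv_int {k f : V → ℝ} (hk : Integrable k) (hf : AEStronglyMeasurable f) {M : ℝ}
    (hM : ∀ x, |f x| ≤ M) (y : V) : Integrable (fun x => k (y - x) * f x) := by
  have h := (hk.comp_sub_left y).mul_bdd (c := M) hf (Eventually.of_forall hM)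
  exact h

theorem conv_cont {k f : V → ℝ} (hk : Integrable k) (hf : AEStronglyMeasurable f) {M : ℝ}
    (hM : ∀ x, |f x| ≤ M) : Continuous (fun y => ∫ x, k (y - x) * f x) := by
  rw [continuous_iff_continuousAt]
  intro y0
  have hM0 : 0 ≤ M := (abs_nonneg _).trans (hM 0)
  rw [ContinuousAt, tendsto_iff_edist_tendsto_0]
  have h1 : Tendsto (fun y : V => ENNReal.ofReal M * ∫⁻ x, ‖k (x - (y0 - y)) - k x‖ₑ) (𝓝 y0)
      (𝓝 (ENNReal.ofReal M * 0)) := by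
    refine ENNReal.Tendsto.const_mul ?_ (Or.inr ENNReal.ofReal_ne_top)
    have h2 : Tendsto (fun y : V => y0 - y) (𝓝 y0) (𝓝 0) := by
      have : Continuous (fun y : V => y0 - y) := by fun_prop
      simpa using this.tendsto y0
    exact (trans_cont hk).comp h2
  rw [mul_zero] at h1
  refine tendsto_of_tendsto_of_tendsto_of_le_of_le tendsto_const_nhds h1 (fun _ => zero_le) fun y => ?_
  dsimp only
  rw [edist_eq_enorm_sub, ← integral_sub (conv_int hk hf hM y) (conv_int hk hf hM y0)]
  refine (enorm_integral_le_lintegral_enorm _).trans ?_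
  have h3 : ∫⁻ x, ‖k (x - (y0 - y)) - k x‖ₑ = ∫⁻ x, ‖k (y - x) - k (y0 - x)‖ₑ := by
    rw [← lintegral_sub_left_eq_self (fun x => ‖k (x - (y0 - y)) - k x‖ₑ) y0]
    congr 1; funext x; congr 3; abel
  rw [h3, ← lintegral_const_mul' _ _ ENNReal.ofReal_ne_top]
  refine lintegral_mono fun x => ?_
  rw [← sub_mul, enorm_mul, mul_comm]
  gcongr
  rw [Real.enorm_eq_ofReal_abs]
  exact ENNReal.ofReal_le_ofReal (hM x)

variable {S : EF V ι} {n : ℕ} {r : ℝ} (K : Ker S n r)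

def Ker.kk (R : ℝ) (z : V) : ℝ :=
  hk n (K.C * R) z + (closedBall (0:V) (K.C * R)).indicator (fun _ => (R⁻¹) ^ (2 * n)) z

theorem Ker.E_le_kk {R s : ℝ} {y x : V} (hR : 0 < R) (hRR : R ≤ K.R0) (hs : 0 < s) (hy : y ∈ closedBall (0:V) r)
    (hx : x ≠ y) : K.E R s y x ≤ K.C * K.kk R (y - x) := by
  have hC := K.Cpos
  by_cases h : ‖x - y‖ < K.C * R
  · refine (K.E_le hR hRR hs hy hx).trans (le_of_eq ?_)
    unfold Ker.kk
    rw [norm_sub_rev] at h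
    rw [hk_eq h, Set.indicator_of_mem (by rw [mem_closedBall_zero_iff]; exact h.le), norm_sub_rev]
  · rw [K.E_zero hR hRR hs hy (not_lt.1 h)]
    unfold Ker.kk
    have h1 := hk_nonneg n (K.C * R) (y - x)
    have h2 : 0 ≤ (closedBall (0:V) (K.C * R)).indicator (fun _ => (R⁻¹) ^ (2 * n)) (y - x) :=
      Set.indicator_apply_nonneg fun _ => by positivity
    positivity

theorem Ker.kk_nonneg {R : ℝ} (hR : 0 < R) (z : V) : 0 ≤ K.kk R z := by
  unfold Ker.kk
  have h1 := hk_nonneg n (K.C * R) z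
  have h2 : 0 ≤ (closedBall (0:V) (K.C * R)).indicator (fun _ => (R⁻¹) ^ (2 * n)) z :=
      Set.indicator_apply_nonneg fun _ => by positivity
  positivity

theorem ind_int (ρ c : ℝ) : Integrable ((closedBall (0:V) ρ).indicator (fun _ => c)) := by
  rw [integrable_indicator_iff measurableSet_closedBall]
  exact integrableOn_const measure_closedBall_lt_top.ne

theorem Ker.kk_int (hn : 1 ≤ n) (hN : Fintype.card ι = 2 * n) {R : ℝ} (hR : 0 < R) : Integrable (K.kk R) := by
  obtain ⟨C, hC, h⟩ := hk_int (V := V) hn (finrank_eq_two S hN)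
  exact (h _ (mul_pos K.Cpos hR)).1.add (ind_int _ _)

theorem WSub.bdd_int {D : Set V} {u : V → ℝ} (hD : IsOpen D) (hb : Bornology.IsBounded D)
    (hu : LocallyIntegrableOn u D) {M : ℝ} (hM : ∀ x ∈ D, |u x| ≤ M) : Integrable (D.indicator u) := by
  rw [integrable_indicator_iff hD.measurableSet]
  refine Integrable.mono' (g := fun _ => M) (integrableOn_const hb.measure_lt_top.ne) hu.aestronglyMeasurable ?_
  exact (ae_restrict_mem hD.measurableSet).mono fun x hx => hM x hx

theorem Ker.sub_test (hn : 1 ≤ n) (hN : Fintype.card ι = 2 * n) {D : Set V} {u : V → ℝ} (hD : IsOpen D) (hDr : D ⊆ closedBall 0 r)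
    (hu : WSub S D u) {M : ℝ} (hM : ∀ x ∈ D, |u x| ≤ M) {R s : ℝ} (hR : 0 < R) (hRR : R ≤ K.R0) (hs : 0 < s)
    {y : V} (hy : closedBall y (K.C * R) ⊆ D) (q : ℝ) :
    ∫ x, K.H R s y x * D.indicator (fun x => u x - q) x ≤
      K.C * ∫ x, K.kk R (y - x) * D.indicator (fun x => |u x - q|) x := by
  have hC := K.Cpos
  have hyr : y ∈ closedBall (0:V) r := hDr (hy (mem_closedBall_self (by positivity)))
  have hw : WSub S D (fun x => u x + -q) := WSub.add S hu (WSub.const S D (-q))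
  have h0 := hw.2 (K.G R s y) (K.G_smooth hR hRR hs) (K.G_hcs hR hRR hs hyr)
    ((K.G_tsupport hR hRR hs hyr).trans hy) (fun z => K.G_nonneg hR hRR hs)
  have tsH : tsupport (K.H R s y) ⊆ D := by
    refine (closure_minimal ?_ isClosed_closedBall).trans hy
    intro x hx
    by_contra h
    rw [mem_closedBall, dist_eq_norm, not_le] at h
    exact hx (K.H_zero hR hRR hs hyr h.le)
  have tsE : tsupport (K.E R s y) ⊆ D := by
    refine (closure_minimal ?_ isClosed_closedBall).trans hy
    intro x hx
    by_contra h
    rw [mem_closedBall, dist_eq_norm, not_le] at h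
    exact hx (K.E_zero hR hRR hs hyr h.le)
  have iH := WSub.int_mul hw.1 (K.H_contx (y := y) hR hRR hs) (K.H_hcs hR hRR hs hyr) tsH
  have iE := WSub.int_mul hw.1 (K.E_cont (y := y) hR hRR hs) (K.E_hcs hR hRR hs hyr) tsE
  have h1 : ∫ x, (u x + -q) * S.L (K.G R s y) x = (∫ x, (u x + -q) * K.E R s y x) - ∫ x, (u x + -q) * K.H R s y x := by
    rw [← integral_sub iE iH]
    congr 1; funext x; rw [K.LG hR hRR hs]; ring
  have h2 : ∫ x, K.H R s y x * D.indicator (fun x => u x - q) x = ∫ x, (u x + -q) * K.H R s y x := by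
    congr 1; funext x
    by_cases hx : x ∈ D
    · rw [Set.indicator_of_mem hx]; ring
    · rw [Set.indicator_of_notMem hx, show K.H R s y x = 0 from image_eq_zero_of_notMem_tsupport fun h => hx (tsH h)]; ring
  rw [h2]
  have h3 : ∫ x, (u x + -q) * K.E R s y x ≤ K.C * ∫ x, K.kk R (y - x) * D.indicator (fun x => |u x - q|) x := by
    rw [← integral_const_mul]
    have hnt : Nontrivial V := by
      apply Module.nontrivial_of_finrank_pos (R := ℝ); rw [finrank_eq_two S hN]; omega
    have hl : LocallyIntegrableOn (fun x => |u x - q|) D := by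
      have := hw.1.norm
      simpa only [Real.norm_eq_abs, ← sub_eq_add_neg] using this
    have hb : Bornology.IsBounded D := isBounded_closedBall.subset hDr
    have hi : Integrable (D.indicator (fun x => |u x - q|)) :=
      WSub.bdd_int hD hb hl (M := M + |q|) fun x hx => by
        rw [abs_abs]; exact (abs_sub _ _).trans (by gcongr; exact hM x hx)
    have hM0 : 0 ≤ M := (abs_nonneg _).trans (hM y (hy (mem_closedBall_self (by positivity))))
    have hbd : ∀ x, |D.indicator (fun x => |u x - q|) x| ≤ M + |q| := by
      intro x
      by_cases hx : x ∈ D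
      · rw [Set.indicator_of_mem hx, abs_abs]; exact (abs_sub _ _).trans (by gcongr; exact hM x hx)
      · rw [Set.indicator_of_notMem hx, abs_zero]; positivity
    refine integral_mono_ae iE ((conv_int (K.kk_int hn hN hR) hi.aestronglyMeasurable hbd y).const_mul _) ?_
    have hne : ∀ᵐ x : V, x ≠ y := by simp [ae_iff, measure_singleton]
    filter_upwards [hne] with x hx
    by_cases hxD : x ∈ D
    · rw [Set.indicator_of_mem hxD]
      have e1 := K.E_le_kk hR hRR hs hyr hx
      have e0 := K.E_nonneg hR hRR hs hyr (x := x)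
      calc (u x + -q) * K.E R s y x ≤ |u x - q| * K.E R s y x := by
            rw [← sub_eq_add_neg]; gcongr; exact le_abs_self _
        _ ≤ |u x - q| * (K.C * K.kk R (y - x)) := by gcongr
        _ = _ := by ring
    · rw [Set.indicator_of_notMem hxD, show K.E R s y x = 0 from image_eq_zero_of_notMem_tsupport fun h => hxD (tsE h)]
      simp
  linarith

end regu

end APerron
end

open MeasureTheory Filter Topology Complex Metric

set_option linter.unusedSectionVars false
set_option linter.unusedSimpArgs false
set_option linter.unusedVariables false

noncomputable section

namespace APerron

open Module

section regu

variable {V : Type*} [NormedAddCommGroup V] [NormedSpace ℝ V] [FiniteDimensional ℝ V]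
  [MeasureSpace V] [BorelSpace V] [(volume : Measure V).IsAddHaarMeasure]
  {ι : Type*} [Fintype ι]
variable {S : EF V ι} {n : ℕ} {r : ℝ} (K : Ker S n r)

theorem Ker.AKH (hN : Fintype.card ι = 2 * n) {f : V → ℝ} (hf : Integrable f) {B : Set V} (hB : MeasurableSet B)
    (hBr : B ⊆ closedBall 0 r) {R : ℝ} (hR : 0 < R) (hRR : R ≤ K.R0) {s : ℕ → ℝ} (hs : ∀ m, 0 < s m)
    (hs0 : Tendsto s atTop (𝓝 0)) :
    Tendsto (fun m => ∫⁻ x in B, ‖(∫ y, K.H R (s m) x y * f y) - (∫ y, K.H R (s m) x y) * f x‖ₑ) atTop (𝓝 0) := by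
  obtain ⟨C, hC, hth⟩ := th_int (V := V) (finrank_eq_two S hN)
  have hKC := K.Cpos
  refine AK (k := fun m => K.H R (s m)) (M := fun m x => ∫ y, K.H R (s m) x y)
    (Θ := fun m z => ENNReal.ofReal (K.C * th n (s m) z)) (C := ENNReal.ofReal (K.C * C)) hf hB ?_ ENNReal.ofReal_ne_top ?_ ?_ ?_ ?_ ?_
  · intro m
    exact (ENNReal.continuous_ofReal.comp (continuous_const.mul (th_cont (hs m)))).measurable
  · intro m
    obtain ⟨i0, b0, i1, b1⟩ := hth (s m) (hs m)
    rw [← ofReal_integral_eq_lintegral_ofReal (i0.const_mul _)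
      (Eventually.of_forall fun z => mul_nonneg hKC.le (th_nonneg (hs m) z)), integral_const_mul]
    apply ENNReal.ofReal_le_ofReal; gcongr
  · intro ρ hρ
    have hlim : Tendsto (fun m => ENNReal.ofReal (K.C / ρ * (C * √(s m)))) atTop (𝓝 0) := by
      have : Tendsto (fun m => K.C / ρ * (C * √(s m))) atTop (𝓝 (K.C / ρ * (C * √0))) :=
        ((((Real.continuous_sqrt.tendsto 0).comp hs0).const_mul C).const_mul _)
      have h2 := ENNReal.tendsto_ofReal this
      simpa using h2
    refine tendsto_of_tendsto_of_tendsto_of_le_of_le tendsto_const_nhds hlim (fun _ => zero_le) fun m => ?_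
    obtain ⟨i0, b0, i1, b1⟩ := hth (s m) (hs m)
    dsimp only
    calc ∫⁻ z in {z : V | ρ ≤ ‖z‖}, ENNReal.ofReal (K.C * th n (s m) z)
        ≤ ∫⁻ z in {z : V | ρ ≤ ‖z‖}, ENNReal.ofReal (K.C / ρ * (‖z‖ * th n (s m) z)) := by
          refine setLIntegral_mono' (measurableSet_le measurable_const measurable_norm) fun z hz => ?_
          apply ENNReal.ofReal_le_ofReal
          have h0 := th_nonneg (n := n) (hs m) z
          have hz' : ρ ≤ ‖z‖ := hz
          calc K.C * th n (s m) z = K.C / ρ * (ρ * th n (s m) z) := by field_simp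
            _ ≤ _ := by gcongr
      _ ≤ ∫⁻ z : V, ENNReal.ofReal (K.C / ρ * (‖z‖ * th n (s m) z)) := setLIntegral_le_lintegral _ _
      _ = ENNReal.ofReal (∫ z : V, K.C / ρ * (‖z‖ * th n (s m) z)) := by
          rw [ofReal_integral_eq_lintegral_ofReal (i1.const_mul _)]
          exact Eventually.of_forall fun z => by
            have h0 := th_nonneg (n := n) (hs m) z
            dsimp only [Pi.zero_apply]; positivity
      _ ≤ _ := by
          rw [integral_const_mul]
          apply ENNReal.ofReal_le_ofReal; gcongr
  · intro m x hx
    exact (K.H_contx hR hRR (hs m)).aestronglyMeasurable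
  · refine Eventually.of_forall fun m x hx y => ?_
    rw [Real.enorm_eq_ofReal_abs, abs_of_nonneg (K.H_nonneg hR hRR (hs m))]
    apply ENNReal.ofReal_le_ofReal
    have := K.H_le_th hR hRR (hs m) (hBr hx) y
    refine this.trans (le_of_eq ?_)
    unfold th; rw [norm_sub_rev]
  · exact Eventually.of_forall fun m x hx => rfl

theorem Ker.ae_bound (hn : 1 ≤ n) (hN : Fintype.card ι = 2 * n) {D : Set V} (hD : IsOpen D)
    (hDr : D ⊆ closedBall 0 r) : ∃ κ : ℝ, 0 < κ ∧ ∀ {u : V → ℝ}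
    (hu : WSub S D u) {M : ℝ} (hM : ∀ x ∈ D, |u x| ≤ M) {R : ℝ} (hR : 0 < R) (hRR : R ≤ K.R0) (q : ℝ),
    ∀ᵐ y, y ∈ (thickening (2 * (K.C * R)) Dᶜ)ᶜ →
      κ * (u y - q) ≤ K.C * ∫ x, K.kk R (y - x) * D.indicator (fun x => |u x - q|) x := by
  obtain ⟨κ, hκ, hge⟩ := K.H_mass_ge hN
  refine ⟨κ, hκ, fun {u} hu {M} hM {R} hR hRR q => ?_⟩
  have hKC := K.Cpos
  have hm := K.m_pos
  set B : Set V := (thickening (2 * (K.C * R)) Dᶜ)ᶜ with hB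
  have hBD : ∀ y ∈ B, closedBall y (K.C * R) ⊆ D := by
    intro y hy z hz
    by_contra hzD
    apply hy
    rw [mem_thickening_iff]
    refine ⟨z, hzD, ?_⟩
    rw [mem_closedBall, dist_comm] at hz
    have : 0 < K.C * R := by positivity
    linarith
  have hBm : MeasurableSet B := isOpen_thickening.isClosed_compl.measurableSet
  have hBD' : B ⊆ D := fun y hy => hBD y hy (mem_closedBall_self (by positivity))
  have hb : Bornology.IsBounded D := isBounded_closedBall.subset hDr
  have hl : LocallyIntegrableOn (fun x => u x - q) D := by
    have := (WSub.add S hu (WSub.const S D (-q))).1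
    simpa only [← sub_eq_add_neg] using this
  have hi : Integrable (D.indicator (fun x => u x - q)) :=
    WSub.bdd_int hD hb hl (M := M + |q|) fun x hx => by
        exact (abs_sub _ _).trans (by gcongr; exact hM x hx)
  set s : ℕ → ℝ := fun k => K.m * R ^ 2 * (1 / ((k : ℝ) + 1)) with hsdef
  have hs : ∀ k, 0 < s k := fun k => by simp only [hsdef]; positivity
  have hsm : ∀ k, s k ≤ K.m * R ^ 2 := fun k => by
    simp only [hsdef]
    apply mul_le_of_le_one_right (by positivity)
    rw [div_le_one (by positivity)]; linarith [Nat.cast_nonneg (α := ℝ) k]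
  have hs0 : Tendsto s atTop (𝓝 0) := by
    have := (tendsto_one_div_add_atTop_nhds_zero_nat (𝕜 := ℝ)).const_mul (K.m * R ^ 2)
    rw [mul_zero] at this; exact this
  have hAK := K.AKH hN hi hBm (hBD'.trans hDr) hR hRR hs hs0
  set g : V → ℝ := fun y => ∫ x, K.kk R (y - x) * D.indicator (fun x => |u x - q|) x with hg
  have hg0 : ∀ y, 0 ≤ g y := fun y => integral_nonneg fun x =>
    mul_nonneg (K.kk_nonneg hR _) (Set.indicator_apply_nonneg fun _ => abs_nonneg _)
  have hgc : Continuous g := by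
    have hi' : Integrable (D.indicator (fun x => |u x - q|)) := by
      have := hi.abs
      refine this.congr (Eventually.of_forall fun x => ?_)
      by_cases hx : x ∈ D
      · simp [Set.indicator_of_mem hx]
      · simp [Set.indicator_of_notMem hx]
    have hbd : ∀ x, |D.indicator (fun x => |u x - q|) x| ≤ |M| + |q| := by
      intro x
      by_cases hx : x ∈ D
      · rw [Set.indicator_of_mem hx, abs_abs]; exact (abs_sub _ _).trans (add_le_add ((hM x hx).trans (le_abs_self _)) le_rfl)
      · rw [Set.indicator_of_notMem hx, abs_zero]; positivity
    exact conv_cont (K.kk_int hn hN hR) hi'.aestronglyMeasurable hbd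
  have key : ∀ k, ∀ y ∈ B, ENNReal.ofReal (κ * D.indicator (fun x => u x - q) y - K.C * g y) ≤
      ‖(∫ x, K.H R (s k) y x * D.indicator (fun x => u x - q) x) - (∫ x, K.H R (s k) y x) * D.indicator (fun x => u x - q) y‖ₑ := by
    intro k y hy
    rw [Real.enorm_eq_ofReal_abs]
    apply ENNReal.ofReal_le_ofReal
    have h1 := K.sub_test hn hN hD hDr hu hM hR hRR (hs k) (hBD y hy) q
    have h2 := hge hR hRR (hs k) (hsm k) (hDr (hBD' hy))
    have h3 := hg0 y
    by_cases hp : 0 ≤ D.indicator (fun x => u x - q) y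
    · rw [abs_sub_comm]
      refine le_trans ?_ (le_abs_self _)
      have := mul_le_mul_of_nonneg_right h2 hp
      simp only [hg]; linarith
    · refine le_trans ?_ (abs_nonneg _)
      have h4 := mul_nonneg hKC.le h3
      have h5 := mul_neg_of_pos_of_neg hκ (not_le.1 hp)
      linarith
  have hz : ∫⁻ y in B, ENNReal.ofReal (κ * D.indicator (fun x => u x - q) y - K.C * g y) = 0 := by
    refine le_antisymm (ge_of_tendsto' hAK fun k => ?_) zero_le
    exact setLIntegral_mono' hBm (key k)
  rw [lintegral_eq_zero_iff' (by
    have h6 : AEMeasurable (D.indicator (fun x => u x - q)) := hi.aestronglyMeasurable.aemeasurable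
    exact (((h6.const_mul κ).sub (hgc.measurable.aemeasurable.const_mul K.C)).ennreal_ofReal).restrict)] at hz
  rw [Filter.EventuallyEq, ae_restrict_iff' hBm] at hz
  filter_upwards [hz] with y hy hyB
  have h7 := hy hyB
  simp only [Pi.zero_apply, ENNReal.ofReal_eq_zero] at h7
  rw [Set.indicator_of_mem (hBD' hyB)] at h7
  linarith

/-- a.e. essential upper semicontinuity of bounded weak subsolutions -/
theorem Ker.ess_usc (K : Ker S n r) (hn : 1 ≤ n) (hN : Fintype.card ι = 2 * n) {D : Set V} (hD : IsOpen D)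
    (hDr : D ⊆ closedBall 0 r) {u : V → ℝ} (hu : WSub S D u) {M : ℝ} (hM : ∀ x ∈ D, |u x| ≤ M) :
    ∀ᵐ y, y ∈ D → ∀ c, u y < c → ∀ᶠ x in 𝓝 y ⊓ ae volume, u x < c := by
  obtain ⟨κ, hκ, hae⟩ := K.ae_bound hn hN hD hDr
  have hKC := K.Cpos
  have hR0 := K.R0_pos
  have hb : Bornology.IsBounded D := isBounded_closedBall.subset hDr
  have hnt : Nontrivial V := by
      apply Module.nontrivial_of_finrank_pos (R := ℝ); rw [finrank_eq_two S hN]; omega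
  obtain ⟨Ch, hCh, hhk⟩ := hk_int (V := V) hn (finrank_eq_two S hN)
  set R : ℕ → ℝ := fun j => K.R0 * (1 / ((j : ℝ) + 1)) with hRdef
  have hR : ∀ j, 0 < R j := fun j => by simp only [hRdef]; positivity
  have hRR : ∀ j, R j ≤ K.R0 := fun j => by
    simp only [hRdef]
    apply mul_le_of_le_one_right (by positivity)
    rw [div_le_one (by positivity)]; linarith [Nat.cast_nonneg (α := ℝ) j]
  have hRl : Tendsto R atTop (𝓝 0) := by
    have := (tendsto_one_div_add_atTop_nhds_zero_nat (𝕜 := ℝ)).const_mul K.R0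
    rw [mul_zero] at this; exact this
  have hI : Integrable (D.indicator u) := WSub.bdd_int hD hb hu.1 hM
  have hall : ∀ᵐ y, ∀ j : ℕ, ∀ q : ℚ, y ∈ (thickening (2 * (K.C * R j)) Dᶜ)ᶜ →
      κ * (u y - q) ≤ K.C * ∫ x, K.kk (R j) (y - x) * D.indicator (fun x => |u x - q|) x := by
    rw [ae_all_iff]; intro j; rw [ae_all_iff]; intro q
    exact hae hu hM (hR j) (hRR j) q
  have hleb := IsUnifLocDoublingMeasure.ae_tendsto_average_norm_sub (volume : Measure V) hI.locallyIntegrable 1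
  filter_upwards [hleb] with y hy hyD c hc
  have hδ : Tendsto (fun j => K.C * R j) atTop (𝓝[>] 0) := by
    rw [tendsto_nhdsWithin_iff]
    refine ⟨by simpa using hRl.const_mul K.C, Eventually.of_forall fun j => ?_⟩
    have := hR j
    exact mul_pos hKC this
  have hy1 := hy (l := atTop) (fun _ : ℕ => y) (fun j => K.C * R j) hδ
    (Eventually.of_forall fun j => mem_closedBall_self (by have := hR j; positivity))
  clear hy
  set A : ℕ → ℝ := fun j => ⨍ x in closedBall y (K.C * R j), ‖D.indicator u x - D.indicator u y‖ with hA
  set v1 : ℝ := (volume : Measure V).real (closedBall (0:V) 1) with hv1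
  have hv1p : 0 ≤ v1 := measureReal_nonneg
  -- choose q
  set T : ℝ := K.C / κ * (K.C ^ (2 * n) * v1) with hT
  have hT0 : 0 ≤ T := by positivity
  set ε : ℝ := (c - u y) / (2 * (1 + T)) with hε
  have hεp : 0 < ε := by rw [hε]; apply div_pos <;> linarith
  have hε2 : ε * (1 + T) < c - u y := by
    have : ε * (1 + T) = (c - u y) / 2 := by rw [hε]; field_simp
    linarith
  obtain ⟨q, hq1, hq2⟩ := exists_rat_btwn (show u y < u y + ε by linarith)
  -- bound for the convolution at y
  have hMq : ∀ x ∈ D, |u x - q| ≤ M + |(q:ℝ)| := fun x hx => (abs_sub _ _).trans (by gcongr; exact hM x hx)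
  have hM0 : 0 ≤ M := (abs_nonneg _).trans (hM y hyD)
  set F : V → ℝ := D.indicator (fun x => |u x - q|) with hF
  have hFi : Integrable F := by
    have hl : LocallyIntegrableOn (fun x => |u x - q|) D := by
      have := (WSub.add S hu (WSub.const S D (-(q:ℝ)))).1.norm
      simpa only [Real.norm_eq_abs, ← sub_eq_add_neg] using this
    exact WSub.bdd_int hD hb hl (M := M + |(q:ℝ)|) fun x hx => by rw [abs_abs]; exact hMq x hx
  have hFb : ∀ x, |F x| ≤ M + |(q:ℝ)| := by
      intro x
      by_cases hx : x ∈ D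
      · rw [hF, Set.indicator_of_mem hx, abs_abs]; exact hMq x hx
      · rw [hF, Set.indicator_of_notMem hx, abs_zero]; positivity
  have hF0 : ∀ x, 0 ≤ F x := fun x => Set.indicator_apply_nonneg fun _ => abs_nonneg _
  have hbound : ∀ᶠ j in atTop, ∫ x, K.kk (R j) (y - x) * F x ≤
      (M + |(q:ℝ)|) * (Ch * (K.C * R j)) + (K.C ^ (2 * n) * v1) * (A j + ε) := by
    refine Eventually.of_forall fun j => ?_
    have hRj := hR j
    obtain ⟨ih, bh⟩ := hhk (K.C * R j) (by positivity)
    have e1 : ∫ x, K.kk (R j) (y - x) * F x = (∫ x, hk n (K.C * R j) (y - x) * F x) +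
        ∫ x, (closedBall (0:V) (K.C * R j)).indicator (fun _ => ((R j)⁻¹) ^ (2 * n)) (y - x) * F x := by
      rw [← integral_add (conv_int ih hFi.aestronglyMeasurable hFb y) (conv_int (ind_int _ _) hFi.aestronglyMeasurable hFb y)]
      congr 1; funext x; unfold Ker.kk; ring
    rw [e1]
    apply add_le_add
    · calc ∫ x, hk n (K.C * R j) (y - x) * F x ≤ ∫ x, (M + |(q:ℝ)|) * hk n (K.C * R j) (y - x) := by
            refine integral_mono (conv_int ih hFi.aestronglyMeasurable hFb y) ((ih.comp_sub_left y).const_mul _) fun x => ?_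
            have h1 := hk_nonneg n (K.C * R j) (y - x)
            have h2 := (le_abs_self _).trans (hFb x)
            dsimp only
            rw [mul_comm]; gcongr
        _ = (M + |(q:ℝ)|) * ∫ x : V, hk n (K.C * R j) x := by
            rw [integral_const_mul, integral_sub_left_eq_self (fun x : V => hk n (K.C * R j) x)]
        _ ≤ _ := by gcongr
    · have hvol : (volume : Measure V).real (closedBall y (K.C * R j)) = (K.C * R j) ^ (2 * n) * v1 := by
        rw [Measure.addHaar_real_closedBall' _ _ (by positivity), finrank_eq_two S hN]
      have hvp : 0 < (volume : Measure V).real (closedBall y (K.C * R j)) :=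
        ENNReal.toReal_pos (measure_closedBall_pos _ _ (by positivity)).ne' measure_closedBall_lt_top.ne
      have e2 : ∀ x, (closedBall (0:V) (K.C * R j)).indicator (fun _ => ((R j)⁻¹) ^ (2 * n)) (y - x) * F x =
          (closedBall y (K.C * R j)).indicator (fun x => ((R j)⁻¹) ^ (2 * n) * F x) x := by
        intro x
        by_cases hx : x ∈ closedBall y (K.C * R j)
        · rw [Set.indicator_of_mem hx, Set.indicator_of_mem]
          rw [mem_closedBall, dist_eq_norm, norm_sub_rev] at hx
          rwa [mem_closedBall_zero_iff]
        · rw [Set.indicator_of_notMem hx, Set.indicator_of_notMem, zero_mul]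
          rw [mem_closedBall, dist_eq_norm, norm_sub_rev] at hx
          rwa [mem_closedBall_zero_iff]
      simp_rw [e2]
      rw [integral_indicator measurableSet_closedBall, integral_const_mul]
      have iA : IntegrableOn (fun x => ‖D.indicator u x - D.indicator u y‖) (closedBall y (K.C * R j)) :=
        (hI.integrableOn.sub (integrableOn_const measure_closedBall_lt_top.ne)).norm
      have e3 : ∫ x in closedBall y (K.C * R j), F x ≤
          ∫ x in closedBall y (K.C * R j), (‖D.indicator u x - D.indicator u y‖ + ε) := by
        refine integral_mono hFi.integrableOn (iA.add (integrableOn_const measure_closedBall_lt_top.ne)) fun x => ?_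
        dsimp only
        by_cases hx : x ∈ D
        · rw [hF, Set.indicator_of_mem hx, Set.indicator_of_mem hx, Set.indicator_of_mem hyD, Real.norm_eq_abs]
          calc |u x - q| ≤ |u x - u y| + |u y - q| := abs_sub_le _ _ _
            _ ≤ _ := by gcongr; rw [abs_le]; constructor <;> linarith
        · rw [hF, Set.indicator_of_notMem hx]; positivity
      have e4 : ∫ x in closedBall y (K.C * R j), (‖D.indicator u x - D.indicator u y‖ + ε) =
          (K.C * R j) ^ (2 * n) * v1 * (A j + ε) := by
        have hAj : A j = ((volume : Measure V).real (closedBall y (K.C * R j)))⁻¹ *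
            ∫ x in closedBall y (K.C * R j), ‖D.indicator u x - D.indicator u y‖ := by
          simp only [hA]; rw [setAverage_eq, smul_eq_mul]
        rw [integral_add iA (integrableOn_const measure_closedBall_lt_top.ne), setIntegral_const, hAj, ← hvol, smul_eq_mul,
          mul_add, mul_inv_cancel_left₀ hvp.ne']
      calc ((R j)⁻¹) ^ (2 * n) * ∫ x in closedBall y (K.C * R j), F x
          ≤ ((R j)⁻¹) ^ (2 * n) * ((K.C * R j) ^ (2 * n) * v1 * (A j + ε)) := by
            rw [← e4]; gcongr
        _ = _ := by rw [mul_pow, inv_pow]; field_simp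
  have hlim : Tendsto (fun j => (q : ℝ) + K.C / κ * ((M + |(q:ℝ)|) * (Ch * (K.C * R j)) + (K.C ^ (2 * n) * v1) * (A j + ε)))
      atTop (𝓝 ((q : ℝ) + K.C / κ * ((M + |(q:ℝ)|) * (Ch * (K.C * 0)) + (K.C ^ (2 * n) * v1) * (0 + ε)))) := by
    refine tendsto_const_nhds.add (Tendsto.const_mul _ (Tendsto.add ?_ ?_))
    · exact ((hRl.const_mul _).const_mul _).const_mul _
    · exact (hy1.add_const _).const_mul _
  have hlt : (q : ℝ) + K.C / κ * ((M + |(q:ℝ)|) * (Ch * (K.C * 0)) + (K.C ^ (2 * n) * v1) * (0 + ε)) < c := by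
    have : K.C / κ * ((M + |(q:ℝ)|) * (Ch * (K.C * 0)) + (K.C ^ (2 * n) * v1) * (0 + ε)) = T * ε := by rw [hT]; ring
    rw [this]; nlinarith
  have hball : ∀ᶠ j in atTop, ball y (4 * (K.C * R j)) ⊆ D := by
    obtain ⟨δ, hδp, hδ'⟩ := Metric.isOpen_iff.1 hD y hyD
    have h4 : Tendsto (fun j => 4 * (K.C * R j)) atTop (𝓝 (4 * (K.C * 0))) := (hRl.const_mul _).const_mul _
    have := h4.eventually_lt_const (show 4 * (K.C * 0) < δ by simpa using hδp)
    filter_upwards [this] with j hj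
    exact (ball_subset_ball hj.le).trans hδ'
  obtain ⟨j, hj1, hj2, hj3⟩ := (hbound.and ((hlim.eventually_lt_const hlt).and hball)).exists
  have hRj := hR j
  have hgc : Continuous (fun y => (q:ℝ) + K.C / κ * ∫ x, K.kk (R j) (y - x) * F x) := by
    have := conv_cont (K.kk_int hn hN (hR j)) hFi.aestronglyMeasurable hFb
    fun_prop
  have hev : ∀ᶠ z in 𝓝 y, (q:ℝ) + K.C / κ * ∫ x, K.kk (R j) (z - x) * F x < c := by
    refine (hgc.tendsto y).eventually_lt_const (lt_of_le_of_lt ?_ hj2)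
    gcongr
  have hnear : ∀ᶠ z in 𝓝 y, z ∈ (thickening (2 * (K.C * R j)) Dᶜ)ᶜ := by
    filter_upwards [ball_mem_nhds y (show 0 < 2 * (K.C * R j) by positivity)] with z hz hz'
    rw [mem_thickening_iff] at hz'
    obtain ⟨w, hw, hzw⟩ := hz'
    apply hw
    apply hj3
    rw [mem_ball] at hz ⊢
    rw [dist_comm] at hzw
    linarith [dist_triangle w z y]
  filter_upwards [hev.filter_mono inf_le_left, hnear.filter_mono inf_le_left, hall.filter_mono inf_le_right] with z h1 h2 h3
  have h4 := h3 j q h2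
  refine lt_of_le_of_lt ?_ h1
  rw [div_mul_eq_mul_div]
  have h5 : u z - q ≤ K.C * (∫ x, K.kk (R j) (z - x) * F x) / κ := by
    rw [le_div_iff₀ hκ, mul_comm]; exact h4
  linarith

end regu

end APerron
end

open MeasureTheory Filter Topology Complex Metric

set_option linter.unusedSectionVars false
set_option linter.unusedSimpArgs false
set_option linter.unusedVariables false

noncomputable section

namespace APerron

open Module

section ess

variable {V : Type*} [NormedAddCommGroup V] [NormedSpace ℝ V] [FiniteDimensional ℝ V]
  [MeasureSpace V] [BorelSpace V] [(volume : Measure V).IsAddHaarMeasure]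
  {ι : Type*} [Fintype ι]

theorem nae_neBot (y : V) : (𝓝 y ⊓ ae (volume : Measure V)).NeBot := by
  rw [inf_neBot_iff]
  intro s hs s' hs'
  by_contra h
  rw [Set.not_nonempty_iff_eq_empty] at h
  have h1 : s ⊆ s'ᶜ := by
    intro x hx hx'
    have : x ∈ s ∩ s' := ⟨hx, hx'⟩
    rw [h] at this; exact this
  have h2 : volume s = 0 := measure_mono_null h1 (mem_ae_iff.1 hs')
  exact (Measure.measure_pos_of_mem_nhds volume hs).ne' h2

/-- strong upper semicontinuity, in terms of real inequalities -/
def SU (D : Set V) (v : V → ℝ) : Prop :=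
  ∀ y ∈ D, (∀ c, v y < c → ∀ᶠ x in 𝓝 y, v x < c) ∧ (∀ c, c < v y → ∃ᶠ x in 𝓝 y ⊓ ae volume, c < v x)

def ess (u : V → ℝ) (y : V) : ℝ := limsup u (𝓝 y ⊓ ae volume)

theorem ae_nae {P : V → Prop} (D : Set V) (hD : IsOpen D) (h : ∀ᵐ x, x ∈ D → P x) {y : V} (hy : y ∈ D) :
    ∀ᶠ x in 𝓝 y ⊓ ae volume, P x := by
  filter_upwards [Filter.Eventually.filter_mono (inf_le_left : 𝓝 y ⊓ ae volume ≤ 𝓝 y) (hD.mem_nhds hy),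
    h.filter_mono inf_le_right] with x hx h'
  exact h' hx

section bd
variable {D : Set V} (hD : IsOpen D) {u : V → ℝ} {M : ℝ} (hM : ∀ x ∈ D, |u x| ≤ M) {y : V} (hy : y ∈ D) {c : ℝ}

theorem ev_bd (hD : IsOpen D) (hM : ∀ x ∈ D, |u x| ≤ M) (hy : y ∈ D) :
    ∀ᶠ x in 𝓝 y ⊓ ae volume, |u x| ≤ M := ae_nae D hD (Eventually.of_forall hM) hy

theorem ess_bdd (hD : IsOpen D) (hM : ∀ x ∈ D, |u x| ≤ M) (hy : y ∈ D) :
    IsBoundedUnder (· ≤ ·) (𝓝 y ⊓ ae volume) u :=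
  ⟨M, by rw [eventually_map]; exact (ev_bd hD hM hy).mono fun x hx => (le_abs_self _).trans hx⟩

theorem ess_cobdd (hD : IsOpen D) (hM : ∀ x ∈ D, |u x| ≤ M) (hy : y ∈ D) :
    IsCoboundedUnder (· ≤ ·) (𝓝 y ⊓ ae volume) u := by
  have := nae_neBot y
  refine IsBoundedUnder.isCoboundedUnder_le ⟨-M, ?_⟩
  rw [eventually_map]
  exact (ev_bd hD hM hy).mono fun x hx => (abs_le.1 hx).1

theorem ess_lt (hD : IsOpen D) (hM : ∀ x ∈ D, |u x| ≤ M) (hy : y ∈ D) (h : ess u y < c) :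
    ∀ᶠ x in 𝓝 y ⊓ ae volume, u x < c :=
  eventually_lt_of_limsup_lt h (ess_bdd hD hM hy)

theorem lt_ess (hD : IsOpen D) (hM : ∀ x ∈ D, |u x| ≤ M) (hy : y ∈ D) (h : c < ess u y) :
    ∃ᶠ x in 𝓝 y ⊓ ae volume, c < u x :=
  frequently_lt_of_lt_limsup (ess_cobdd hD hM hy) h

theorem ess_le (hD : IsOpen D) (hM : ∀ x ∈ D, |u x| ≤ M) (hy : y ∈ D)
    (h : ∀ᶠ x in 𝓝 y ⊓ ae volume, u x ≤ c) : ess u y ≤ c :=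
  limsup_le_of_le (ess_cobdd hD hM hy) h

theorem le_ess (hD : IsOpen D) (hM : ∀ x ∈ D, |u x| ≤ M) (hy : y ∈ D)
    (h : ∃ᶠ x in 𝓝 y ⊓ ae volume, c ≤ u x) : c ≤ ess u y :=
  le_limsup_of_frequently_le h (ess_bdd hD hM hy)

theorem ess_abs (hD : IsOpen D) (hM : ∀ x ∈ D, |u x| ≤ M) (hy : y ∈ D) : |ess u y| ≤ M := by
  have := nae_neBot y
  rw [abs_le]
  exact ⟨le_ess hD hM hy ((ev_bd hD hM hy).mono fun x hx => (abs_le.1 hx).1).frequently,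
    ess_le hD hM hy ((ev_bd hD hM hy).mono fun x hx => (abs_le.1 hx).2)⟩

/-- if `u ≤ v` a.e. on `D` and `u` is strongly usc, then `u ≤ ess v`. -/
theorem SU.le_ess' {v : V → ℝ} (hu : SU D v) (hD : IsOpen D) (hM : ∀ x ∈ D, |u x| ≤ M) (hy : y ∈ D)
    (h : ∀ᵐ x, x ∈ D → v x ≤ u x) : v y ≤ ess u y := by
  by_contra hlt
  rw [not_le] at hlt
  obtain ⟨c, h1, h2⟩ := exists_between hlt
  have h3 := (hu y hy).2 c h2
  obtain ⟨x, hx1, hx2, hx3⟩ := (h3.and_eventually ((ess_lt hD hM hy h1).and (ae_nae D hD h hy))).exists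
  linarith

theorem ess_usc (hD : IsOpen D) (hM : ∀ x ∈ D, |u x| ≤ M) (hy : y ∈ D) (hc : ess u y < c) :
    ∀ᶠ x in 𝓝 y, ess u x < c := by
  obtain ⟨c', h1, h2⟩ := exists_between hc
  have h3 := ess_lt hD hM hy h1
  rw [eventually_inf] at h3
  obtain ⟨s, hs, t, ht, hst⟩ := h3
  have h4 : D ∩ interior s ∈ 𝓝 y := inter_mem (hD.mem_nhds hy) (interior_mem_nhds.2 hs)
  filter_upwards [h4] with x hx
  refine lt_of_le_of_lt (ess_le hD hM hx.1 ?_) h2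
  have h5 : s ∩ t ∈ 𝓝 x ⊓ ae volume := inter_mem_inf (mem_interior_iff_mem_nhds.1 hx.2) ht
  filter_upwards [h5] with z hz
  exact (hst z hz).le

end bd

theorem ae_freq {D : Set V} (u : V → ℝ) : ∀ᵐ y, ∀ c, c < u y → ∃ᶠ x in 𝓝 y ⊓ ae volume, c < u x := by
  have h : ∀ᵐ y, ∀ q : ℚ, (q : ℝ) < u y → ∃ᶠ x in 𝓝 y ⊓ ae volume, (q : ℝ) < u x := by
    rw [ae_all_iff]; intro q
    rw [ae_iff]
    set A : Set V := {a | ¬((q : ℝ) < u a → ∃ᶠ x in 𝓝 a ⊓ ae volume, (q : ℝ) < u x)} with hA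
    refine measure_null_of_locally_null A fun y hy => ?_
    simp only [hA, Set.mem_ofPred_eq, Classical.not_imp, not_frequently] at hy
    obtain ⟨h1, h2⟩ := hy
    rw [eventually_inf] at h2
    obtain ⟨s, hs, t, ht, hst⟩ := h2
    refine ⟨A ∩ s, inter_mem self_mem_nhdsWithin (mem_nhdsWithin_of_mem_nhds hs), ?_⟩
    refine measure_mono_null ?_ (mem_ae_iff.1 ht)
    rintro z ⟨hz1, hz2⟩ hzt
    simp only [hA, Set.mem_ofPred_eq, Classical.not_imp] at hz1
    exact hst z ⟨hz2, hzt⟩ hz1.1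
  filter_upwards [h] with y hy c hc
  obtain ⟨q, hq1, hq2⟩ := exists_rat_btwn hc
  exact (hy q hq2).mono fun x hx => hq1.trans hx

section
variable {S : EF V ι} {n : ℕ} {r : ℝ}

theorem ess_ae_eq (K : Ker S n r) (hn : 1 ≤ n) (hN : Fintype.card ι = 2 * n) {D : Set V} (hD : IsOpen D)
    (hDr : D ⊆ closedBall 0 r) {u : V → ℝ} (hu : WSub S D u) {M : ℝ} (hM : ∀ x ∈ D, |u x| ≤ M) :
    ∀ᵐ y, y ∈ D → ess u y = u y := by
  filter_upwards [K.ess_usc hn hN hD hDr hu hM, ae_freq (D := D) u] with y h1 h2 hy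
  refine le_antisymm (le_of_forall_gt_imp_ge_of_dense fun c hc => ?_) (le_of_forall_lt_imp_le_of_dense fun c hc => ?_)
  · exact ess_le hD hM hy ((h1 hy c hc).mono fun x hx => hx.le)
  · exact le_ess hD hM hy ((h2 c hc).mono fun x hx => hx.le)

theorem ess_SU {D : Set V} (hD : IsOpen D) {u : V → ℝ} {M : ℝ} (hM : ∀ x ∈ D, |u x| ≤ M)
    (h : ∀ᵐ y, y ∈ D → ess u y = u y) : SU D (ess u) := by
  intro y hy
  refine ⟨fun c hc => ess_usc hD hM hy hc, fun c hc => ?_⟩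
  exact ((lt_ess hD hM hy hc).and_eventually (ae_nae D hD h hy)).mono fun x hx => by rw [hx.2]; exact hx.1

end

theorem SU.max {D : Set V} {u v : V → ℝ} (hu : SU D u) (hv : SU D v) : SU D (fun x => max (u x) (v x)) := by
  intro y hy
  refine ⟨fun c hc => ?_, fun c hc => ?_⟩
  · rw [max_lt_iff] at hc
    filter_upwards [(hu y hy).1 c hc.1, (hv y hy).1 c hc.2] with x h1 h2
    exact max_lt h1 h2
  · rcases lt_max_iff.1 hc with h | h
    · exact ((hu y hy).2 c h).mono fun x hx => lt_max_of_lt_left hx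
    · exact ((hv y hy).2 c h).mono fun x hx => lt_max_of_lt_right hx

theorem SU.add_const {D : Set V} {u : V → ℝ} (hu : SU D u) (δ : ℝ) : SU D (fun x => u x + δ) := by
  intro y hy
  refine ⟨fun c hc => ?_, fun c hc => ?_⟩
  · filter_upwards [(hu y hy).1 (c - δ) (by linarith)] with x h1
    linarith
  · exact ((hu y hy).2 (c - δ) (by linarith)).mono fun x hx => by linarith

theorem SU.const {D : Set V} (c : ℝ) : SU D (fun _ => c) := by
  intro y hy
  have := nae_neBot y
  exact ⟨fun d hd => Eventually.of_forall fun _ => hd, fun d hd => (Eventually.of_forall fun _ => hd).frequently⟩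

theorem SU.iff {D : Set V} (hD : IsOpen D) (v : V → ℝ) : SU D v ↔
    (UpperSemicontinuousOn (fun z => (v z : EReal)) D ∧ ∀ z₀ ∈ D, ∀ T : Set V, (∃ N ∈ 𝓝 z₀, volume (N \ T) = 0) →
      limsup (fun z => (v z : EReal)) (𝓝[T] z₀) = v z₀) := by
  have mem_iff : ∀ (z : V) (T : Set V), T ∈ 𝓝 z ⊓ ae volume ↔ ∃ N ∈ 𝓝 z, volume (N \ T) = 0 := by
    intro z T
    constructor
    · intro h
      rw [mem_inf_iff_superset] at h
      obtain ⟨s, hs, t, ht, hst⟩ := h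
      refine ⟨s, hs, measure_mono_null ?_ (mem_ae_iff.1 ht)⟩
      rintro x ⟨h1, h2⟩ h3
      exact h2 (hst ⟨h1, h3⟩)
    · rintro ⟨N, hN, h0⟩
      rw [mem_inf_iff_superset]
      refine ⟨N, hN, (N \ T)ᶜ, by rw [mem_ae_iff, compl_compl]; exact h0, ?_⟩
      rintro x ⟨h1, h2⟩
      by_contra h3
      exact h2 ⟨h1, h3⟩
  constructor
  · intro h
    refine ⟨fun z hz c hc => ?_, fun z hz T hT => ?_⟩
    · obtain ⟨c', h1, h2⟩ := EReal.lt_iff_exists_real_btwn.1 hc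
      refine mem_nhdsWithin_of_mem_nhds ?_
      filter_upwards [(h z hz).1 c' (EReal.coe_lt_coe_iff.1 h1)] with x hx
      exact (EReal.coe_lt_coe_iff.2 hx).trans h2
    · have hle : 𝓝 z ⊓ ae volume ≤ 𝓝[T] z :=
        le_inf inf_le_left (le_principal_iff.2 ((mem_iff z T).2 hT))
      refine le_antisymm (le_of_forall_gt_imp_ge_of_dense fun c hc => ?_) (le_of_forall_lt_imp_le_of_dense fun c hc => ?_)
      · obtain ⟨c', h1, h2⟩ := EReal.lt_iff_exists_real_btwn.1 hc
        refine limsup_le_of_le (h := ?_)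
        refine mem_nhdsWithin_of_mem_nhds ?_
        filter_upwards [(h z hz).1 c' (EReal.coe_lt_coe_iff.1 h1)] with x hx
        exact ((EReal.coe_lt_coe_iff.2 hx).trans h2).le
      · obtain ⟨c', h1, h2⟩ := EReal.lt_iff_exists_real_btwn.1 hc
        refine le_limsup_of_frequently_le ?_
        refine Filter.Frequently.filter_mono (((h z hz).2 c' (EReal.coe_lt_coe_iff.1 h2)).mono fun x hx => ?_) hle
        exact (h1.trans (EReal.coe_lt_coe_iff.2 hx)).le
  · rintro ⟨h1, h2⟩ y hy
    refine ⟨fun c hc => ?_, fun c hc => ?_⟩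
    · have h3 := h1 y hy (c : EReal) (EReal.coe_lt_coe_iff.2 hc)
      rw [nhdsWithin_eq_nhds.2 (hD.mem_nhds hy)] at h3
      exact h3.mono fun x hx => EReal.coe_lt_coe_iff.1 hx
    · intro hev
      have h3 := h2 y hy {x | ¬ c < v x} ((mem_iff y _).1 hev)
      have h4 : limsup (fun z => (v z : EReal)) (𝓝[{x | ¬ c < v x}] y) ≤ (c : EReal) := by
        refine limsup_le_of_le (h := ?_)
        filter_upwards [self_mem_nhdsWithin] with x hx
        exact EReal.coe_le_coe_iff.2 (not_lt.1 hx)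
      rw [h3, EReal.coe_le_coe_iff] at h4
      linarith

end ess

end APerron
end

open MeasureTheory Filter Topology Complex Metric

set_option linter.unusedSectionVars false
set_option linter.unusedSimpArgs false
set_option linter.unusedVariables false

noncomputable section

namespace APerron

open Module

section riesz

open CompactlySupported

variable {V : Type*} [NormedAddCommGroup V] [NormedSpace ℝ V] [FiniteDimensional ℝ V]
  [MeasureSpace V] [BorelSpace V] [(volume : Measure V).IsAddHaarMeasure]
  {ι : Type*} [Fintype ι] (S : EF V ι)

theorem cutoff {K U : Set V} (hK : IsCompact K) (hU : IsOpen U) (hKU : K ⊆ U) :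
    ∃ χ : V → ℝ, ContDiff ℝ (⊤ : ℕ∞) χ ∧ HasCompactSupport χ ∧ tsupport χ ⊆ U ∧ (∀ x, 0 ≤ χ x) ∧ (∀ x, χ x ≤ 1) ∧
      ∃ O : Set V, IsOpen O ∧ K ⊆ O ∧ ∀ x ∈ O, χ x = 1 := by
  obtain ⟨K1, hK1, h1, h2⟩ := exists_compact_between hK hU hKU
  obtain ⟨K2, hK2, h3, h4⟩ := exists_compact_between hK1 hU h2
  obtain ⟨f, hf, hr, hs, ht⟩ := exists_contMDiff_support_eq_eq_one_iff (n := ⊤) (modelWithCornersSelf ℝ V) isOpen_interior hK1.isClosed h3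
  have hts : tsupport f ⊆ K2 := by
    rw [tsupport, hs]; exact closure_minimal interior_subset hK2.isClosed
  refine ⟨f, contMDiff_iff_contDiff.1 hf, hK2.of_isClosed_subset (isClosed_tsupport f) hts, hts.trans h4,
    fun x => (hr ⟨x, rfl⟩).1, fun x => (hr ⟨x, rfl⟩).2, interior K1, isOpen_interior, h1, fun x hx => (ht x).1 (interior_subset hx)⟩

theorem exists_nu {D : Set V} {u : V → ℝ} (hu : WSub S D u) {χ : V → ℝ} (hχ : ContDiff ℝ (⊤ : ℕ∞) χ)
    (hχc : HasCompactSupport χ) (hχD : tsupport χ ⊆ D) (hχ0 : ∀ x, 0 ≤ χ x) :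
    ∃ ν : Measure V, IsFiniteMeasure ν ∧ ν (tsupport χ)ᶜ = 0 ∧ ∀ f : V → ℝ, ContDiff ℝ (⊤ : ℕ∞) f → HasCompactSupport f →
      ∫ x, f x ∂ν = ∫ x, u x * S.L (fun y => χ y * f y) x := by
  have h2t : (2 : WithTop ℕ∞) ≤ ((⊤ : ℕ∞) : WithTop ℕ∞) := by norm_cast
  let dom : Submodule ℝ C_c(V, ℝ) :=
    { carrier := {f | ContDiff ℝ (⊤ : ℕ∞) (f : V → ℝ)}
      add_mem' := fun {a b} ha hb => by
        have : ContDiff ℝ (⊤ : ℕ∞) (fun x => a x + b x) := ContDiff.add ha hb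
        exact this
      zero_mem' := by
        have : ContDiff ℝ (⊤ : ℕ∞) (fun _ : V => (0:ℝ)) := contDiff_const
        exact this
      smul_mem' := fun c f hf => by
        have : ContDiff ℝ (⊤ : ℕ∞) (fun x => c * f x) := contDiff_const.mul hf
        exact this }
  have smul_sm : ∀ f : V → ℝ, ContDiff ℝ (⊤ : ℕ∞) f → ContDiff ℝ (⊤ : ℕ∞) (fun y => χ y * f y) := fun f hf => hχ.mul hf
  have hInt0 : ∀ f : V → ℝ, ContDiff ℝ (⊤ : ℕ∞) f → Integrable (fun x => u x * S.L (fun y => χ y * f y) x) := fun f hf =>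
    WSub.int_mul_L S hu.1 (smul_sm f hf) hχc.mul_right ((tsupport_mul_subset_left).trans hχD)
  let Λ : C_c(V, ℝ) →ₗ.[ℝ] ℝ :=
    { domain := dom
      toFun :=
        { toFun := fun f => ∫ x, u x * S.L (fun y => χ y * (f : C_c(V, ℝ)) y) x
          map_add' := fun a b => by
            rw [← integral_add (hInt0 _ a.2) (hInt0 _ b.2)]
            congr 1; funext x
            have h := congrFun (L_add S ((smul_sm _ a.2).of_le h2t) ((smul_sm _ b.2).of_le h2t)) x
            rw [← mul_add, ← h]
            congr 2; funext y
            simp [mul_add]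
          map_smul' := fun c a => by
            simp only [RingHom.id_apply, smul_eq_mul]
            rw [← integral_const_mul]
            congr 1; funext x
            have h := congrFun (L_const_mul S c ((smul_sm _ a.2).of_le h2t)) x
            rw [mul_left_comm, ← h]
            congr 2; funext y
            simp; ring } }
  let cone : PointedCone ℝ C_c(V, ℝ) :=
    { carrier := {f | ∀ x, 0 ≤ f x}
      add_mem' := fun {a b} ha hb x => add_nonneg (ha x) (hb x)
      zero_mem' := fun x => le_rfl
      smul_mem' := fun c f hf x => mul_nonneg c.2 (hf x) }
  have hdense : ∀ y : C_c(V, ℝ), ∃ x : Λ.domain, (x : C_c(V, ℝ)) + y ∈ cone := by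
    intro y
    obtain ⟨b, hb, hbc, -, hb0, hb1, O, hO, hKO, hO1⟩ := cutoff (V := V) y.hasCompactSupport isOpen_univ (Set.subset_univ _)
    obtain ⟨C, hC, hyC⟩ := bdd_of_hcs y.continuous y.hasCompactSupport
    have hcs : ContDiff ℝ (⊤ : ℕ∞) (fun x => C * b x) := contDiff_const.mul hb
    refine ⟨⟨⟨⟨fun x => C * b x, hcs.continuous⟩, hbc.mul_left⟩, hcs⟩, ?_⟩
    intro x
    change (0:ℝ) ≤ C * b x + y x
    by_cases hx : x ∈ tsupport y
    · rw [hO1 x (hKO hx), mul_one]; have e : -C ≤ y x := (abs_le.1 (hyC x)).1; linarith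
    · rw [image_eq_zero_of_notMem_tsupport hx]
      have := hb0 x; positivity
  obtain ⟨g, hg1, hg2⟩ := riesz_extension (cone) Λ (by
    intro f hf
    refine hu.2 _ (smul_sm _ f.2) hχc.mul_right ((tsupport_mul_subset_left).trans hχD) fun z => ?_
    exact mul_nonneg (hχ0 z) (hf z)) hdense
  let P : C_c(V, ℝ) →ₚ[ℝ] ℝ := PositiveLinearMap.mk₀ g fun x hx => hg2 x hx
  have hrep : ∀ f : V → ℝ, ContDiff ℝ (⊤ : ℕ∞) f → HasCompactSupport f →
      ∫ x, f x ∂(RealRMK.rieszMeasure P) = ∫ x, u x * S.L (fun y => χ y * f y) x := by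
    intro f hf hfc
    have h1 := RealRMK.integral_rieszMeasure P ⟨⟨f, hf.continuous⟩, hfc⟩
    have h2 := hg1 ⟨⟨⟨f, hf.continuous⟩, hfc⟩, hf⟩
    exact h1.trans h2
  have hnull : (RealRMK.rieszMeasure P) (tsupport χ)ᶜ = 0 := by
    refine measure_null_of_locally_null _ fun y hy => ?_
    obtain ⟨b, hb, hbc, hbU, hb0, hb1, O, hO, hKO, hO1⟩ := cutoff (V := V) (isCompact_singleton (x := y))
      (isClosed_tsupport χ).isOpen_compl (Set.singleton_subset_iff.2 hy)
    refine ⟨O, mem_nhdsWithin_of_mem_nhds (hO.mem_nhds (hKO rfl)), ?_⟩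
    have h0 : ∫ x, b x ∂(RealRMK.rieszMeasure P) = 0 := by
      rw [hrep b hb hbc]
      have : (fun y => χ y * b y) = fun _ => 0 := by
        funext x
        by_cases hx : x ∈ tsupport χ
        · rw [image_eq_zero_of_notMem_tsupport fun h => hbU h hx, mul_zero]
        · rw [image_eq_zero_of_notMem_tsupport hx, zero_mul]
      rw [this, L_const]; simp
    have hbi : Integrable b (RealRMK.rieszMeasure P) := hb.continuous.integrable_of_hasCompactSupport hbc
    rw [integral_eq_zero_iff_of_nonneg hb0 hbi] at h0
    refine measure_mono_null ?_ (ae_iff.1 h0)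
    intro x hx
    simp [hO1 x hx]
  refine ⟨RealRMK.rieszMeasure P, ⟨?_⟩, hnull, hrep⟩
  calc (RealRMK.rieszMeasure P) Set.univ ≤ (RealRMK.rieszMeasure P) (tsupport χ) + (RealRMK.rieszMeasure P) (tsupport χ)ᶜ := by
        rw [← Set.union_compl_self (tsupport χ)]; exact measure_union_le _ _
    _ < ⊤ := by
        rw [hnull, add_zero]; exact hχc.isCompact.measure_lt_top

end riesz

end APerron
end

open MeasureTheory Filter Topology Complex Metric

set_option linter.unusedSectionVars false
set_option linter.unusedSimpArgs false
set_option linter.unusedVariables false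

noncomputable section

namespace APerron

open Module

section pot

variable {V : Type*} [NormedAddCommGroup V] [NormedSpace ℝ V] [FiniteDimensional ℝ V]
  [MeasureSpace V] [BorelSpace V] [(volume : Measure V).IsAddHaarMeasure]
  {ι : Type*} [Fintype ι]
variable {S : EF V ι} {n : ℕ} {r : ℝ} (K : Ker S n r)

theorem fub {ν : Measure V} [IsFiniteMeasure ν] {X T : Set V} (hX : IsCompact X) (hT : IsCompact T) {F : V → V → ℝ}
    (hF : Continuous fun p : V × V => F p.1 p.2) :
    Integrable (Function.uncurry F) (((volume : Measure V).restrict X).prod (ν.restrict T)) := by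
  rw [Measure.prod_restrict]
  exact hF.continuousOn.integrableOn_compact (hX.prod hT)

/-- increasing limits with bounded integrals -/
theorem mono_lim {g : ℕ → V → ℝ} (hg : ∀ k, Integrable (g k)) (h0 : ∀ k x, 0 ≤ g k x) (hm : ∀ x, Monotone fun k => g k x)
    {B : ℝ} (hB : ∀ k, ∫ x, g k x ≤ B) :
    ∃ G : V → ℝ, Integrable G ∧ (∀ x, 0 ≤ G x) ∧ (∀ x, (∀ k, g k x = 0) → G x = 0) ∧
      (∀ᵐ x, Tendsto (fun k => g k x) atTop (𝓝 (G x))) ∧ ∀ᵐ x, ∀ k, g k x ≤ G x := by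
  set Φ : V → ENNReal := fun x => ⨆ k, ENNReal.ofReal (g k x) with hΦ
  have hmm : ∀ x, Monotone fun k => ENNReal.ofReal (g k x) := fun x i j hij => ENNReal.ofReal_le_ofReal (hm x hij)
  have haem : ∀ k, AEMeasurable (fun x => ENNReal.ofReal (g k x)) :=
    fun k => (hg k).aestronglyMeasurable.aemeasurable.ennreal_ofReal
  have hl : ∫⁻ x, Φ x ≤ ENNReal.ofReal B := by
    rw [hΦ, lintegral_iSup' haem (Eventually.of_forall hmm)]
    refine iSup_le fun k => ?_
    rw [← ofReal_integral_eq_lintegral_ofReal (hg k) (Eventually.of_forall (h0 k))]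
    exact ENNReal.ofReal_le_ofReal (hB k)
  have hΦm : AEMeasurable Φ := AEMeasurable.iSup haem
  have hfin : ∀ᵐ x, Φ x < ⊤ := ae_lt_top' hΦm (lt_of_le_of_lt hl ENNReal.ofReal_lt_top).ne
  have hle : ∀ᵐ x, ∀ k, g k x ≤ (Φ x).toReal := by
    filter_upwards [hfin] with x hx k
    have h1 : ENNReal.ofReal (g k x) ≤ Φ x := le_iSup (fun k => ENNReal.ofReal (g k x)) k
    rw [← ENNReal.toReal_ofReal (h0 k x)]
    exact ENNReal.toReal_mono hx.ne h1
  refine ⟨fun x => (Φ x).toReal, integrable_toReal_of_lintegral_ne_top hΦm (lt_of_le_of_lt hl ENNReal.ofReal_lt_top).ne,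
    fun x => ENNReal.toReal_nonneg, fun x hx => ?_, ?_, hle⟩
  · simp [hΦ, hx]
  · filter_upwards [hfin] with x hx
    have h1 : Tendsto (fun k => ENNReal.ofReal (g k x)) atTop (𝓝 (Φ x)) := tendsto_atTop_iSup (hmm x)
    have h2 := (ENNReal.tendsto_toReal hx.ne).comp h1
    refine h2.congr fun k => ?_
    simp [ENNReal.toReal_ofReal (h0 k x)]

def Ker.pt (R s : ℝ) (T : Set V) (ν : Measure V) (x : V) : ℝ := ∫ y in T, K.G R s y x ∂ν

section
variable {R : ℝ} (hR : 0 < R) (hRR : R ≤ K.R0) {s : ℝ} (hs : 0 < s) {T : Set V} (hT : IsCompact T)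
  (hTr : T ⊆ closedBall 0 r) (ν : Measure V) [IsFiniteMeasure ν]

theorem Ker.G_swap (hR : 0 < R) (hRR : R ≤ K.R0) (hs : 0 < s) : Continuous fun p : V × V => K.G R s p.2 p.1 :=
  (K.G_cont hR hRR hs).comp continuous_swap

theorem Ker.pt_cont (hR : 0 < R) (hRR : R ≤ K.R0) (hs : 0 < s) (hT : IsCompact T) : Continuous (K.pt R s T ν) := by
  have h : Continuous (Function.uncurry fun x y => K.G R s y x) := K.G_swap hR hRR hs
  exact continuous_parametric_integral_of_continuous h hT

theorem Ker.pt_nonneg (hR : 0 < R) (hRR : R ≤ K.R0) (hs : 0 < s) (x : V) : 0 ≤ K.pt R s T ν x :=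
  integral_nonneg fun y => K.G_nonneg hR hRR hs

theorem Ker.pt_zero (hR : 0 < R) (hRR : R ≤ K.R0) (hs : 0 < s) (hT : IsCompact T) (hTr : T ⊆ closedBall 0 r) {x : V}
    (hx : ∀ y ∈ T, K.C * R ≤ ‖x - y‖) : K.pt R s T ν x = 0 := by
  unfold Ker.pt
  rw [setIntegral_congr_fun (g := fun _ => 0) hT.measurableSet fun y hy => K.G_zero hR hRR hs (hTr hy) (hx y hy)]
  simp

theorem Ker.far (hTr : T ⊆ closedBall 0 r) {x y : V} (hx : x ∉ closedBall (0:V) (r + K.C * R)) (hy : y ∈ T) :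
    K.C * R ≤ ‖x - y‖ := by
  rw [mem_closedBall_zero_iff, not_le] at hx
  have h1 := hTr hy
  rw [mem_closedBall_zero_iff] at h1
  linarith [norm_sub_norm_le x y]

theorem Ker.pt_hcs (hR : 0 < R) (hRR : R ≤ K.R0) (hs : 0 < s) (hT : IsCompact T) (hTr : T ⊆ closedBall 0 r) :
    HasCompactSupport (K.pt R s T ν) :=
  HasCompactSupport.intro (isCompact_closedBall 0 (r + K.C * R)) fun x hx =>
    K.pt_zero ν hR hRR hs hT hTr fun y hy => K.far hTr hx hy

theorem Ker.pt_int (hR : 0 < R) (hRR : R ≤ K.R0) (hs : 0 < s) (hT : IsCompact T) (hTr : T ⊆ closedBall 0 r) :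
    Integrable (K.pt R s T ν) :=
  (K.pt_cont ν hR hRR hs hT).integrable_of_hasCompactSupport (K.pt_hcs ν hR hRR hs hT hTr)

/-- Fubini for potentials -/
theorem Ker.pt_fub (hR : 0 < R) (hRR : R ≤ K.R0) (hs : 0 < s) (hT : IsCompact T) (hTr : T ⊆ closedBall 0 r)
    {h : V → ℝ} (hh : Continuous h) :
    ∫ x, K.pt R s T ν x * h x = ∫ y in T, (∫ x, K.G R s y x * h x) ∂ν ∧
    IntegrableOn (fun y => ∫ x, K.G R s y x * h x) T ν := by
  set X := closedBall (0:V) (r + K.C * R) with hX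
  have hF : Continuous fun p : V × V => K.G R s p.2 p.1 * h p.1 := (K.G_swap hR hRR hs).mul (hh.comp continuous_fst)
  have hi := fub (ν := ν) (isCompact_closedBall (0:V) (r + K.C * R)) hT (F := fun x y => K.G R s y x * h x) hF
  have e1 : ∫ x, K.pt R s T ν x * h x = ∫ x in X, ∫ y in T, K.G R s y x * h x ∂ν := by
    rw [← setIntegral_eq_integral_of_forall_compl_eq_zero (s := X) (fun x hx => by
      rw [K.pt_zero ν hR hRR hs hT hTr fun y hy => K.far hTr hx hy, zero_mul])]
    congr 1; funext x
    rw [Ker.pt, integral_mul_const]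
  have e2 : ∀ y ∈ T, ∫ x in X, K.G R s y x * h x = ∫ x, K.G R s y x * h x := fun y hy =>
    setIntegral_eq_integral_of_forall_compl_eq_zero fun x hx => by
      rw [K.G_zero hR hRR hs (hTr hy) (K.far hTr hx hy), zero_mul]
  constructor
  · rw [e1, integral_integral_swap hi]
    exact setIntegral_congr_fun hT.measurableSet e2
  · exact (integrableOn_congr_fun e2 hT.measurableSet).1 hi.integral_prod_right

theorem Ker.G_int (hR : 0 < R) (hRR : R ≤ K.R0) (hs : 0 < s) {y : V} (hy : y ∈ closedBall (0:V) r) : Integrable (K.G R s y) :=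
  (K.G_smooth hR hRR hs).continuous.integrable_of_hasCompactSupport (K.G_hcs hR hRR hs hy)

theorem Ker.pt_upper (hn : 1 ≤ n) (hN : Fintype.card ι = 2 * n) {R : ℝ} (hR : 0 < R) (hRR : R ≤ K.R0) : ∃ B : ℝ, ∀ {s : ℝ} (hs : 0 < s) {T : Set V} (hT : IsCompact T)
  (hTr : T ⊆ closedBall 0 r) (ν : Measure V) [IsFiniteMeasure ν], ∫ x, K.pt R s T ν x ≤ B * ν.real T := by
  obtain ⟨C, hC, hk⟩ := hk_int (V := V) hn (finrank_eq_two S hN)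
  have hKC := K.Cpos
  have hnt : Nontrivial V := by
      apply Module.nontrivial_of_finrank_pos (R := ℝ); rw [finrank_eq_two S hN]; omega
  obtain ⟨ih, bh⟩ := hk (K.C * R) (by positivity)
  refine ⟨K.C * (C * (K.C * R)), fun {s} hs {T} hT hTr ν _ => ?_⟩
  obtain ⟨f1, f2⟩ := K.pt_fub ν hR hRR hs hT hTr (h := fun _ => 1) continuous_const
  simp only [mul_one] at f1 f2
  rw [f1]
  calc ∫ y in T, (∫ x, K.G R s y x) ∂ν ≤ ∫ y in T, K.C * (C * (K.C * R)) ∂ν := by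
        refine setIntegral_mono_on f2 (integrableOn_const (measure_lt_top _ _).ne) hT.measurableSet fun y hy => ?_
        calc ∫ x, K.G R s y x ≤ ∫ x, K.C * APerron.hk n (K.C * R) (x - y) := by
              refine integral_mono_ae (K.G_int hR hRR hs (hTr hy)) ((ih.comp_sub_right y).const_mul _) ?_
              have hne : ∀ᵐ x : V, x ≠ y := by simp [ae_iff, measure_singleton]
              filter_upwards [hne] with x hx
              by_cases hd : ‖x - y‖ < K.C * R
              · rw [hk_eq hd]; exact K.G_le hR hRR hs (hTr hy) hx
              · rw [K.G_zero hR hRR hs (hTr hy) (not_lt.1 hd)]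
                have := hk_nonneg n (K.C * R) (x - y)
                positivity
          _ = K.C * ∫ x : V, APerron.hk n (K.C * R) x := by
              rw [integral_const_mul, integral_sub_right_eq_self (fun x : V => APerron.hk n (K.C * R) x)]
          _ ≤ _ := by gcongr
    _ = _ := by rw [setIntegral_const, smul_eq_mul, mul_comm]

theorem Ker.pt_lower (hn : 1 ≤ n) (hN : Fintype.card ι = 2 * n) {R : ℝ} (hR : 0 < R) (hRR : R ≤ K.R0) : ∃ c : ℝ, 0 < c ∧ ∀ {s : ℝ} (hs : 0 < s) (hsm : s ≤ K.m * R ^ 2) {T : Set V} (hT : IsCompact T)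
  (hTr : T ⊆ closedBall 0 r) (ν : Measure V) [IsFiniteMeasure ν], c * ν.real T ≤ ∫ x, K.pt R s T ν x := by
  obtain ⟨γ, hγ, hge⟩ := K.G_ge hR hRR
  have hm := K.m_pos
  have hb : 0 < (volume : Measure V).real (closedBall (0:V) (K.m * R)) :=
    ENNReal.toReal_pos (measure_closedBall_pos _ _ (by positivity)).ne' measure_closedBall_lt_top.ne
  refine ⟨(volume : Measure V).real (closedBall (0:V) (K.m * R)) * γ, by positivity, fun {s} hs hsm {T} hT hTr ν _ => ?_⟩
  obtain ⟨f1, f2⟩ := K.pt_fub ν hR hRR hs hT hTr (h := fun _ => 1) continuous_const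
  simp only [mul_one] at f1 f2
  rw [f1]
  calc _ = ∫ y in T, (volume : Measure V).real (closedBall (0:V) (K.m * R)) * γ ∂ν := by
        rw [setIntegral_const, smul_eq_mul, mul_comm]
    _ ≤ _ := by
      refine setIntegral_mono_on (integrableOn_const (measure_lt_top _ _).ne) f2 hT.measurableSet fun y hy => ?_
      have hi := K.G_int hR hRR hs (hTr hy)
      calc _ = ∫ x in closedBall y (K.m * R), γ := by
            rw [setIntegral_const, smul_eq_mul, Measure.addHaar_real_closedBall_center (volume : Measure V) y]
        _ ≤ ∫ x in closedBall y (K.m * R), K.G R s y x := by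
            refine setIntegral_mono_on (integrableOn_const measure_closedBall_lt_top.ne) hi.integrableOn measurableSet_closedBall fun x hx => ?_
            rw [mem_closedBall, dist_eq_norm] at hx
            exact hge hs hsm (hTr hy) hx
        _ ≤ _ := setIntegral_le_integral hi (Eventually.of_forall fun x => K.G_nonneg hR hRR hs)

theorem Ker.pt_L (hN : Fintype.card ι = 2 * n) : ∃ κ : ℝ, 0 < κ ∧ ∀ {R : ℝ} (hR : 0 < R) (hRR : R ≤ K.R0) {s : ℝ} (hs : 0 < s) {T : Set V} (hT : IsCompact T)
  (hTr : T ⊆ closedBall 0 r) (ν : Measure V) [IsFiniteMeasure ν] {φ : V → ℝ} (hφ : ContDiff ℝ (⊤ : ℕ∞) φ)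
  (hφc : HasCompactSupport φ) (hφ0 : ∀ x, 0 ≤ φ x) {Lp : NNReal} (hLp : LipschitzWith Lp φ),
    -(κ * ∫ y in T, φ y ∂ν) - Lp * (κ * √s) * ν.real T ≤ ∫ x, K.pt R s T ν x * S.L φ x := by
  obtain ⟨κ, hκ, hH⟩ := K.H_mass_le hN
  refine ⟨κ, hκ, fun {R} hR hRR {s} hs {T} hT hTr ν _ {φ} hφ hφc hφ0 {Lp} hLp => ?_⟩
  have h2t : (2 : WithTop ℕ∞) ≤ ((⊤ : ℕ∞) : WithTop ℕ∞) := by norm_cast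
  obtain ⟨f1, f2⟩ := K.pt_fub ν hR hRR hs hT hTr (h := S.L φ) (L_cont S (hφ.of_le h2t))
  rw [f1]
  have iφ : IntegrableOn φ T ν := hφ.continuous.continuousOn.integrableOn_compact hT
  have ic : IntegrableOn (fun _ : V => Lp * (κ * √s)) T ν := integrableOn_const (measure_lt_top _ _).ne
  have iφ' : IntegrableOn (fun y => -(κ * φ y)) T ν := (iφ.const_mul κ).neg
  calc _ = ∫ y in T, (-(κ * φ y) - Lp * (κ * √s)) ∂ν := by
        rw [integral_sub iφ' ic, integral_neg, integral_const_mul, setIntegral_const, smul_eq_mul]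
        ring
    _ ≤ _ := by
      refine setIntegral_mono_on ((iφ.const_mul κ).neg.sub ic) f2 hT.measurableSet fun y hy => ?_
      have hyr := hTr hy
      obtain ⟨m1, m2⟩ := hH hR hRR hs hyr
      have iH := K.H_int hR hRR hs hyr
      have e1 : ∫ x, K.G R s y x * S.L φ x = ∫ x, φ x * S.L (K.G R s y) x :=
        (L_symm S (K.G_two hR hRR hs) (hφ.of_le h2t) (Or.inl hφc)).symm
      have iL : Integrable fun x => φ x * S.L (K.G R s y) x :=
        (hφ.continuous.mul (L_cont S (K.G_two hR hRR hs))).integrable_of_hasCompactSupport hφc.mul_right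
      have iH1 : Integrable fun x => K.H R s y x * ‖x - y‖ :=
        ((K.H_contx hR hRR hs).mul (by fun_prop)).integrable_of_hasCompactSupport (K.H_hcs hR hRR hs hyr).mul_right
      have iHn : Integrable fun x => -(K.H R s y x * φ y) := (iH.mul_const _).neg
      rw [e1]
      calc -(κ * φ y) - Lp * (κ * √s) ≤ -((∫ x, K.H R s y x) * φ y) - Lp * (∫ x, K.H R s y x * ‖x - y‖) := by
            have := hφ0 y
            gcongr
        _ = ∫ x, (-(K.H R s y x * φ y) - Lp * (K.H R s y x * ‖x - y‖)) := by
            rw [integral_sub iHn (iH1.const_mul _), integral_neg, integral_mul_const, integral_const_mul]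
        _ ≤ _ := by
            refine integral_mono ((iH.mul_const _).neg.sub (iH1.const_mul _)) iL fun x => ?_
            dsimp only
            rw [K.LG hR hRR hs]
            have hE := K.E_nonneg hR hRR hs hyr (x := x)
            have hHn := K.H_nonneg hR hRR hs (y := y) (x := x)
            have h1 := mul_nonneg (hφ0 x) hE
            have h2 : φ x ≤ φ y + Lp * ‖x - y‖ := by
              have := hLp.dist_le_mul x y
              rw [Real.dist_eq, dist_eq_norm] at this
              linarith [le_abs_self (φ x - φ y)]
            nlinarith [mul_le_mul_of_nonneg_left h2 hHn]

/-- The potential of a measure. -/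
theorem Ker.potential (hn : 1 ≤ n) (hN : Fintype.card ι = 2 * n) {R : ℝ} (hR : 0 < R) (hRR : R ≤ K.R0) :
    ∃ c : ℝ, 0 < c ∧ ∀ {T : Set V} (hT : IsCompact T) (hTr : T ⊆ closedBall 0 r) (ν : Measure V) [IsFiniteMeasure ν],
    ∃ g : V → ℝ, Integrable g ∧ (∀ x, 0 ≤ g x) ∧ (∀ x, (∀ y ∈ T, K.C * R ≤ ‖x - y‖) → g x = 0) ∧
      c * ν.real T ≤ ∫ x, g x ∧ ∀ φ : V → ℝ, ContDiff ℝ (⊤ : ℕ∞) φ → HasCompactSupport φ → (∀ x, 0 ≤ φ x) →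
        -(∫ y in T, φ y ∂ν) ≤ ∫ x, g x * S.L φ x := by
  obtain ⟨B, hB⟩ := K.pt_upper hn hN hR hRR
  obtain ⟨c, hc, hlow⟩ := K.pt_lower hn hN hR hRR
  obtain ⟨κ, hκ, hL⟩ := K.pt_L hN
  have hm := K.m_pos
  refine ⟨κ⁻¹ * c, by positivity, fun {T} hT hTr ν _ => ?_⟩
  set s : ℕ → ℝ := fun k => K.m * R ^ 2 * (1 / ((k : ℝ) + 1)) with hsdef
  have hs : ∀ k, 0 < s k := fun k => by simp only [hsdef]; positivity
  have hsm : ∀ k, s k ≤ K.m * R ^ 2 := fun k => by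
    simp only [hsdef]
    apply mul_le_of_le_one_right (by positivity)
    rw [div_le_one (by positivity)]; linarith [Nat.cast_nonneg (α := ℝ) k]
  have hsa : ∀ i j, i ≤ j → s j ≤ s i := fun i j hij => by
    simp only [hsdef]
    gcongr
  have hs0 : Tendsto s atTop (𝓝 0) := by
    have := (tendsto_one_div_add_atTop_nhds_zero_nat (𝕜 := ℝ)).const_mul (K.m * R ^ 2)
    rw [mul_zero] at this; exact this
  obtain ⟨G, G1, G2, G3, G4, G5⟩ := mono_lim (g := fun k => K.pt R (s k) T ν) (B := B * ν.real T)
    (fun k => K.pt_int ν hR hRR (hs k) hT hTr) (fun k x => K.pt_nonneg ν hR hRR (hs k) x)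
    (fun x i j hij => by
      dsimp only [Ker.pt]
      have hi : ∀ k, IntegrableOn (fun y => K.G R (s k) y x) T ν := fun k =>
        ((K.G_cont hR hRR (hs k)).comp (continuous_id.prodMk continuous_const)).continuousOn.integrableOn_compact hT
      exact integral_mono (hi i) (hi j) fun y => K.G_anti hR hRR (hs j) (hsa i j hij))
    (fun k => hB (hs k) hT hTr ν)
  refine ⟨fun x => κ⁻¹ * G x, G1.const_mul _, fun x => mul_nonneg (by positivity) (G2 x), fun x hx => ?_, ?_, fun φ hφ hφc hφ0 => ?_⟩
  · show κ⁻¹ * G x = 0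
    rw [G3 x fun k => K.pt_zero ν hR hRR (hs k) hT hTr hx, mul_zero]
  · rw [integral_const_mul, mul_assoc]
    gcongr
    refine (hlow (hs 0) (hsm 0) hT hTr ν).trans ?_
    exact integral_mono_ae (K.pt_int ν hR hRR (hs 0) hT hTr) G1 (G5.mono fun x hx => hx 0)
  · have h2t : (2 : WithTop ℕ∞) ≤ ((⊤ : ℕ∞) : WithTop ℕ∞) := by norm_cast
    obtain ⟨Lp, hLp⟩ := ContDiff.lipschitzWith_of_hasCompactSupport hφc hφ (by norm_num)
    have hLc : Continuous (S.L φ) := L_cont S (hφ.of_le h2t)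
    obtain ⟨CL, hCL0, hCL⟩ := bdd_of_hcs hLc (L_hcs S hφc)
    have hlim : Tendsto (fun k => ∫ x, K.pt R (s k) T ν x * S.L φ x) atTop (𝓝 (∫ x, G x * S.L φ x)) := by
      refine tendsto_integral_of_dominated_convergence (fun x => G x * CL) (fun k => ?_) (G1.mul_const _) (fun k => ?_) ?_
      · exact ((K.pt_cont ν hR hRR (hs k) hT).mul hLc).aestronglyMeasurable
      · filter_upwards [G5] with x hx
        rw [norm_mul, Real.norm_eq_abs, Real.norm_eq_abs, abs_of_nonneg (K.pt_nonneg ν hR hRR (hs k) x)]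
        exact mul_le_mul (hx k) (hCL x) (abs_nonneg _) (G2 x)
      · filter_upwards [G4] with x hx
        exact hx.mul_const _
    have hlim2 : Tendsto (fun k => -(κ * ∫ y in T, φ y ∂ν) - Lp * (κ * √(s k)) * ν.real T) atTop
        (𝓝 (-(κ * ∫ y in T, φ y ∂ν) - Lp * (κ * √0) * ν.real T)) :=
      tendsto_const_nhds.sub (((((Real.continuous_sqrt.tendsto 0).comp hs0).const_mul κ).const_mul _).mul_const _)
    have h := le_of_tendsto_of_tendsto' hlim2 hlim fun k => hL hR hRR (hs k) hT hTr ν hφ hφc hφ0 hLp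
    rw [Real.sqrt_zero, mul_zero, mul_zero, zero_mul, sub_zero] at h
    simp_rw [mul_assoc]
    rw [integral_const_mul]
    have h3 := mul_le_mul_of_nonneg_left h (show 0 ≤ κ⁻¹ by positivity)
    rw [mul_neg, inv_mul_cancel_left₀ hκ.ne'] at h3
    exact h3
end

end pot

end APerron
end

open MeasureTheory Filter Topology Complex Metric

set_option linter.unusedSectionVars false
set_option linter.unusedSimpArgs false
set_option linter.unusedVariables false

noncomputable section

namespace APerron

open Module

section bal

variable {V : Type*} [NormedAddCommGroup V] [NormedSpace ℝ V] [FiniteDimensional ℝ V]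
  [MeasureSpace V] [BorelSpace V] [(volume : Measure V).IsAddHaarMeasure]
  {ι : Type*} [Fintype ι]
variable (S : EF V ι)

/-- existence of a function with `L` negative -/
theorem exists_neg (p : ι) : ∃ ℓ : V → ℝ, ContDiff ℝ (⊤ : ℕ∞) ℓ ∧
    ∀ (C : ℝ) x, S.L (fun y => C - ℓ y ^ 2) x < 0 := by
  classical
  set ℓ : V →L[ℝ] ℝ := LinearMap.toContinuousLinearMap (S.e.coord p) with hℓ
  have hd : ∀ i, S.d i ℓ = fun _ => if i = p then (1:ℝ) else 0 := by
    intro i; funext x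
    rw [EF.d, ContinuousLinearMap.fderiv]
    simp [hℓ, Finsupp.single_apply]
  have hL : ∀ x, S.L ℓ x = 0 := by
    intro x
    unfold EF.L
    refine Finset.sum_eq_zero fun i _ => Finset.sum_eq_zero fun j _ => ?_
    rw [hd j, d_const, mul_zero]
  refine ⟨ℓ, ℓ.contDiff, fun C x => ?_⟩
  have h := L_comp S (f := ℓ) ℓ.contDiff (g := fun t => C - t ^ 2) (g1 := fun t => -(2 * t)) (g2 := -2) (x := x)
    (Eventually.of_forall fun t => by
      have := ((hasDerivAt_id t).pow 2).const_sub C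
      simpa using this)
    (by
      have := ((hasDerivAt_id (ℓ x)).const_mul (2:ℝ)).neg
      rw [mul_one] at this
      exact this)
  rw [h, hL, mul_zero, zero_add]
  have hp := S.pos x (fun i => S.d i ℓ x) (by
    intro h0
    have := congrFun h0 p
    simp only [hd, if_true] at this
    simp at this)
  linarith

theorem zero_of_cs (p : ι) {D Q : Set V} (hD : IsOpen D) (hQ : IsCompact Q) (hQD : Q ⊆ D) {w : V → ℝ} (hw : WSub S D w)
    (h0 : ∀ x ∈ D, 0 ≤ w x) (hz : ∀ x ∉ Q, w x = 0) : ∀ᵐ x, x ∈ D → w x = 0 := by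
  obtain ⟨ℓ, hℓ, hneg⟩ := exists_neg S p
  obtain ⟨η, η1, η2, η3, η4, η5, O, hO, hQO, hη⟩ := cutoff hQ hD hQD
  obtain ⟨C, hC⟩ := η2.exists_bound_of_continuousOn (f := fun y => ℓ y ^ 2) (hℓ.continuous.pow 2).continuousOn
  have hφs : ContDiff ℝ (⊤ : ℕ∞) (fun y => η y * (C - ℓ y ^ 2)) := η1.mul (contDiff_const.sub (hℓ.pow 2))
  have hφc : HasCompactSupport (fun y => η y * (C - ℓ y ^ 2)) := HasCompactSupport.mul_right η2
  have hφt : tsupport (fun y => η y * (C - ℓ y ^ 2)) ⊆ D := (tsupport_mul_subset_left).trans η3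
  have h1 := hw.2 _ hφs hφc hφt fun y => by
    by_cases hy : y ∈ tsupport η
    · have := hC y hy
      rw [Real.norm_eq_abs] at this
      exact mul_nonneg (η4 y) (by linarith [le_abs_self (ℓ y ^ 2)])
    · rw [image_eq_zero_of_notMem_tsupport hy, zero_mul]
  have hi := WSub.int_mul_L S hw.1 hφs hφc hφt
  have hLn : ∀ x ∈ Q, S.L (fun y => η y * (C - ℓ y ^ 2)) x < 0 := by
    intro x hx
    rw [L_congr S (g := fun y => C - ℓ y ^ 2)]
    · exact hneg C x
    · filter_upwards [hO.mem_nhds (hQO hx)] with y hy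
      rw [hη y hy, one_mul]
  have hpos : ∀ x, 0 ≤ -(w x * S.L (fun y => η y * (C - ℓ y ^ 2)) x) := by
    intro x
    by_cases hx : x ∈ Q
    · have := mul_nonneg (h0 x (hQD hx)) (neg_nonneg.2 (hLn x hx).le)
      linarith
    · rw [hz x hx]; simp
  have h2 : ∫ x, -(w x * S.L (fun y => η y * (C - ℓ y ^ 2)) x) = 0 :=
    le_antisymm (by rw [integral_neg]; linarith) (integral_nonneg hpos)
  have h3 := (integral_eq_zero_iff_of_nonneg hpos hi.neg).1 h2
  filter_upwards [h3] with x hx _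
  by_cases hxQ : x ∈ Q
  · have h4 : w x * S.L (fun y => η y * (C - ℓ y ^ 2)) x = 0 := neg_eq_zero.1 hx
    exact (mul_eq_zero.1 h4).resolve_right (hLn x hxQ).ne
  · exact hz x hxQ

theorem balayage {n : ℕ} {r : ℝ} (K : Ker S n r) (hn : 1 ≤ n) (hN : Fintype.card ι = 2 * n) {D U K0 : Set V}
    (hD : IsOpen D) (hU : IsOpen U) (hUD : U ⊆ D) (hDr : D ⊆ closedBall 0 r) (hK0 : IsCompact K0) (hKU : K0 ⊆ U) :
    ∃ c : ℝ, 0 < c ∧ ∃ Q : Set V, IsCompact Q ∧ Q ⊆ U ∧ ∀ {u : V → ℝ} {M : ℝ}, WSub S D u → (∀ x ∈ D, -M ≤ u x) →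
      (∀ x ∈ D, u x ≤ 0) → ∃ g : V → ℝ, Integrable g ∧ (∀ x, 0 ≤ g x) ∧ (∀ x ∉ Q, g x = 0) ∧
        WSub S D (fun x => u x + g x) ∧ (∀ᵐ x, x ∈ D → u x + g x ≤ 0) ∧
        ∀ φ : V → ℝ, ContDiff ℝ (⊤ : ℕ∞) φ → HasCompactSupport φ → tsupport φ ⊆ K0 → ∀ B, (∀ x, |φ x| ≤ B) →
          c * |∫ x, u x * S.L φ x| ≤ B * ∫ x, g x := by
  have h2t : (2 : WithTop ℕ∞) ≤ ((⊤ : ℕ∞) : WithTop ℕ∞) := by norm_cast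
  obtain ⟨χ, χ1, χ2, χ3, χ4, χ5, O, hO, hKO, hχ⟩ := cutoff hK0 hU hKU
  obtain ⟨δ, hδ, hδU⟩ := χ2.exists_cthickening_subset_open hU χ3
  have hKC := K.Cpos
  have hR0 := K.R0_pos
  set R := min K.R0 (δ / K.C) with hRdef
  have hR : 0 < R := lt_min hR0 (by positivity)
  have hRR : R ≤ K.R0 := min_le_left _ _
  have hCR : K.C * R ≤ δ := by
    have : R ≤ δ / K.C := min_le_right _ _
    rwa [le_div_iff₀' hKC] at this
  obtain ⟨c, hc, hpot⟩ := K.potential hn hN hR hRR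
  refine ⟨c, hc, cthickening δ (tsupport χ), χ2.cthickening, hδU, fun {u M} hu hum hu0 => ?_⟩
  obtain ⟨ν, hν, hνT, hνf⟩ := exists_nu S hu χ1 χ2 (χ3.trans hUD) χ4
  have hνr : ν.restrict (tsupport χ) = ν := by
    apply Measure.restrict_eq_self_of_ae_mem
    rw [ae_iff]; exact hνT
  obtain ⟨g, g1, g2, g3, g4, g5⟩ := hpot (T := tsupport χ) χ2 ((χ3.trans hUD).trans hDr) ν
  rw [hνr] at g5
  have gz : ∀ x ∉ cthickening δ (tsupport χ), g x = 0 := by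
    intro x hx
    refine g3 x fun y hy => ?_
    by_contra hlt
    rw [not_le] at hlt
    apply hx
    refine mem_cthickening_of_dist_le x y δ _ hy ?_
    rw [dist_eq_norm]; linarith
  have hsum : WSub S D (fun x => u x + g x) := by
    refine ⟨hu.1.add (g1.locallyIntegrable.locallyIntegrableOn D), fun φ hφ hφc hφD hφ0 => ?_⟩
    have i1 := WSub.int_mul_L S hu.1 hφ hφc hφD
    have i2 := WSub.int_mul_L S (g1.locallyIntegrable.locallyIntegrableOn D) hφ hφc hφD
    have s1 : ContDiff ℝ (⊤ : ℕ∞) (fun y => χ y * φ y) := χ1.mul hφ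
    have s2 : ContDiff ℝ (⊤ : ℕ∞) (fun y => (1 - χ y) * φ y) := (contDiff_const.sub χ1).mul hφ
    have c1 : HasCompactSupport (fun y => χ y * φ y) := HasCompactSupport.mul_left hφc
    have c2 : HasCompactSupport (fun y => (1 - χ y) * φ y) := HasCompactSupport.mul_left hφc
    have t1 : tsupport (fun y => χ y * φ y) ⊆ D := tsupport_mul_subset_right.trans hφD
    have t2 : tsupport (fun y => (1 - χ y) * φ y) ⊆ D := tsupport_mul_subset_right.trans hφD
    have i3 := WSub.int_mul_L S hu.1 s1 c1 t1
    have i4 := WSub.int_mul_L S hu.1 s2 c2 t2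
    have hp := hu.2 _ s2 c2 t2 fun z => mul_nonneg (by linarith [χ5 z]) (hφ0 z)
    have hg := g5 φ hφ hφc hφ0
    rw [hνf φ hφ hφc] at hg
    have hsplit : ∫ x, u x * S.L φ x = (∫ x, u x * S.L (fun y => χ y * φ y) x) + ∫ x, u x * S.L (fun y => (1 - χ y) * φ y) x := by
      rw [← integral_add i3 i4]
      congr 1; funext x
      have := congrFun (L_add S (s1.of_le h2t) (s2.of_le h2t)) x
      rw [← mul_add, ← this]
      congr 2; funext y; ring
    simp_rw [add_mul]
    rw [integral_add i1 i2]
    linarith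
  have hp : Nonempty ι := by
    rw [← Fintype.card_pos_iff]; omega
  have hle : ∀ᵐ x, x ∈ D → u x + g x ≤ 0 := by
    have hk := kato S hD hsum (WSub.const S D 0) (c := -M) (M := 0)
      (Or.inl fun x hx => by linarith [hum x hx, g2 x]) (fun x _ => by simp)
    have hk' : WSub S D (D.indicator fun x => max (u x + g x) 0) :=
      hk.congr S hD (Eventually.of_forall fun x hx => by rw [Set.indicator_of_mem hx])
    have := zero_of_cs S hp.some hD χ2.cthickening (hδU.trans hUD) hk'
      (fun x hx => by rw [Set.indicator_of_mem hx]; exact le_max_right _ _)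
      (fun x hx => by
        by_cases hxD : x ∈ D
        · rw [Set.indicator_of_mem hxD, gz x hx, add_zero]
          exact max_eq_right (hu0 x hxD)
        · rw [Set.indicator_of_notMem hxD])
    filter_upwards [this] with x hx hxD
    have h := hx hxD
    rw [Set.indicator_of_mem hxD] at h
    rw [← h]; exact le_max_left _ _
  refine ⟨g, g1, g2, gz, hsum, hle, fun φ hφ hφc hφK B hB => ?_⟩
  have he : (fun y => χ y * φ y) = φ := by
    funext y
    by_cases hy : y ∈ tsupport φ
    · rw [hχ y (hKO (hφK hy)), one_mul]
    · rw [image_eq_zero_of_notMem_tsupport hy, mul_zero]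
  have h1 := hνf φ hφ hφc
  rw [he] at h1
  rw [← h1]
  have hB0 : 0 ≤ B := (abs_nonneg _).trans (hB 0)
  have h2 : |∫ x, φ x ∂ν| ≤ B * ν.real (tsupport χ) := by
    have h3 := norm_integral_le_of_norm_le_const (μ := ν) (f := φ) (C := B) (Eventually.of_forall hB)
    have h4 : ν.real (tsupport χ) = ν.real Set.univ := by
      rw [← measureReal_restrict_apply_univ, hνr]
    rw [h4]; exact h3
  calc c * |∫ x, φ x ∂ν| ≤ c * (B * ν.real (tsupport χ)) := by gcongr
    _ = B * (c * ν.real (tsupport χ)) := by ring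
    _ ≤ _ := by gcongr

end bal

end APerron
end

open MeasureTheory Filter Topology Complex Metric

set_option linter.unusedSectionVars false
set_option linter.unusedSimpArgs false
set_option linter.unusedVariables false

noncomputable section

namespace APerron

open Module

section perron

variable {V : Type*} [NormedAddCommGroup V] [NormedSpace ℝ V] [FiniteDimensional ℝ V]
  [MeasureSpace V] [BorelSpace V] [(volume : Measure V).IsAddHaarMeasure]
  {ι : Type*} [Fintype ι]
variable (S : EF V ι)

/-- the Perron class -/
def Cls (D E : Set V) (ψ : V → ℝ) : Set (V → ℝ) :=
  {u | WSub S D u ∧ SU D u ∧ (∀ z ∈ E, u z ≤ ψ z) ∧ ∀ z ∈ D, u z < 0}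

/-- the bounded Perron class -/
def BCls (D E : Set V) (ψ : V → ℝ) (M : ℝ) : Set (V → ℝ) :=
  {u | u ∈ Cls S D E ψ ∧ ∀ z ∈ D, -M ≤ u z}

variable {D E : Set V} {ψ : V → ℝ} {M : ℝ}

theorem BCls.abs {u : V → ℝ} (hu : u ∈ BCls S D E ψ M) : ∀ x ∈ D, |u x| ≤ M := fun x hx => by
  rw [abs_le]
  have h1 := hu.2 x hx
  have h2 := hu.1.2.2.2 x hx
  exact ⟨h1, by linarith⟩

theorem BCls.intOn (hD : IsOpen D) (hb : Bornology.IsBounded D) {u : V → ℝ} (hu : u ∈ BCls S D E ψ M) : IntegrableOn u D := by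
  rw [← integrable_indicator_iff hD.measurableSet]
  exact WSub.bdd_int hD hb hu.1.1.1 (BCls.abs S hu)

theorem BCls.const (hM : 0 < M) (hψ : ∀ z ∈ E, -M ≤ ψ z) : (fun _ => -M) ∈ BCls S D E ψ M :=
  ⟨⟨WSub.const S D _, SU.const _, hψ, fun _ _ => by linarith⟩, fun _ _ => le_rfl⟩

theorem Cls.max (hD : IsOpen D) {u v : V → ℝ} (hu : u ∈ Cls S D E ψ) (hv : v ∈ BCls S D E ψ M) :
    (fun x => max (u x) (v x)) ∈ BCls S D E ψ M :=
  ⟨⟨kato S hD hu.1 hv.1.1 (c := 0) (Or.inr fun x hx => (hu.2.2.2 x hx).le) (BCls.abs S hv),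
    hu.2.1.max hv.1.2.1, fun z hz => max_le (hu.2.2.1 z hz) (hv.1.2.2.1 z hz),
    fun z hz => max_lt (hu.2.2.2 z hz) (hv.1.2.2.2 z hz)⟩, fun z hz => (hv.2 z hz).trans (le_max_right _ _)⟩

/-- maximizing sequence -/
theorem exists_seq (hD : IsOpen D) (hb : Bornology.IsBounded D) (hM : 0 < M) (hψ : ∀ z ∈ E, -M ≤ ψ z) :
    ∃ (s : ℝ) (u : ℕ → V → ℝ), (∀ k, u k ∈ BCls S D E ψ M) ∧ (∀ x, Monotone fun k => u k x) ∧
      (∀ v ∈ BCls S D E ψ M, ∫ x in D, v x ≤ s) ∧ Tendsto (fun k => ∫ x in D, u k x) atTop (𝓝 s) := by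
  set I : Set ℝ := (fun v : V → ℝ => ∫ x in D, v x) '' BCls S D E ψ M with hI
  have hne : I.Nonempty := ⟨_, _, BCls.const S hM hψ, rfl⟩
  have hbd : BddAbove I := by
    refine ⟨0, ?_⟩
    rintro _ ⟨v, hv, rfl⟩
    exact setIntegral_nonpos hD.measurableSet fun x hx => (hv.1.2.2.2 x hx).le
  have hex : ∀ k : ℕ, ∃ v ∈ BCls S D E ψ M, sSup I - 1 / ((k:ℝ) + 1) < ∫ x in D, v x := by
    intro k
    obtain ⟨_, ⟨v, hv, rfl⟩, h⟩ := exists_lt_of_lt_csSup hne (show sSup I - 1 / ((k:ℝ) + 1) < sSup I by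
      have : 0 < 1 / ((k:ℝ) + 1) := by positivity
      linarith)
    exact ⟨v, hv, h⟩
  choose v hv hvI using hex
  set u : ℕ → V → ℝ := fun k => Nat.rec (v 0) (fun j f x => max (f x) (v (j + 1) x)) k with hu
  have hu1 : ∀ k, u (k + 1) = fun x => max (u k x) (v (k + 1) x) := fun k => rfl
  have hub : ∀ k, u k ∈ BCls S D E ψ M := by
    intro k
    induction k with
    | zero => exact hv 0
    | succ k ih => rw [hu1]; exact Cls.max S hD ih.1 (hv _)
  have huv : ∀ k x, v k x ≤ u k x := by
    intro k x
    cases k with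
    | zero => exact le_rfl
    | succ k => rw [hu1]; exact le_max_right _ _
  have hup : ∀ w ∈ BCls S D E ψ M, ∫ x in D, w x ≤ sSup I := fun w hw => le_csSup hbd ⟨w, hw, rfl⟩
  refine ⟨sSup I, u, hub, fun x => monotone_nat_of_le_succ fun k => by rw [hu1]; exact le_max_left _ _, hup, ?_⟩
  refine tendsto_of_tendsto_of_tendsto_of_le_of_le (g := fun k : ℕ => sSup I - 1 / ((k:ℝ) + 1)) ?_ tendsto_const_nhds
    (fun k => ?_) (fun k => hup _ (hub k))
  · have := (tendsto_one_div_add_atTop_nhds_zero_nat (𝕜 := ℝ)).const_sub (sSup I)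
    rwa [sub_zero] at this
  · exact (hvI k).le.trans (integral_mono (BCls.intOn S hD hb (hv k)) (BCls.intOn S hD hb (hub k)) (huv k))

/-- improvement of a member of the class -/
theorem improve {n : ℕ} {r : ℝ} (K : Ker S n r) (hn : 1 ≤ n) (hN : Fintype.card ι = 2 * n) (hED : E ⊆ D)
    (hD : IsOpen D) (hDr : D ⊆ closedBall 0 r) (hM : 0 < M) (hψ : ∀ z ∈ E, -M ≤ ψ z) {s : ℝ}
    (hs : ∀ v ∈ BCls S D E ψ M, ∫ x in D, v x ≤ s) {u g : V → ℝ} {Q : Set V} (hQ : IsCompact Q) (hQU : Q ⊆ D \ closure E)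
    (hu : u ∈ BCls S D E ψ M) (g1 : Integrable g) (g2 : ∀ x, 0 ≤ g x) (gz : ∀ x ∉ Q, g x = 0)
    (hsum : WSub S D (fun x => u x + g x)) (hle : ∀ᵐ x, x ∈ D → u x + g x ≤ 0) :
    ∫ x, g x ≤ s - ∫ x in D, u x := by
  have hb : Bornology.IsBounded D := isBounded_closedBall.subset hDr
  set v : V → ℝ := fun x => min (u x + g x) 0 with hv
  have hva : ∀ᵐ x, x ∈ D → u x + g x = v x := by
    filter_upwards [hle] with x hx hxD
    exact (min_eq_left (hx hxD)).symm
  have hvW : WSub S D v := hsum.congr S hD hva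
  have hvM : ∀ x ∈ D, |v x| ≤ M := fun x hx => by
    rw [abs_le]
    exact ⟨le_min (by linarith [hu.2 x hx, g2 x]) (by linarith), (min_le_right _ _).trans hM.le⟩
  have hae := ess_ae_eq K hn hN hD hDr hvW hvM
  have hSU := ess_SU hD hvM hae
  have heW : WSub S D (ess v) := hvW.congr S hD (hae.mono fun x hx hxD => (hx hxD).symm)
  have he0 : ∀ x ∈ D, ess v x ≤ 0 := fun x hx =>
    ess_le hD hvM hx (Eventually.of_forall fun y => min_le_right _ _)
  have heE : ∀ z ∈ E, ess v z ≤ ψ z := by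
    intro z hz
    have hzD := hED hz
    refine le_trans ?_ (hu.1.2.2.1 z hz)
    refine le_of_forall_gt_imp_ge_of_dense fun c hc => ?_
    refine ess_le hD hvM hzD ?_
    have h1 := (hu.1.2.1 z hzD).1 c hc
    have h2 : ∀ᶠ x in 𝓝 z, x ∉ Q := hQ.isClosed.isOpen_compl.mem_nhds fun hzQ => (hQU hzQ).2 (subset_closure hz)
    have h3 : ∀ᶠ x in 𝓝 z, v x ≤ c := by
      filter_upwards [h1, h2] with x hx1 hx2
      refine (min_le_left _ _).trans ?_
      rw [gz x hx2, add_zero]; exact hx1.le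
    exact h3.filter_mono inf_le_left
  have hgD : ∫ x in D, g x = ∫ x, g x :=
    setIntegral_eq_integral_of_forall_compl_eq_zero fun x hx => gz x fun hxQ => hx (hQU hxQ).1
  have key : ∀ δ : ℝ, 0 < δ → ∫ x, g x ≤ s - (∫ x in D, u x) + δ * volume.real D := by
    intro δ hδ
    have hmem : (fun x => ess v x + -δ) ∈ Cls S D E ψ :=
      ⟨heW.add S (WSub.const S D (-δ)), hSU.add_const (-δ), fun z hz => by linarith [heE z hz],
        fun z hz => by linarith [he0 z hz]⟩
    have hB := Cls.max S hD hmem (BCls.const S (D := D) hM hψ)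
    have h1 := hs _ hB
    have iu := BCls.intOn S hD hb hu
    have ic : IntegrableOn (fun _ : V => -δ) D := integrableOn_const hb.measure_lt_top.ne
    have h2 : ∫ x in D, (u x + g x + -δ) ≤ ∫ x in D, max (ess v x + -δ) (-M) := by
      refine integral_mono_ae ((iu.add g1.integrableOn).add ic) (BCls.intOn S hD hb hB) ?_
      rw [EventuallyLE, ae_restrict_iff' hD.measurableSet]
      filter_upwards [hva, hae] with x h3 h4 hx
      rw [h3 hx, ← h4 hx]
      exact le_max_left _ _
    have h5 : ∫ x in D, (u x + g x + -δ) = (∫ x in D, u x) + (∫ x in D, g x) - δ * volume.real D := by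
      have e1 := integral_add (iu.add g1.integrableOn) ic
      have e2 := integral_add iu g1.integrableOn
      simp only [Pi.add_apply] at e1
      rw [e1, e2, setIntegral_const, smul_eq_mul]
      ring
    linarith
  by_contra hlt
  rw [not_le] at hlt
  have hv0 : 0 ≤ volume.real D := measureReal_nonneg
  set ε := (∫ x, g x) - (s - ∫ x in D, u x) with hε
  have hε0 : 0 < ε := by linarith
  have := key (ε / (2 * (volume.real D + 1))) (by positivity)
  have h6 : ε / (2 * (volume.real D + 1)) * volume.real D < ε := by
    rw [div_mul_eq_mul_div, div_lt_iff₀ (by positivity)]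
    nlinarith
  linarith

/-- Perron method -/
theorem perron {n : ℕ} {r : ℝ} (K : Ker S n r) (hn : 1 ≤ n) (hN : Fintype.card ι = 2 * n) (hED : E ⊆ D)
    (hD : IsOpen D) (hDr : D ⊆ closedBall 0 r) (hM : 0 < M) (hψ : ∀ z ∈ E, -M ≤ ψ z) :
    ∃ w : V → ℝ, LocallyIntegrableOn w D ∧
      (∀ᵐ z, z ∈ D → limsup (fun y => sSup ((fun u : V → ℝ => u y) '' Cls S D E ψ)) (𝓝 z) = w z) ∧
      ∀ φ : V → ℝ, ContDiff ℝ (⊤ : ℕ∞) φ → HasCompactSupport φ → tsupport φ ⊆ D \ closure E →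
        ∫ x, w x * S.L φ x = 0 := by
  have h2t : (2 : WithTop ℕ∞) ≤ ((⊤ : ℕ∞) : WithTop ℕ∞) := by norm_cast
  have hb : Bornology.IsBounded D := isBounded_closedBall.subset hDr
  obtain ⟨s, u, hu, hmono, hs, hlim⟩ := exists_seq S hD hb hM hψ
  set w : V → ℝ := fun x => ⨆ k, u k x with hw
  have hbdd : ∀ x ∈ D, BddAbove (Set.range fun k => u k x) := fun x hx => ⟨0, by
    rintro _ ⟨k, rfl⟩; exact ((hu k).1.2.2.2 x hx).le⟩
  have hwt : ∀ x ∈ D, Tendsto (fun k => u k x) atTop (𝓝 (w x)) := fun x hx => tendsto_atTop_ciSup (hmono x) (hbdd x hx)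
  have huw : ∀ x ∈ D, ∀ k, u k x ≤ w x := fun x hx k => le_ciSup (hbdd x hx) k
  have hwM : ∀ x ∈ D, |w x| ≤ M := fun x hx => by
    rw [abs_le]
    exact ⟨((hu 0).2 x hx).trans (huw x hx 0), ciSup_le fun k => (((hu k).1.2.2.2 x hx).le).trans hM.le⟩
  have hwm : AEStronglyMeasurable w (volume.restrict D) := by
    refine aestronglyMeasurable_of_tendsto_ae atTop (f := fun k => u k) (fun k => (BCls.intOn S hD hb (hu k)).aestronglyMeasurable) ?_
    exact (ae_restrict_mem hD.measurableSet).mono fun x hx => hwt x hx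
  have hwI : IntegrableOn w D := by
    refine Integrable.mono' (g := fun _ => M) (integrableOn_const hb.measure_lt_top.ne) hwm ?_
    exact (ae_restrict_mem hD.measurableSet).mono fun x hx => hwM x hx
  have hwL : LocallyIntegrableOn w D := hwI.locallyIntegrableOn
  have htest : ∀ φ : V → ℝ, ContDiff ℝ (⊤ : ℕ∞) φ → HasCompactSupport φ → tsupport φ ⊆ D →
      Tendsto (fun k => ∫ x, u k x * S.L φ x) atTop (𝓝 (∫ x, w x * S.L φ x)) := by
    intro φ hφ hφc hφD
    have hLc := L_cont S (hφ.of_le h2t)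
    refine tendsto_integral_of_dominated_convergence (fun x => M * |S.L φ x|) (fun k => ?_) ?_ (fun k => ?_) ?_
    · exact (WSub.int_mul_L S (hu k).1.1.1 hφ hφc hφD).aestronglyMeasurable
    · exact ((hLc.integrable_of_hasCompactSupport (L_hcs S hφc)).abs).const_mul M
    · refine Eventually.of_forall fun x => ?_
      rw [norm_mul, Real.norm_eq_abs, Real.norm_eq_abs]
      by_cases hx : x ∈ D
      · exact mul_le_mul_of_nonneg_right (BCls.abs S (hu k) x hx) (abs_nonneg _)
      · rw [image_eq_zero_of_notMem_tsupport fun h => hx (hφD (L_tsupport S h))]; simp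
    · refine Eventually.of_forall fun x => ?_
      by_cases hx : x ∈ D
      · exact (hwt x hx).mul_const _
      · rw [image_eq_zero_of_notMem_tsupport fun h => hx (hφD (L_tsupport S h))]; simp
  have hwW : WSub S D w := ⟨hwL, fun φ hφ hφc hφD hφ0 =>
    ge_of_tendsto' (htest φ hφ hφc hφD) fun k => (hu k).1.1.2 φ hφ hφc hφD hφ0⟩
  have hae := ess_ae_eq K hn hN hD hDr hwW hwM
  have hmax : ∀ v ∈ BCls S D E ψ M, ∀ᵐ x, x ∈ D → v x ≤ w x := by
    intro v hv
    have iv := BCls.intOn S hD hb hv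
    have i0 : IntegrableOn (fun x => max (v x - w x) 0) D := (iv.sub hwI).pos_part
    have h1 : ∀ k, ∫ x in D, max (v x - w x) 0 ≤ s - ∫ x in D, u k x := by
      intro k
      have hm := Cls.max S hD hv.1 (hu k)
      have h2 := hs _ hm
      have iu := BCls.intOn S hD hb (hu k)
      have im := BCls.intOn S hD hb hm
      have h3 : ∫ x in D, max (v x - w x) 0 ≤ ∫ x in D, (max (v x) (u k x) - u k x) := by
        refine setIntegral_mono_on i0 (im.sub iu) hD.measurableSet fun x hx => ?_
        refine max_le ?_ (by linarith [le_max_right (v x) (u k x)])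
        linarith [le_max_left (v x) (u k x), huw x hx k]
      rw [integral_sub im iu] at h3
      linarith
    have h4 : ∫ x in D, max (v x - w x) 0 ≤ 0 := by
      have := hlim.const_sub s
      rw [sub_self] at this
      exact ge_of_tendsto' this h1
    have h5 : ∫ x in D, max (v x - w x) 0 = 0 := le_antisymm h4 (integral_nonneg fun x => le_max_right _ _)
    have h6 := (integral_eq_zero_iff_of_nonneg (fun x => le_max_right _ _) i0).1 h5
    rw [EventuallyEq, ae_restrict_iff' hD.measurableSet] at h6
    filter_upwards [h6] with x hx hxD
    have h7 := hx hxD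
    have h8 := le_max_left (v x - w x) 0
    simp only [Pi.zero_apply] at h7
    linarith
  have hall : ∀ v ∈ Cls S D E ψ, ∀ x ∈ D, v x ≤ ess w x := by
    intro v hv x hx
    have hm := Cls.max S hD hv (BCls.const S (D := D) hM hψ)
    exact (le_max_left _ _).trans (hm.1.2.1.le_ess' hD hwM hx (hmax _ hm))
  set Om : V → ℝ := fun y => sSup ((fun u : V → ℝ => u y) '' Cls S D E ψ) with hOm
  have hOb : ∀ x ∈ D, BddAbove ((fun u : V → ℝ => u x) '' Cls S D E ψ) := fun x hx => ⟨0, by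
    rintro _ ⟨v, hv, rfl⟩; exact (hv.2.2.2 x hx).le⟩
  have hO1 : ∀ v ∈ Cls S D E ψ, ∀ x ∈ D, v x ≤ Om x := fun v hv x hx => le_csSup (hOb x hx) ⟨v, hv, rfl⟩
  have hO2 : ∀ x ∈ D, Om x ≤ ess w x := fun x hx => csSup_le ⟨_, _, (hu 0).1, rfl⟩ (by
    rintro _ ⟨v, hv, rfl⟩; exact hall v hv x hx)
  have hcob : ∀ z ∈ D, IsCoboundedUnder (· ≤ ·) (𝓝 z) Om := by
    intro z hz
    refine IsBoundedUnder.isCoboundedUnder_le ⟨-M, ?_⟩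
    rw [eventually_map]
    filter_upwards [hD.mem_nhds hz] with x hx
    exact ((hu 0).2 x hx).trans (hO1 _ (hu 0).1 x hx)
  have hbu : ∀ z ∈ D, IsBoundedUnder (· ≤ ·) (𝓝 z) Om := by
    intro z hz
    refine ⟨M, ?_⟩
    rw [eventually_map]
    filter_upwards [hD.mem_nhds hz] with x hx
    exact (hO2 x hx).trans ((le_abs_self _).trans (ess_abs hD hwM hx))
  refine ⟨w, hwL, ?_, fun φ hφ hφc hφU => ?_⟩
  · filter_upwards [hae] with z hz hzD
    refine le_antisymm ?_ ?_
    · rw [← hz hzD]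
      refine le_of_forall_gt_imp_ge_of_dense fun c hc => ?_
      refine limsup_le_of_le (hcob z hzD) ?_
      filter_upwards [ess_usc hD hwM hzD hc, hD.mem_nhds hzD] with x hx hxD
      exact (hO2 x hxD).trans hx.le
    · refine ciSup_le fun k => ?_
      refine le_of_forall_lt_imp_le_of_dense fun c hc => ?_
      refine le_limsup_of_frequently_le ?_ (hbu z hzD)
      have h1 := ((hu k).1.2.1 z hzD).2 c hc
      have h2 : ∃ᶠ x in 𝓝 z, c < u k x := h1.filter_mono inf_le_left
      exact (h2.and_eventually (hD.mem_nhds hzD)).mono fun x hx => hx.1.le.trans (hO1 _ (hu k).1 x hx.2)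
  · obtain ⟨c, hc, Q, hQ, hQU, hbal⟩ := balayage S K hn hN hD (hD.sdiff isClosed_closure) Set.sdiff_subset hDr hφc.isCompact hφU
    obtain ⟨B, hB0, hB⟩ := bdd_of_hcs hφ.continuous hφc
    have hk : ∀ k, c * |∫ x, u k x * S.L φ x| ≤ B * (s - ∫ x in D, u k x) := by
      intro k
      obtain ⟨g, g1, g2, gz, g3, g4, g5⟩ := hbal (hu k).1.1 (hu k).2 fun x hx => ((hu k).1.2.2.2 x hx).le
      refine (g5 φ hφ hφc subset_rfl B hB).trans ?_
      gcongr
      exact improve S K hn hN hED hD hDr hM hψ hs hQ hQU (hu k) g1 g2 gz g3 g4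
    have l1 := ((htest φ hφ hφc (hφU.trans Set.sdiff_subset)).abs).const_mul c
    have l2 := (hlim.const_sub s).const_mul B
    rw [sub_self, mul_zero] at l2
    have h := le_of_tendsto_of_tendsto' l1 l2 hk
    have h3 : |∫ x, w x * S.L φ x| ≤ 0 := by
      by_contra hlt
      rw [not_le] at hlt
      nlinarith [mul_pos hc hlt]
    exact abs_nonpos_iff.1 h3

end perron

end APerron
end

open MeasureTheory Filter Topology Complex Metric

set_option linter.unusedSectionVars false
set_option linter.unusedSimpArgs false
set_option linter.unusedVariables false

noncomputable section

namespace APerron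

open Module

section real

variable {n : ℕ}

instance haarCn : (volume : Measure (Cn n)).IsAddHaarMeasure := inferInstance

/-- coefficients of the real form -/
def rot (s t : Fin 2) (z : ℂ) : ℝ :=
  if s = 0 then (if t = 0 then z.re else -z.im) else (if t = 0 then z.im else z.re)

theorem fd_re {F : Cn n → ℂ} {z : Cn n} (h : DifferentiableAt ℝ F z) (v : Cn n) :
    fderiv ℝ (fun w => (F w).re) z v = (fderiv ℝ F z v).re := by
  have h1 : HasFDerivAt (fun w => (F w).re) (Complex.reCLM.comp (fderiv ℝ F z)) z := Complex.reCLM.hasFDerivAt.comp z h.hasFDerivAt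
  rw [h1.fderiv]; rfl

theorem fd_im {F : Cn n → ℂ} {z : Cn n} (h : DifferentiableAt ℝ F z) (v : Cn n) :
    fderiv ℝ (fun w => (F w).im) z v = (fderiv ℝ F z v).im := by
  have h1 : HasFDerivAt (fun w => (F w).im) (Complex.imCLM.comp (fderiv ℝ F z)) z := Complex.imCLM.hasFDerivAt.comp z h.hasFDerivAt
  rw [h1.fderiv]; rfl

theorem fd_ofReal {f : Cn n → ℝ} {z : Cn n} (h : DifferentiableAt ℝ f z) (v : Cn n) :
    fderiv ℝ (fun w => (f w : ℂ)) z v = (fderiv ℝ f z v : ℂ) := by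
  have h1 : HasFDerivAt (fun w => (f w : ℂ)) (Complex.ofRealCLM.comp (fderiv ℝ f z)) z := Complex.ofRealCLM.hasFDerivAt.comp z h.hasFDerivAt
  rw [h1.fderiv]; rfl

/-- the real basis of `ℂⁿ` -/
def rbasis (n : ℕ) : Basis (Σ _ : Fin n, Fin 2) ℝ (Cn n) := Pi.basis fun _ => Complex.basisOneI

theorem rbasis0 (j : Fin n) : rbasis n ⟨j, 0⟩ = Pi.single j 1 := by
  simp [rbasis, Pi.basis_apply]

theorem rbasis1 (j : Fin n) : rbasis n ⟨j, 1⟩ = Pi.single j Complex.I := by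
  simp [rbasis, Pi.basis_apply]

theorem rot_contDiff (A : AlphaForm n) (j k : Fin n) (s t : Fin 2) :
    ContDiff ℝ 1 (fun z => (1 / 4 : ℝ) * rot s t (A.coeff j k z)) := by
  have h1 : ContDiff ℝ 1 fun z => (A.coeff j k z).re := Complex.reCLM.contDiff.comp (A.contDiff j k)
  have h2 : ContDiff ℝ 1 fun z => (A.coeff j k z).im := Complex.imCLM.contDiff.comp (A.contDiff j k)
  refine contDiff_const.mul ?_
  unfold rot
  fin_cases s <;> fin_cases t <;> simp [h1, h2, h2.neg]

/-- the real form -/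
def rform (A : AlphaForm n) : EF (Cn n) (Σ _ : Fin n, Fin 2) where
  e := rbasis n
  a p q z := (1 / 4 : ℝ) * rot p.2 q.2 (A.coeff p.1 q.1 z)
  smooth p q := rot_contDiff A p.1 q.1 p.2 q.2
  symm := by
    rintro ⟨j, s⟩ ⟨k, t⟩ x
    have h := A.hermitian j k x
    unfold rot
    fin_cases s <;> fin_cases t <;> simp [h]
  pos := by
    intro x ξ hξ
    have hz : (fun j => ((ξ ⟨j, 0⟩ : ℝ) : ℂ) - Complex.I * ((ξ ⟨j, 1⟩ : ℝ) : ℂ)) ≠ 0 := by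
      intro h0
      apply hξ
      funext ⟨j, s⟩
      have h1 := congrFun h0 j
      have hr := congrArg Complex.re h1
      have hi := congrArg Complex.im h1
      simp at hr hi
      fin_cases s
      · simpa using hr
      · simpa using hi
    have h := A.strictlyPositive x _ hz
    have e : (∑ p, ∑ q, (1 / 4 : ℝ) * rot p.2 q.2 (A.coeff p.1 q.1 x) * ξ p * ξ q) =
        (1 / 4) * (∑ j, ∑ k, A.coeff j k x * (((ξ ⟨j, 0⟩ : ℝ) : ℂ) - Complex.I * ((ξ ⟨j, 1⟩ : ℝ) : ℂ)) *
          starRingEnd ℂ (((ξ ⟨k, 0⟩ : ℝ) : ℂ) - Complex.I * ((ξ ⟨k, 1⟩ : ℝ) : ℂ))).re := by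
      rw [Fintype.sum_sigma, Complex.re_sum, Finset.mul_sum]
      refine Finset.sum_congr rfl fun j _ => ?_
      rw [Fin.sum_univ_two, Fintype.sum_sigma, Fintype.sum_sigma, Complex.re_sum, Finset.mul_sum, ← Finset.sum_add_distrib]
      refine Finset.sum_congr rfl fun k _ => ?_
      rw [Fin.sum_univ_two, Fin.sum_univ_two]
      simp [rot]
      ring
    rw [e]; linarith
  div := by
    rintro ⟨k, t⟩ x
    have h := A.closed k x
    have hd : ∀ j, DifferentiableAt ℝ (A.coeff j k) x := fun j => (A.contDiff j k).differentiable (by norm_num) x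
    have hre : ∀ j, DifferentiableAt ℝ (fun z => (A.coeff j k z).re) x := fun j => Complex.reCLM.differentiableAt.comp x (hd j)
    have him : ∀ j, DifferentiableAt ℝ (fun z => (A.coeff j k z).im) x := fun j => Complex.imCLM.differentiableAt.comp x (hd j)
    have h1 := congrArg Complex.re h
    have h2 := congrArg Complex.im h
    rw [Complex.re_sum] at h1
    rw [Complex.im_sum] at h2
    unfold wdz at h1 h2
    rw [Fintype.sum_sigma]
    simp only [Fin.sum_univ_two, rbasis0, rbasis1]
    fin_cases t
    · have : ∀ j, fderiv ℝ (fun z => (1 / 4 : ℝ) * rot 0 0 (A.coeff j k z)) x (Pi.single j 1) +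
          fderiv ℝ (fun z => (1 / 4 : ℝ) * rot 1 0 (A.coeff j k z)) x (Pi.single j Complex.I) =
          (1 / 2) * ((fderiv ℝ (A.coeff j k) x (Pi.single j 1) - Complex.I * fderiv ℝ (A.coeff j k) x (Pi.single j Complex.I)) / 2).re := by
        intro j
        simp only [rot, if_true, one_ne_zero, if_false]
        rw [fderiv_const_mul (hre j), fderiv_const_mul (him j)]
        simp only [smul_apply, smul_eq_mul, fd_re (hd j), fd_im (hd j)]
        simp
        ring
      refine (Finset.sum_congr rfl fun j _ => this j).trans ?_
      rw [← Finset.mul_sum, h1]; simp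
    · have : ∀ j, fderiv ℝ (fun z => (1 / 4 : ℝ) * rot 0 1 (A.coeff j k z)) x (Pi.single j 1) +
          fderiv ℝ (fun z => (1 / 4 : ℝ) * rot 1 1 (A.coeff j k z)) x (Pi.single j Complex.I) =
          -(1 / 2) * ((fderiv ℝ (A.coeff j k) x (Pi.single j 1) - Complex.I * fderiv ℝ (A.coeff j k) x (Pi.single j Complex.I)) / 2).im := by
        intro j
        simp only [rot, if_true, one_ne_zero, if_false]
        have hin : DifferentiableAt ℝ (fun z => -(A.coeff j k z).im) x := (him j).neg
        rw [fderiv_const_mul (hre j), fderiv_const_mul hin, fderiv_fun_neg]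
        simp only [smul_apply, neg_apply, smul_eq_mul, fd_re (hd j), fd_im (hd j)]
        simp
        ring
      refine (Finset.sum_congr rfl fun j _ => this j).trans ?_
      rw [← Finset.mul_sum, h2]; simp

theorem alphaOpR_eq (A : AlphaForm n) {ω : Cn n → ℝ} (hω : ContDiff ℝ 2 ω) : alphaOpR A ω = (rform A).L ω := by
  funext z
  set S := rform A with hS
  have hd1 : ∀ p, ContDiff ℝ 1 (S.d p ω) := fun p => by
    have : S.d p ω = fun x => fderiv ℝ ω x (S.e p) := rfl
    rw [this]
    exact (hω.fderiv_right (m := 1) (by norm_num)).clm_apply contDiff_const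
  have hw : ∀ j, wdz j (fun w => (ω w : ℂ)) = fun w => ((S.d ⟨j, 0⟩ ω w : ℂ) - Complex.I * (S.d ⟨j, 1⟩ ω w : ℂ)) / 2 := by
    intro j; funext w
    have hdw : DifferentiableAt ℝ ω w := hω.differentiable (by norm_num) w
    unfold wdz
    rw [fd_ofReal hdw, fd_ofReal hdw, ← rbasis0, ← rbasis1]
    rfl
  have hF : ∀ j v, fderiv ℝ (fun w => ((S.d ⟨j, 0⟩ ω w : ℂ) - Complex.I * (S.d ⟨j, 1⟩ ω w : ℂ)) / 2) z v =
      ((fderiv ℝ (S.d ⟨j, 0⟩ ω) z v : ℂ) - Complex.I * (fderiv ℝ (S.d ⟨j, 1⟩ ω) z v : ℂ)) / 2 := by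
    intro j v
    have d0 : DifferentiableAt ℝ (S.d ⟨j, 0⟩ ω) z := (hd1 _).differentiable (by norm_num) z
    have d1 : DifferentiableAt ℝ (S.d ⟨j, 1⟩ ω) z := (hd1 _).differentiable (by norm_num) z
    have c0 : HasFDerivAt (fun w => (S.d ⟨j, 0⟩ ω w : ℂ)) (Complex.ofRealCLM.comp (fderiv ℝ (S.d ⟨j, 0⟩ ω) z)) z :=
      Complex.ofRealCLM.hasFDerivAt.comp z d0.hasFDerivAt
    have c1 : HasFDerivAt (fun w => (S.d ⟨j, 1⟩ ω w : ℂ)) (Complex.ofRealCLM.comp (fderiv ℝ (S.d ⟨j, 1⟩ ω) z)) z :=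
      Complex.ofRealCLM.hasFDerivAt.comp z d1.hasFDerivAt
    have c2 := (c0.sub (c1.const_mul Complex.I)).const_mul ((2:ℂ)⁻¹)
    have c3 : HasFDerivAt (fun w => ((S.d ⟨j, 0⟩ ω w : ℂ) - Complex.I * (S.d ⟨j, 1⟩ ω w : ℂ)) / 2) _ z :=
      c2.congr_of_eventuallyEq (Eventually.of_forall fun w => by simp [div_eq_inv_mul])
    rw [c3.fderiv]
    simp [div_eq_inv_mul]
  have hL : S.L ω z = ∑ p, ∑ q, S.a p q z * S.d q (S.d p ω) z := by
    unfold EF.L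
    rw [Finset.sum_comm]
    refine Finset.sum_congr rfl fun p _ => Finset.sum_congr rfl fun q _ => ?_
    rw [S.symm]
  rw [hL, alphaOpR, alphaOp, Fintype.sum_sigma, Complex.re_sum]
  refine Finset.sum_congr rfl fun j _ => ?_
  rw [Fin.sum_univ_two, Fintype.sum_sigma, Fintype.sum_sigma, Complex.re_sum, ← Finset.sum_add_distrib]
  refine Finset.sum_congr rfl fun k _ => ?_
  rw [Fin.sum_univ_two, Fin.sum_univ_two, hw]
  unfold wdzbar
  rw [hF, hF, ← rbasis0, ← rbasis1]
  have hdd : ∀ p f, S.d p f z = fderiv ℝ f z (rbasis n p) := fun p f => rfl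
  have ha : ∀ p q, S.a p q z = (1 / 4 : ℝ) * rot p.2 q.2 (A.coeff p.1 q.1 z) := fun p q => rfl
  simp only [hdd ⟨k, 0⟩, hdd ⟨k, 1⟩, ha]
  simp [rot]
  ring

end real

end APerron
end

open MeasureTheory Filter Topology Complex Metric

set_option linter.unusedSectionVars false
set_option linter.unusedSimpArgs false
set_option linter.unusedVariables false

noncomputable section

namespace APerron

open Module

section final

variable {n : ℕ}

theorem int_D (A : AlphaForm n) {D : Set (Cn n)} {ω u : Cn n → ℝ} (hω : ContDiff ℝ (⊤ : ℕ∞) ω) (hD : tsupport ω ⊆ D) :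
    ∫ z in D, u z * alphaOpR A ω z = ∫ z, u z * (rform A).L ω z := by
  rw [alphaOpR_eq A (hω.of_le (by norm_cast))]
  refine setIntegral_eq_integral_of_forall_compl_eq_zero fun x hx => ?_
  rw [image_eq_zero_of_notMem_tsupport fun h => hx (hD (L_tsupport (rform A) h)), mul_zero]

theorem sub_iff (A : AlphaForm n) {D : Set (Cn n)} (hD : IsOpen D) (u : Cn n → ℝ) :
    IsAlphaSubharmonic A D u ↔ WSub (rform A) D u ∧ SU D u := by
  rw [SU.iff hD]
  unfold IsAlphaSubharmonic IsAlphaSubharmonicE WSub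
  simp only [EReal.toReal_coe]
  constructor
  · rintro ⟨h1, h2, h3, h4, h5⟩
    exact ⟨⟨h4, fun φ hφ hφc hφD hφ0 => by rw [← int_D A hφ hφD]; exact h5 φ hφ hφc hφD hφ0⟩, h2, h3⟩
  · rintro ⟨⟨h4, h5⟩, h2, h3⟩
    exact ⟨fun z _ => EReal.coe_ne_top _, h2, h3, h4, fun φ hφ hφc hφD hφ0 => by
      rw [int_D A hφ hφD]; exact h5 φ hφ hφc hφD hφ0⟩

theorem Uclass_eq (A : AlphaForm n) {D E : Set (Cn n)} (hD : IsOpen D) (ψ : Cn n → ℝ) :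
    Uclass A E D ψ = Cls (rform A) D E ψ := by
  ext u
  unfold Uclass Cls
  simp only [Set.mem_ofPred_eq, sub_iff A hD, and_assoc]

theorem main (A : AlphaForm n) (D E : Set (Cn n)) (hD : IsOpen D) (hb : Bornology.IsBounded D) (hE : E ⊆ D) (ψ : Cn n → ℝ)
    (hbd : ∃ C : ℝ, ∀ z ∈ E, |ψ z| ≤ C) : IsAlphaHarmonicOn A (D \ closure E) (omegaWStar A E D ψ) := by
  rcases Nat.eq_zero_or_pos n with rfl | hn
  · refine ⟨?_, fun ω _ _ _ => ?_⟩
    · have : omegaWStar A E D ψ = fun _ => omegaWStar A E D ψ 0 := by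
        funext z; rw [Subsingleton.elim z 0]
      rw [this]
      exact (locallyIntegrable_const _).locallyIntegrableOn _
    · simp [alphaOpR, alphaOp]
  · obtain ⟨C, hC⟩ := hbd
    obtain ⟨r, hr⟩ := hb.subset_closedBall (0 : Cn n)
    have hN : Fintype.card (Σ _ : Fin n, Fin 2) = 2 * n := by simp [mul_comm]
    obtain ⟨K⟩ := exists_ker (rform A) hn hN r
    obtain ⟨w, w1, w2, w3⟩ := perron (rform A) K hn hN hE hD hr (M := |C| + 1) (ψ := ψ) (by positivity)
      (fun z hz => by linarith [(abs_le.1 (hC z hz)).1, le_abs_self C])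
    rw [← Uclass_eq A hD] at w2
    have w2' : ∀ᵐ z, z ∈ D → omegaWStar A E D ψ z = w z := w2
    have hUm : MeasurableSet (D \ closure E) := hD.measurableSet.diff isClosed_closure.measurableSet
    refine ⟨?_, fun ω hω hωc hωU => ?_⟩
    · intro x hx
      obtain ⟨s, hs, hi⟩ := w1 x hx.1
      have hDn : D ∈ 𝓝[D \ closure E] x := mem_nhdsWithin_of_mem_nhds (hD.mem_nhds hx.1)
      refine ⟨s ∩ D, inter_mem (nhdsWithin_mono x Set.sdiff_subset hs) hDn, ?_⟩
      have hi' : IntegrableOn w (s ∩ D) := hi.mono_set Set.inter_subset_left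
      refine hi'.congr_fun_ae ?_
      have h1 : ∀ᵐ z, z ∈ s ∩ D → w z = omegaWStar A E D ψ z := w2'.mono fun z hz hzs => (hz hzs.2).symm
      have h2 : ∀ᵐ z ∂(volume.restrict D), w z = omegaWStar A E D ψ z := by
        rw [ae_restrict_iff' hD.measurableSet]
        exact w2'.mono fun z hz hzs => (hz hzs).symm
      exact ae_mono (Measure.restrict_mono_set _ Set.inter_subset_right) h2
    · have e : ∫ z in D \ closure E, omegaWStar A E D ψ z * alphaOpR A ω z =
          ∫ z in D \ closure E, w z * alphaOpR A ω z := by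
        refine setIntegral_congr_ae hUm (w2'.mono fun z hz hzU => ?_)
        rw [hz hzU.1]
      rw [e, int_D A hω hωU]
      exact w3 ω hω hωc hωU

end final

end APerron
end

/-- The weighted `α`-subharmonic measure `ω*_α(·,E,D,ψ)` is
`α`-harmonic on `D \ closure E`, i.e. `dd^c u ∧ α = 0` there. -/
theorem weighted_measure_alpha_harmonic {n : ℕ} (A : AlphaForm n) (D E : Set (Cn n))
    (hD : IsAlphaRegularDomain A D) (hE : E ⊆ D) (ψ : Cn n → ℝ)
    (hbd : ∃ C : ℝ, ∀ z ∈ E, |ψ z| ≤ C) (hsup : ∃ c < (0 : ℝ), ∀ z ∈ E, ψ z ≤ c) :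
    IsAlphaHarmonicOn A (D \ closure E) (omegaWStar A E D ψ) := by
  exact APerron.main A D E hD.1 hD.2.2.1 hE ψ hbd
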